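/- arXiv:2410.08366 — 3 statements merged into one kernel-verified Lean document; each statement's English description precedes it below -/
import Mathlib

section
/- Let n ≥ 2 and 1 ≤ m ≤ n, and let R be the subring of ∏_{w ∈ S_n} ℤ[t_1,…,t_n] of tuples satisfying the GKM divisibility conditions for h' = ((n−1)^{n−m}, n^m). Then the quotient of R by the ideal generated by the constant tuples t_1,…,t_n is isomorphic as a ring to ℤ[x_1,…,x_n,y_1,…,y_n]/I'_m, via the map sending the class of the tuple x_k (with x_k(w) = t_{w(k)}) to x_k and the class of the tuple y_k (with y_k(w) = ∏_{ℓ=n−m+1}^{n−1}(t_k − t_{w(ℓ)}) if w(n) = k and 0 otherwise) to y_k, where I'_m is the ideal generated by: (1) y_k y_{k'} for k ≠ k'; (2) x_n y_k for all k; (3) y_k ∏_{ℓ=1}^{n−m}(−x_ℓ) − ∏_{ℓ=1}^{n−1}(−x_ℓ) for all k; (4) ∑_{k=1}^{n} y_k − ∏_{ℓ=n−m+1}^{n−1}(x_n − x_ℓ); and (5) the elementary symmetric polynomials e_i(x_1,…,x_n) for 1 ≤ i ≤ n. -/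
/-!
STATEMENT 10: For h' = ((n-1)^{n-m}, n^m), the quotient of the GKM ring R
(tuples in ∏_{w ∈ S_n} ℤ[t₁,…,tₙ] satisfying the divisibility conditions) by
the ideal generated by the constant tuples t₁,…,tₙ is isomorphic as a ring to
ℤ[x₁,…,xₙ,y₁,…,yₙ]/I'_m, via a map sending the class of the tuple x_k to x_k
and the class of the tuple y_k to y_k.

Conventions: 0-based indices; the 1-based value of `i : Fin n` is `(i:ℕ)+1`;
h' takes 1-based values; `w ∘ (i j)` is `w * Equiv.swap i j`; in the polynomial
ring, `X (Sum.inl j)` is x_{j+1} and `X (Sum.inr k)` is y_{k+1}.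
-/

open MvPolynomial

namespace Stmt10

abbrev PR (n : ℕ) := Equiv.Perm (Fin n) → MvPolynomial (Fin n) ℤ

/-- The Hessenberg function h' = ((n-1)^{n-m}, n^m), with 1-based values. -/
def hFun (n m : ℕ) : Fin n → ℕ := fun i => if (i : ℕ) < n - m then n - 1 else n

/-- The GKM condition. -/
def gkmCond (n m : ℕ) (α : PR n) : Prop :=
  ∀ w : Equiv.Perm (Fin n), ∀ i j : Fin n, i < j → (j : ℕ) + 1 ≤ hFun n m i →
    (X (w i) - X (w j) : MvPolynomial (Fin n) ℤ) ∣ (α w - α (w * Equiv.swap i j))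

/-- The GKM ring R, as a subring of the product ring. -/
noncomputable def gkmSubring (n m : ℕ) : Subring (PR n) where
  carrier := {α | gkmCond n m α}
  zero_mem' := by
    intro w i j _ _
    simp
  one_mem' := by
    intro w i j _ _
    simp
  add_mem' := by
    intro α β hα hβ w i j h1 h2
    have h3 := hα w i j h1 h2
    have h4 := hβ w i j h1 h2
    have key : (α + β) w - (α + β) (w * Equiv.swap i j)
        = (α w - α (w * Equiv.swap i j)) + (β w - β (w * Equiv.swap i j)) := by
      simp only [Pi.add_apply]; ring
    rw [key]
    exact dvd_add h3 h4
  mul_mem' := by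
    intro α β hα hβ w i j h1 h2
    have h3 := hα w i j h1 h2
    have h4 := hβ w i j h1 h2
    have key : (α * β) w - (α * β) (w * Equiv.swap i j)
        = α w * (β w - β (w * Equiv.swap i j)) +
          (α w - α (w * Equiv.swap i j)) * β (w * Equiv.swap i j) := by
      simp only [Pi.mul_apply]; ring
    rw [key]
    exact dvd_add (Dvd.dvd.mul_left h4 _) (Dvd.dvd.mul_right h3 _)
  neg_mem' := by
    intro α hα w i j h1 h2
    have h3 := hα w i j h1 h2
    have key : (-α) w - (-α) (w * Equiv.swap i j)
        = -(α w - α (w * Equiv.swap i j)) := by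
      simp only [Pi.neg_apply]; ring
    rw [key]
    exact Dvd.dvd.neg_right h3

/-- The constant tuple t_k, as an element of the GKM ring. -/
noncomputable def tkR (n m : ℕ) (k : Fin n) : gkmSubring n m :=
  ⟨fun _ => X k, by intro w i j _ _; simp⟩

/-- The ideal of the GKM ring generated by the constant tuples t₁,…,tₙ. -/
noncomputable def Jt (n m : ℕ) : Ideal (gkmSubring n m) :=
  Ideal.span (Set.range (tkR n m))

/-- The tuple x_k: x_k(w) = t_{w(k)}. -/
noncomputable def xk (n : ℕ) (k : Fin n) : PR n := fun w => X (w k)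

/-- The tuple y_k. -/
noncomputable def yk (n m : ℕ) (hn : 0 < n) (k : Fin n) : PR n :=
  fun w =>
    if w ⟨n - 1, by omega⟩ = k then
      ∏ ℓ ∈ Finset.univ.filter (fun ℓ : Fin n => n - m ≤ (ℓ : ℕ) ∧ (ℓ : ℕ) < n - 1),
        (X k - X (w ℓ))
    else 0

/-- x_{j+1} in the polynomial presentation. -/
noncomputable def xv (n : ℕ) (j : Fin n) : MvPolynomial (Fin n ⊕ Fin n) ℤ :=
  X (Sum.inl j)

/-- y_{k+1} in the polynomial presentation. -/
noncomputable def yv (n : ℕ) (k : Fin n) : MvPolynomial (Fin n ⊕ Fin n) ℤ :=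
  X (Sum.inr k)

/-- The ideal I'_m. -/
noncomputable def I' (n m : ℕ) (hn : 0 < n) : Ideal (MvPolynomial (Fin n ⊕ Fin n) ℤ) :=
  Ideal.span
    {p | (∃ k k' : Fin n, k ≠ k' ∧ p = yv n k * yv n k') ∨
         (∃ k : Fin n, p = xv n ⟨n - 1, by omega⟩ * yv n k) ∨
         (∃ k : Fin n, p =
            yv n k * (∏ ℓ ∈ Finset.univ.filter (fun ℓ : Fin n => (ℓ : ℕ) < n - m), (-xv n ℓ)) -
              ∏ ℓ ∈ Finset.univ.filter (fun ℓ : Fin n => (ℓ : ℕ) < n - 1), (-xv n ℓ)) ∨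
         (p = (∑ k : Fin n, yv n k) -
            ∏ ℓ ∈ Finset.univ.filter (fun ℓ : Fin n => n - m ≤ (ℓ : ℕ) ∧ (ℓ : ℕ) < n - 1),
              (xv n ⟨n - 1, by omega⟩ - xv n ℓ)) ∨
         (∃ i : ℕ, 1 ≤ i ∧ i ≤ n ∧ p = rename Sum.inl (esymm (Fin n) ℤ i))}

set_option linter.unusedSectionVars false


section prime
variable {ι : Type*} [DecidableEq ι]

/-- substitution `X a ↦ X b`. -/
noncomputable def sub1 (a b : ι) : MvPolynomial ι ℤ →ₐ[ℤ] MvPolynomial ι ℤ :=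
  aeval (fun c => if c = a then X b else X c)

lemma sub1_X (a b c : ι) : sub1 a b (X c) = if c = a then X b else X c := by
  simp [sub1]

lemma dvd_sub_sub1 (a b : ι) (F : MvPolynomial ι ℤ) :
    (X a - X b : MvPolynomial ι ℤ) ∣ F - sub1 a b F := by
  induction F using MvPolynomial.induction_on with
  | C r => simp [sub1]
  | add p q hp hq =>
    rw [map_add, add_sub_add_comm]; exact dvd_add hp hq
  | mul_X p c hp =>
    rw [map_mul, sub1_X]
    split_ifs with h
    · subst h
      have : p * X c - sub1 c b p * X b = (p - sub1 c b p) * X b + p * (X c - X b) := by ring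
      rw [this]
      exact dvd_add (hp.mul_right _) (Dvd.intro_left _ rfl)
    · rw [← sub_mul]; exact hp.mul_right _

lemma dvd_iff_sub1 (a b : ι) (F : MvPolynomial ι ℤ) :
    (X a - X b : MvPolynomial ι ℤ) ∣ F ↔ sub1 a b F = 0 := by
  constructor
  · rintro ⟨G, rfl⟩
    rw [map_mul, map_sub, sub1_X, sub1_X]; simp
  · intro h
    have := dvd_sub_sub1 a b F
    rwa [h, sub_zero] at this

lemma prime_X_sub (a b : ι) (h : a ≠ b) : Prime (X a - X b : MvPolynomial ι ℤ) := by
  refine ⟨?_, ?_, ?_⟩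
  · rw [sub_ne_zero]; intro h'; exact h (X_injective h')
  · intro hu
    have h1 := (isUnit_iff_dvd_one.mp hu)
    rw [dvd_iff_sub1] at h1; simp at h1
  · intro F G
    rw [dvd_iff_sub1, dvd_iff_sub1, dvd_iff_sub1, map_mul, mul_eq_zero]; exact id

lemma not_dvd_X_sub (a b c d : ι) (hcd : c ≠ d) (h : ¬ ((c = a ∧ d = b) ∨ (c = b ∧ d = a))) :
    ¬ (X a - X b : MvPolynomial ι ℤ) ∣ (X c - X d) := by
  rw [dvd_iff_sub1, map_sub, sub1_X, sub1_X, sub_eq_zero]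
  split_ifs <;> intro h' <;> have := X_injective h' <;> grind

lemma prod_dvd_of_primes {A κ : Type*} [CommRing A] [IsDomain A] (T : Finset κ) (f : κ → A)
    (hp : ∀ i ∈ T, Prime (f i)) (hnd : ∀ i ∈ T, ∀ j ∈ T, i ≠ j → ¬ f i ∣ f j)
    (F : A) (hd : ∀ i ∈ T, f i ∣ F) : (∏ i ∈ T, f i) ∣ F := by
  classical
  induction T using Finset.induction_on with
  | empty => simp
  | insert b T hb ih =>
    obtain ⟨G, hG⟩ := ih (fun i hi => hp i (by simp [hi]))
      (fun i hi j hj => hnd i (by simp [hi]) j (by simp [hj])) (fun i hi => hd i (by simp [hi]))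
    have h1 := hd b (by simp)
    have hpb := hp b (by simp)
    rw [hG] at h1
    rw [Finset.prod_insert hb, hG, mul_comm (f b)]
    apply mul_dvd_mul_left
    rcases hpb.dvd_or_dvd h1 with h2 | h2
    · rw [hpb.dvd_finsetProd_iff] at h2
      obtain ⟨j, hj, hj'⟩ := h2
      exact absurd hj' (hnd b (by simp) j (by simp [hj]) (by rintro rfl; exact hb hj))
    · exact h2

lemma poly_swap_dvd {ι κ : Type*} [DecidableEq κ] (w : κ → ι) (i j : κ)
    (P : MvPolynomial κ (MvPolynomial ι ℤ)) :
    (X (w i) - X (w j) : MvPolynomial ι ℤ) ∣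
      eval (fun c => X (w c)) P - eval (fun c => X (w (Equiv.swap i j c))) P := by
  rw [← Ideal.mem_span_singleton, ← Ideal.Quotient.eq]
  set I := Ideal.span {(X (w i) - X (w j) : MvPolynomial ι ℤ)}
  have hij : Ideal.Quotient.mk I (X (w i)) = Ideal.Quotient.mk I (X (w j)) := by
    rw [Ideal.Quotient.eq]; exact Ideal.mem_span_singleton_self _
  have e1 : ∀ g : κ → MvPolynomial ι ℤ, Ideal.Quotient.mk I (eval g P) =
      eval₂ (Ideal.Quotient.mk I) (fun c => Ideal.Quotient.mk I (g c)) P := by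
    intro g
    have h := eval₂_comp_left (Ideal.Quotient.mk I) (RingHom.id _) g P
    rw [← RingHom.comp_id (Ideal.Quotient.mk I)]
    exact h
  rw [e1, e1]
  congr 1
  funext c
  by_cases h1 : c = i
  · subst h1; simp [hij]
  by_cases h2 : c = j
  · subst h2; simp [hij]
  rw [Equiv.swap_apply_of_ne_of_ne h1 h2]

end prime



section words
variable {ι : Type} [DecidableEq ι]

def Valid {N : ℕ} (V : Finset ι) (w : Fin N → ι) : Prop := Function.Injective w ∧ ∀ i, w i ∈ V

def WG {N : ℕ} (V : Finset ι) (p : (Fin N → ι) → MvPolynomial ι ℤ) : Prop :=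
  ∀ w, Valid V w → ∀ i j, i ≠ j →
    (X (w i) - X (w j) : MvPolynomial ι ℤ) ∣ p w - p (w ∘ Equiv.swap i j)

def WC {N : ℕ} (V J : Finset ι) (L : Finset (Fin N)) (k : ι)
    (p : (Fin N → ι) → MvPolynomial ι ℤ) : Prop :=
  ∀ w, Valid V w → ∀ l ∈ L, w l ∈ J → (X k - X (w l) : MvPolynomial ι ℤ) ∣ p w

noncomputable def ev {N : ℕ} (w : Fin N → ι) (P : MvPolynomial (Fin N) (MvPolynomial ι ℤ)) :
    MvPolynomial ι ℤ := eval (fun c => X (w c)) P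

noncomputable def JI {N : ℕ} (J : Finset ι) (L : Finset (Fin N)) (k : ι) :
    Ideal (MvPolynomial (Fin N) (MvPolynomial ι ℤ)) :=
  Ideal.span {∏ l ∈ L, (C (X k) - X l), C (∏ j ∈ J, (X k - X j))}

lemma Valid.swap {N : ℕ} {V : Finset ι} {w : Fin N → ι} (h : Valid V w) (i j : Fin N) :
    Valid V (w ∘ Equiv.swap i j) :=
  ⟨h.1.comp (Equiv.injective _), fun _ => h.2 _⟩

lemma Valid.ins {N : ℕ} {V : Finset ι} {a : ι} (ha : a ∈ V) (l0 : Fin (N+1)) {w : Fin N → ι}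
    (h : Valid (V.erase a) w) : Valid V (l0.insertNth (α := fun _ => ι) a w) := by
  have h2 : ∀ i, w i ≠ a := fun i => (Finset.mem_erase.mp (h.2 i)).1
  constructor
  · intro i j
    cases i using Fin.succAboveCases l0 <;> cases j using Fin.succAboveCases l0
    · simp
    · simp; intro h'; exact absurd h'.symm (h2 _)
    · simp; intro h'; exact absurd h' (h2 _)
    · simp; intro h'; exact h.1 h'
  · intro i
    cases i using Fin.succAboveCases l0
    · simpa
    · simpa using (Finset.mem_erase.mp (h.2 _)).2

lemma ins_swap {N : ℕ} (a : ι) (l0 : Fin (N+1)) (w : Fin N → ι) (i j : Fin N) :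
    l0.insertNth (α := fun _ => ι) a (w ∘ Equiv.swap i j) =
      l0.insertNth (α := fun _ => ι) a w ∘ Equiv.swap (l0.succAbove i) (l0.succAbove j) := by
  funext c
  cases c using Fin.succAboveCases l0 with
  | x =>
    rw [Function.comp_apply, Equiv.swap_apply_of_ne_of_ne] <;> simp
  | p c =>
    rw [Function.comp_apply, ← (Fin.succAbove_right_injective).map_swap]
    simp

lemma ev_mul {N : ℕ} (w : Fin N → ι) (P Q) : ev w (P * Q) = ev w P * ev w Q := by simp [ev]
lemma ev_add {N : ℕ} (w : Fin N → ι) (P Q) : ev w (P + Q) = ev w P + ev w Q := by simp [ev]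
lemma ev_C {N : ℕ} (w : Fin N → ι) (c) : ev w (C c) = c := by simp [ev]
lemma ev_X {N : ℕ} (w : Fin N → ι) (c) : ev w (X c) = X (w c) := by simp [ev]
lemma ev_prod {N : ℕ} (w : Fin N → ι) (L : Finset (Fin N)) (k : ι) :
    ev w (∏ l ∈ L, (C (X k) - X l)) = ∏ l ∈ L, (X k - X (w l)) := by
  simp [ev, map_prod]

lemma ev_rename {N : ℕ} (l0 : Fin (N+1)) (a : ι) (w : Fin N → ι) (P) :
    ev (l0.insertNth (α := fun _ => ι) a w) (rename l0.succAbove P) = ev w P := by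
  simp [ev, eval_rename, Function.comp_def]

lemma ev_swap {N : ℕ} (w : Fin N → ι) (P) (i j) :
    (X (w i) - X (w j) : MvPolynomial ι ℤ) ∣ ev w P - ev (w ∘ Equiv.swap i j) P :=
  poly_swap_dvd w i j P

lemma JI_cond {N : ℕ} {J : Finset ι} {L : Finset (Fin N)} {k : ι} {P} (hP : P ∈ JI J L k)
    (w : Fin N → ι) (l) (hl : l ∈ L) (hw : w l ∈ J) :
    (X k - X (w l) : MvPolynomial ι ℤ) ∣ ev w P := by
  obtain ⟨u, v, rfl⟩ := Ideal.mem_span_pair.mp hP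
  rw [ev_add, ev_mul, ev_mul, ev_C, ev_prod]
  apply dvd_add
  · exact (Finset.dvd_prod_of_mem (fun l => (X k - X (w l) : MvPolynomial ι ℤ)) hl).mul_left _
  · exact (Finset.dvd_prod_of_mem (fun j => (X k - X j : MvPolynomial ι ℤ)) hw).mul_left _

lemma step_quot {N : ℕ} (V J : Finset ι) (L T : Finset (Fin (N+1))) (k a : ι) (l0 : Fin (N+1))
    (p : (Fin (N+1) → ι) → MvPolynomial ι ℤ) (hk : k ∉ V) (ha : a ∈ V) (hl0 : l0 ∉ T)
    (hJV : J ⊆ V)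
    (hg : WG V p) (hc : WC V J L k p) (hT : ∀ w, Valid V w → ∀ l ∈ T, w l = a → p w = 0)
    (c : MvPolynomial ι ℤ)
    (hcc : c = 1 ∨ (c = X k - X a ∧ ∀ w, Valid V w → w l0 = a → c ∣ p w)) :
    ∃ q : (Fin N → ι) → MvPolynomial ι ℤ,
      (∀ w, Valid (V.erase a) w → p (l0.insertNth (α := fun _ => ι) a w) =
        c * (∏ l ∈ T, (X a - X (l0.insertNth (α := fun _ => ι) a w l))) * q w) ∧
      WG (V.erase a) q ∧
      WC (V.erase a) (J.erase a) (Finset.univ.filter (fun l => l0.succAbove l ∈ L)) k q := by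
  have hka : k ≠ a := by rintro rfl; exact hk ha
  -- divisibility
  have h1 : ∀ w, Valid V w → w l0 = a → c * (∏ l ∈ T, (X a - X (w l))) ∣ p w := by
    intro w hw hwa
    have hne : ∀ l ∈ T, w l ≠ a := by
      intro l hl h
      exact hl0 (hw.1 (hwa.trans h.symm) ▸ hl)
    have hd : (∏ l ∈ T, (X a - X (w l) : MvPolynomial ι ℤ)) ∣ p w := by
      apply prod_dvd_of_primes
      · intro l hl; exact prime_X_sub _ _ (hne l hl).symm
      · intro l hl j hj hlj
        apply not_dvd_X_sub _ _ _ _ (hne j hj).symm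
        have := hne l hl
        have := hne j hj
        have : w l ≠ w j := fun h => hlj (hw.1 h)
        grind
      · intro l hl
        have h2 := hg w hw l0 l (by rintro rfl; exact hl0 hl)
        rw [hT (w ∘ Equiv.swap l0 l) (hw.swap _ _) l hl (by simp [hwa]), sub_zero, hwa] at h2
        exact h2
    rcases hcc with rfl | ⟨hc1, hc2⟩
    · simpa
    · obtain ⟨G, hG⟩ := hd
      have h3 := hc2 w hw hwa
      have hpr : Prime c := hc1 ▸ prime_X_sub _ _ hka
      rw [hG] at h3 ⊢
      rw [mul_comm c]
      apply mul_dvd_mul_left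
      refine (hpr.dvd_or_dvd h3).resolve_left ?_
      rw [hpr.dvd_finsetProd_iff]
      rintro ⟨j, hj, hj'⟩
      rw [hc1] at hj'
      refine not_dvd_X_sub _ _ _ _ (hne j hj).symm ?_ hj'
      have : w j ≠ k := fun h => hk (h ▸ hw.2 j)
      grind
  have h2 : ∀ w, ∃ q, Valid (V.erase a) w → p (l0.insertNth (α := fun _ => ι) a w) =
        c * (∏ l ∈ T, (X a - X (l0.insertNth (α := fun _ => ι) a w l))) * q := by
    intro w
    by_cases hw : Valid (V.erase a) w
    · obtain ⟨q, hq⟩ := h1 _ (hw.ins ha l0) (by simp)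
      exact ⟨q, fun _ => hq⟩
    · exact ⟨0, fun h => absurd h hw⟩
  choose q hq using h2
  -- a prime not involving `a` cancels
  have hcancel : ∀ w, Valid (V.erase a) w → ∀ b d, b ≠ d → b ≠ a → d ≠ a →
      (X b - X d : MvPolynomial ι ℤ) ∣
        c * (∏ l ∈ T, (X a - X (l0.insertNth (α := fun _ => ι) a w l))) * q w →
      (X b - X d : MvPolynomial ι ℤ) ∣ q w := by
    intro w hw b d hbd hba hda h
    have hpr := prime_X_sub b d hbd
    refine (hpr.dvd_or_dvd h).resolve_left ?_
    intro h
    rcases hpr.dvd_or_dvd h with h | h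
    · rcases hcc with rfl | ⟨hc1, -⟩
      · exact hpr.not_dvd_one h
      · rw [hc1] at h
        exact not_dvd_X_sub b d k a hka (by grind) h
    · rw [hpr.dvd_finsetProd_iff] at h
      obtain ⟨j, hj, hj'⟩ := h
      refine not_dvd_X_sub b d _ _ ?_ ?_ hj'
      · intro h
        have := (hw.ins ha l0).1 (a₁ := l0) (a₂ := j) (by simp [← h])
        exact hl0 (this ▸ hj)
      · grind
  refine ⟨q, hq, ?_, ?_⟩
  · intro w hw i j hij
    have hwi := Finset.mem_erase.mp (hw.2 i)
    have hwj := Finset.mem_erase.mp (hw.2 j)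
    have h3 := hg _ (hw.ins ha l0) (l0.succAbove i) (l0.succAbove j)
      (fun h => hij (Fin.succAbove_right_injective h))
    rw [← ins_swap, hq w hw, hq _ (hw.swap i j)] at h3
    simp only [Fin.insertNth_apply_succAbove] at h3
    have h4 := ev_swap (l0.insertNth (α := fun _ => ι) a w)
      (C c * ∏ l ∈ T, (C (X a) - X l)) (l0.succAbove i) (l0.succAbove j)
    rw [← ins_swap, ev_mul, ev_mul, ev_C, ev_C, ev_prod, ev_prod] at h4
    simp only [Fin.insertNth_apply_succAbove] at h4
    set A := c * (∏ l ∈ T, (X a - X (l0.insertNth (α := fun _ => ι) a w l)))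
    set B := c * (∏ l ∈ T, (X a - X (l0.insertNth (α := fun _ => ι) a (w ∘ Equiv.swap i j) l)))
    have h5 : (X (w i) - X (w j) : MvPolynomial ι ℤ) ∣ B * (q w - q (w ∘ Equiv.swap i j)) := by
      have : B * (q w - q (w ∘ Equiv.swap i j)) =
        (A * q w - B * q (w ∘ Equiv.swap i j)) - (A - B) * q w := by ring
      rw [this]
      exact dvd_sub h3 (h4.mul_right _)
    have h5 : (X (w i) - X (w j) : MvPolynomial ι ℤ) ∣ A * (q w - q (w ∘ Equiv.swap i j)) := by
      have : A * (q w - q (w ∘ Equiv.swap i j)) =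
        (A - B) * (q w - q (w ∘ Equiv.swap i j)) + B * (q w - q (w ∘ Equiv.swap i j)) := by ring
      rw [this]
      exact dvd_add (h4.mul_right _) h5
    have hpr := prime_X_sub (w i) (w j) (fun h => hij (hw.1 h))
    refine (hpr.dvd_or_dvd h5).resolve_left ?_
    intro h
    rcases hpr.dvd_or_dvd h with h | h
    · rcases hcc with rfl | ⟨hc1, -⟩
      · exact hpr.not_dvd_one h
      · rw [hc1] at h
        exact not_dvd_X_sub _ _ k a hka (by grind) h
    · rw [hpr.dvd_finsetProd_iff] at h
      obtain ⟨j', hj, hj'⟩ := h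
      refine not_dvd_X_sub _ _ _ _ ?_ ?_ hj'
      · intro h
        have := (hw.ins ha l0).1 (a₁ := l0) (a₂ := j') (by simp [← h])
        exact hl0 (this ▸ hj)
      · grind
  · intro w hw l hl hwl
    have hwl' := Finset.mem_erase.mp hwl
    have h3 := hc _ (hw.ins ha l0) (l0.succAbove l) (by simpa using hl) (by simpa using hwl'.2)
    rw [hq w hw, Fin.insertNth_apply_succAbove] at h3
    exact hcancel w hw _ _ (fun h => hk (h ▸ hJV hwl'.2)) hka hwl'.1 h3

end words

section jthm
variable {ι : Type} [DecidableEq ι]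

lemma prod_ins {N : ℕ} {A : Type*} [CommRing A] (l0 : Fin (N+1)) (L : Finset (Fin (N+1)))
    (f : Fin (N+1) → A) : ∏ l ∈ L, f l = (if l0 ∈ L then f l0 else 1) *
      ∏ l ∈ Finset.univ.filter (fun l => l0.succAbove l ∈ L), f (l0.succAbove l) := by
  rw [Finset.prod_filter, ← Fin.prod_univ_succAbove (fun l => if l ∈ L then f l else 1) l0]
  simp

lemma valid_removeNth {N : ℕ} {V : Finset ι} {a : ι} (l0 : Fin (N+1)) {w : Fin (N+1) → ι}
    (h : Valid V w) (hw : w l0 = a) :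
    ∃ w', Valid (V.erase a) w' ∧ w = l0.insertNth (α := fun _ => ι) a w' := by
  refine ⟨l0.removeNth w, ⟨?_, ?_⟩, ?_⟩
  · exact h.1.comp Fin.succAbove_right_injective
  · intro i
    refine Finset.mem_erase.mpr ⟨?_, h.2 _⟩
    intro h'
    exact Fin.succAbove_ne l0 i (h.1 (h'.trans hw.symm))
  · rw [← hw, Fin.insertNth_self_removeNth]

lemma prod_sub_mem {N : ℕ} (L : Finset (Fin N)) (a k : ι) :
    (C (X k - X a) : MvPolynomial (Fin N) (MvPolynomial ι ℤ)) ∣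
      (∏ l ∈ L, (C (X a) - X l)) - ∏ l ∈ L, (C (X k) - X l) := by
  induction L using Finset.induction_on with
  | empty => simp
  | insert b L hb ih =>
    rw [Finset.prod_insert hb, Finset.prod_insert hb]
    obtain ⟨G, hG⟩ := ih
    rw [sub_eq_iff_eq_add] at hG
    rw [hG]
    refine ⟨(C (X a) - X b) * G - ∏ l ∈ L, (C (X k) - X l), ?_⟩
    rw [C_sub]
    ring

theorem jthm : ∀ (N : ℕ) (V J : Finset ι) (L : Finset (Fin N)) (k : ι)
    (p : (Fin N → ι) → MvPolynomial ι ℤ), V.card = N → J ⊆ V → k ∉ V → WG V p → WC V J L k p →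
    ∃ q ∈ JI J L k, ∀ w, Valid V w → p w = ev w q := by
  intro N
  induction N with
  | zero =>
    intro V J L k p hV hJ hk _ _
    have hV' : V = ∅ := Finset.card_eq_zero.mp hV
    subst hV'
    have hJ' : J = ∅ := Finset.subset_empty.mp hJ
    subst hJ'
    refine ⟨C (p Fin.elim0), ?_, ?_⟩
    · have : JI (∅ : Finset ι) L k = ⊤ := by
        rw [Ideal.eq_top_iff_one]
        apply Ideal.subset_span; simp
      rw [this]; trivial
    · intro w _
      rw [ev_C, Subsingleton.elim w Fin.elim0]
  | succ N IH =>
    intro V J L k p hV hJ hk hg hc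
    obtain ⟨a, haV, haJ⟩ : ∃ a ∈ V, (a ∈ J ∨ J = ∅) := by
      rcases J.eq_empty_or_nonempty with h | ⟨a, ha⟩
      · have : V.Nonempty := by rw [← Finset.card_pos]; omega
        obtain ⟨a, ha⟩ := this
        exact ⟨a, ha, Or.inr h⟩
      · exact ⟨a, hJ ha, Or.inl ha⟩
    have inner : ∀ (d : ℕ) (T : Finset (Fin (N+1))) (p : (Fin (N+1) → ι) → MvPolynomial ι ℤ),
        Tᶜ.card = d → (T ⊆ L ∨ L ⊆ T) → WG V p → WC V J L k p →
        (∀ w, Valid V w → ∀ l ∈ T, w l = a → p w = 0) →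
        ∃ q ∈ JI J L k, ∀ w, Valid V w → p w = ev w q := by
      intro d
      induction d with
      | zero =>
        intro T p hT _ _ _ hv
        have hT' : T = Finset.univ := by
          rwa [Finset.card_eq_zero, Finset.compl_eq_empty_iff] at hT
        refine ⟨0, Ideal.zero_mem _, ?_⟩
        intro w hw
        have himg : Finset.univ.image w = V := by
          apply Finset.eq_of_subset_of_card_le
          · intro x hx
            obtain ⟨i, -, rfl⟩ := Finset.mem_image.mp hx
            exact hw.2 i
          · rw [Finset.card_image_of_injective _ hw.1, hV]; simp
        rw [← himg] at haV
        obtain ⟨i, -, hi⟩ := Finset.mem_image.mp haV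
        rw [hv w hw i (by simp [hT']) hi]
        simp [ev]
      | succ d ih =>
        intro T p hT hTL hg hc hv
        obtain ⟨l0, hl0, hl0L⟩ : ∃ l0, l0 ∉ T ∧ (l0 ∈ L ∨ L ⊆ T) := by
          by_cases h : L ⊆ T
          · have : Tᶜ.Nonempty := by rw [← Finset.card_pos]; omega
            obtain ⟨l0, h0⟩ := this
            exact ⟨l0, Finset.mem_compl.mp h0, Or.inr h⟩
          · obtain ⟨l0, h1, h2⟩ := Finset.not_subset.mp h
            exact ⟨l0, h2, Or.inl h1⟩
        have hk' : k ∉ V.erase a := fun h => hk (Finset.mem_of_mem_erase h)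
        have hV' : (V.erase a).card = N := by rw [Finset.card_erase_of_mem haV]; omega
        have hJ' : J.erase a ⊆ V.erase a := Finset.erase_subset_erase _ hJ
        obtain ⟨M, hM, hMev⟩ : ∃ M : MvPolynomial (Fin (N+1)) (MvPolynomial ι ℤ),
            (∏ l ∈ T, (C (X a) - X l)) * M ∈ JI J L k ∧
            ∀ w, Valid V w → w l0 = a → p w = ev w ((∏ l ∈ T, (C (X a) - X l)) * M) := by
          rcases haJ with haJ | haJ
          · by_cases hLl : l0 ∈ L
            · obtain ⟨q, hq1, hq2, hq3⟩ := step_quot V J L T k a l0 p hk haV hl0 hJ hg hc hv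
                (X k - X a) (Or.inr ⟨rfl, fun w hw hwa => by
                  have := hc w hw l0 hLl (hwa ▸ haJ); rwa [hwa] at this⟩)
              obtain ⟨Q, hQ, hQe⟩ := IH _ _ _ k q hV' hJ' hk' hq2 hq3
              obtain ⟨u, v, rfl⟩ := Ideal.mem_span_pair.mp hQ
              refine ⟨rename l0.succAbove u * (∏ l ∈ L, (C (X k) - X l)) +
                rename l0.succAbove v * C (∏ j ∈ J, (X k - X j)), ?_, ?_⟩
              · apply Ideal.mul_mem_left
                exact Ideal.mem_span_pair.mpr ⟨_, _, rfl⟩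
              · intro w hw hwa
                obtain ⟨w', hw', rfl⟩ := valid_removeNth l0 hw hwa
                rw [hq1 w' hw', hQe w' hw']
                simp only [ev_add, ev_mul, ev_C, ev_prod, ev_rename]
                rw [prod_ins l0 L]
                rw [← Finset.mul_prod_erase J _ haJ]
                simp only [hLl, if_true, Fin.insertNth_apply_same, Fin.insertNth_apply_succAbove]
                ring
            · have hLT := hl0L.resolve_left hLl
              obtain ⟨q, hq1, hq2, hq3⟩ := step_quot V J L T k a l0 p hk haV hl0 hJ hg hc hv
                1 (Or.inl rfl)
              obtain ⟨Q, hQ, hQe⟩ := IH _ _ _ k q hV' hJ' hk' hq2 hq3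
              obtain ⟨u, v, rfl⟩ := Ideal.mem_span_pair.mp hQ
              refine ⟨rename l0.succAbove u * (∏ l ∈ L, (C (X k) - X l)) +
                rename l0.succAbove v * C (∏ j ∈ J.erase a, (X k - X j)), ?_, ?_⟩
              · obtain ⟨G, hG⟩ := prod_sub_mem L a k
                rw [sub_eq_iff_eq_add] at hG
                rw [← Finset.prod_sdiff hLT, hG]
                set R := ∏ l ∈ T \ L, (C (X a : MvPolynomial ι ℤ) - X l)
                apply Ideal.mem_span_pair.mpr
                rw [← Finset.mul_prod_erase J _ haJ, C_mul]
                set F := ∏ l ∈ L, (C (X k : MvPolynomial ι ℤ) - X l)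
                set D := (C (X k - X a : MvPolynomial ι ℤ) : MvPolynomial (Fin (N+1)) _)
                set U := rename l0.succAbove u
                set W := rename l0.succAbove v
                set E := (C (∏ j ∈ J.erase a, (X k - X j : MvPolynomial ι ℤ)) :
                  MvPolynomial (Fin (N+1)) _)
                exact ⟨R * (D * G + F) * U + R * W * E, R * G * W, by ring⟩
              · intro w hw hwa
                obtain ⟨w', hw', rfl⟩ := valid_removeNth l0 hw hwa
                rw [hq1 w' hw', hQe w' hw']
                simp only [ev_add, ev_mul, ev_C, ev_prod, ev_rename]
                rw [prod_ins l0 L]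
                simp only [hLl, if_false, Fin.insertNth_apply_succAbove]
                ring
          · obtain ⟨q, hq1, hq2, hq3⟩ := step_quot V J L T k a l0 p hk haV hl0 hJ hg hc hv
                1 (Or.inl rfl)
            obtain ⟨Q, hQ, hQe⟩ := IH _ _ _ k q hV' hJ' hk' hq2 hq3
            refine ⟨rename l0.succAbove Q, ?_, ?_⟩
            · have : JI J L k = ⊤ := by
                rw [Ideal.eq_top_iff_one]
                apply Ideal.subset_span; simp [haJ]
              rw [this]; trivial
            · intro w hw hwa
              obtain ⟨w', hw', rfl⟩ := valid_removeNth l0 hw hwa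
              rw [hq1 w' hw', hQe w' hw']
              simp only [ev_mul, ev_prod, ev_rename]
              ring
        set Q := (∏ l ∈ T, (C (X a : MvPolynomial ι ℤ) - X l)) * M with hQdef
        obtain ⟨q, hq, hqe⟩ := ih (insert l0 T) (fun w => p w - ev w Q)
          (by
            rw [Finset.card_compl] at hT ⊢
            rw [Finset.card_insert_of_notMem hl0]; omega)
          (by
            rcases hl0L with h | h
            · rcases hTL with h' | h'
              · exact Or.inl (Finset.insert_subset h h')
              · exact Or.inr (h'.trans (Finset.subset_insert _ _))
            · exact Or.inr (h.trans (Finset.subset_insert _ _)))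
          (by
            intro w hw i j hij
            have h1 := hg w hw i j hij
            have h2 := ev_swap w Q i j
            have := dvd_sub h1 h2
            convert this using 1; ring)
          (by
            intro w hw l hl hwl
            exact dvd_sub (hc w hw l hl hwl) (JI_cond hM w l hl hwl))
          (by
            intro w hw l hl hwl
            rcases Finset.mem_insert.mp hl with rfl | hl
            · simp only [hMev w hw hwl, sub_self]
            · simp only [hv w hw l hl hwl, hQdef, ev_mul, ev_prod]
              rw [Finset.prod_eq_zero hl (by simp [hwl])]
              simp)
        refine ⟨q + Q, Ideal.add_mem _ hq hM, ?_⟩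
        intro w hw
        rw [ev_add, ← hqe w hw]; ring
    exact inner _ ∅ p rfl (Or.inl (Finset.empty_subset _)) hg hc (by simp)

end jthm


lemma mem_gkm {n m : ℕ} {α : PR n} : α ∈ gkmSubring n m ↔ gkmCond n m α := Iff.rfl

lemma xk_mem (n m : ℕ) (k : Fin n) : xk n k ∈ gkmSubring n m := by
  intro w i j _ _
  have := poly_swap_dvd (κ := Fin n) w i j (X k)
  simpa [xk] using this

lemma yk_mem (n m : ℕ) (hn : 0 < n) (k : Fin n) : yk n m hn k ∈ gkmSubring n m := by
  intro w i j hij hj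
  have hcase : ((j : ℕ) < n - 1) ∨ ((j : ℕ) = n - 1 ∧ n - m ≤ (i : ℕ)) := by
    have := j.2
    have := i.2
    have : (i : ℕ) < j := hij
    unfold hFun at hj
    split_ifs at hj <;> omega
  set lst : Fin n := ⟨n - 1, by omega⟩ with hlst
  rcases hcase with h | ⟨h, hi⟩
  · have h1 : Equiv.swap i j lst = lst := by
      apply Equiv.swap_apply_of_ne_of_ne
      · intro h'; have : (i : ℕ) = n - 1 := by rw [← h']
        have : (i : ℕ) < j := hij
        omega
      · intro h'; have : (j : ℕ) = n - 1 := by rw [← h']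
        omega
    unfold yk
    rw [← hlst]
    simp only [Equiv.Perm.coe_mul, Function.comp_apply, h1]
    split_ifs with hk
    · have := poly_swap_dvd (κ := Fin n) w i j
        (∏ l ∈ Finset.univ.filter (fun l : Fin n => n - m ≤ (l : ℕ) ∧ (l : ℕ) < n - 1),
          (C (X k) - X l))
      simpa [map_prod] using this
    · simp
  · have hj' : j = lst := Fin.ext h
    rw [hj'] at hij ⊢
    have hne : w i ≠ w lst := fun h' => hij.ne (w.injective h')
    unfold yk
    rw [← hlst]
    simp only [Equiv.Perm.coe_mul, Function.comp_apply, Equiv.swap_apply_right]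
    have hil : (i : ℕ) < n - 1 := by exact hij
    have him : i ∈ Finset.univ.filter (fun l : Fin n => n - m ≤ (l : ℕ) ∧ (l : ℕ) < n - 1) := by
      simp [hil]; omega
    by_cases h1 : w lst = k
    · have h2 : w i ≠ k := fun h' => hne (h'.trans h1.symm)
      rw [if_pos h1, if_neg h2, sub_zero]
      have := Finset.dvd_prod_of_mem (fun l => (X k - X (w l) : MvPolynomial (Fin n) ℤ)) him
      refine dvd_trans ?_ this
      rw [h1, ← neg_sub]; exact neg_dvd.mpr dvd_rfl
    · by_cases h2 : w i = k
      · rw [if_neg h1, if_pos h2, zero_sub, dvd_neg]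
        have := Finset.dvd_prod_of_mem
          (fun l => (X k - X (w (Equiv.swap i lst l)) : MvPolynomial (Fin n) ℤ)) him
        refine dvd_trans ?_ this
        simp [h2]
      · simp [h1, h2]

/-- The subalgebra generated by the `x_k` and `y_k`. -/
noncomputable def TT (n m : ℕ) (hn : 0 < n) : Subalgebra (MvPolynomial (Fin n) ℤ) (PR n) :=
  Algebra.adjoin _ (Set.range (xk n) ∪ Set.range (yk n m hn))

lemma const_mem (n m : ℕ) (c : MvPolynomial (Fin n) ℤ) :
    algebraMap (MvPolynomial (Fin n) ℤ) (PR n) c ∈ gkmSubring n m := by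
  intro w i j _ _; simp

lemma TT_le (n m : ℕ) (hn : 0 < n) (α : PR n) (h : α ∈ TT n m hn) : α ∈ gkmSubring n m := by
  induction h using Algebra.adjoin_induction with
  | mem x hx =>
    rcases hx with ⟨k, rfl⟩ | ⟨k, rfl⟩
    · exact xk_mem n m k
    · exact yk_mem n m hn k
  | algebraMap r => exact const_mem n m r
  | add x y _ _ hx hy => exact add_mem hx hy
  | mul x y _ _ hx hy => exact mul_mem hx hy

lemma aeval_apply' {n : ℕ} {κ : Type*} (g : κ → PR n)
    (u : MvPolynomial κ (MvPolynomial (Fin n) ℤ)) (w : Equiv.Perm (Fin n)) :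
    (aeval g u) w = eval (fun i => g i w) u := by
  have : (Pi.evalAlgHom (MvPolynomial (Fin n) ℤ) (fun _ : Equiv.Perm (Fin n) =>
    MvPolynomial (Fin n) ℤ) w).comp (aeval g) = aeval (fun i => g i w) := by
    apply algHom_ext; intro i; simp
  exact DFunLike.congr_fun this u

lemma gkm_ne {n m : ℕ} {α : PR n} (h : α ∈ gkmSubring n m) (w : Equiv.Perm (Fin n))
    (i j : Fin n) (hij : i ≠ j) (hi : (i : ℕ) + 1 ≤ n - 1) (hj : (j : ℕ) + 1 ≤ n - 1) :
    (X (w i) - X (w j) : MvPolynomial (Fin n) ℤ) ∣ (α w - α (w * Equiv.swap i j)) := by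
  have hh : ∀ i : Fin n, n - 1 ≤ hFun n m i := by
    intro i; unfold hFun; split_ifs <;> omega
  rcases lt_or_gt_of_ne hij with h1 | h1
  · exact h w i j h1 (hj.trans (hh i))
  · have := h w j i h1 (hi.trans (hh j))
    rw [Equiv.swap_comm, ← neg_sub]
    exact neg_dvd.mpr this

/-- permutation to word -/
noncomputable def wd {n : ℕ} (α : PR n) (w : Fin n → Fin n) : MvPolynomial (Fin n) ℤ :=
  open Classical in
  if h : Function.Bijective w then α (Equiv.ofBijective w h) else 0

lemma wd_perm {n : ℕ} (α : PR n) (w : Equiv.Perm (Fin n)) : wd α w = α w := by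
  unfold wd
  rw [dif_pos w.bijective]
  congr 1
  ext; rfl

lemma exists_perm {n : ℕ} {V : Finset (Fin n)} {w : Fin n → Fin n} (h : Valid V w) :
    ∃ σ : Equiv.Perm (Fin n), w = σ :=
  ⟨Equiv.ofBijective w (Finite.injective_iff_bijective.mp h.1), rfl⟩

theorem mem_TT (N m : ℕ) : ∀ (d : ℕ) (J : Finset (Fin (N+1))) (α : PR (N+1)),
    Jᶜ.card = d → α ∈ gkmSubring (N+1) m → (∀ w : Equiv.Perm _, w (Fin.last N) ∈ J → α w = 0) →
    α ∈ TT (N+1) m (Nat.succ_pos N) := by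
  intro d
  induction d with
  | zero =>
    intro J α hJ _ h0
    have hJ' : J = Finset.univ := by
      rwa [Finset.card_eq_zero, Finset.compl_eq_empty_iff] at hJ
    have : α = 0 := by
      funext w; exact h0 w (by simp [hJ'])
    rw [this]; exact zero_mem _
  | succ d ih =>
    intro J α hJ hα h0
    obtain ⟨k, hk⟩ : Jᶜ.Nonempty := by rw [← Finset.card_pos]; omega
    have hkJ : k ∉ J := Finset.mem_compl.mp hk
    set L : Finset (Fin N) := Finset.univ.filter (fun l => N + 1 - m ≤ (l : ℕ)) with hL
    obtain ⟨q, hq, hqe⟩ := jthm N (Finset.univ.erase k) J L k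
      (fun w => wd α ((Fin.last N).insertNth (α := fun _ => Fin (N+1)) k w))
      (by simp)
      (by
        intro j hj
        simp; rintro rfl; exact hkJ hj)
      (by simp)
      (by
        intro w hw i j hij
        have hv := hw.ins (Finset.mem_univ k) (Fin.last N)
        obtain ⟨σ, hσ⟩ := exists_perm hv
        have h1 := gkm_ne hα σ i.castSucc j.castSucc (by simpa using hij) (by simp)
          (by simp)
        simp only [ins_swap]
        rw [← wd_perm α, ← wd_perm α, Equiv.Perm.coe_mul, ← hσ] at h1
        rw [← Fin.succAbove_last, Fin.insertNth_apply_succAbove,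
          Fin.insertNth_apply_succAbove] at h1
        exact h1)
      (by
        intro w hw l hl hwl
        have hv := hw.ins (Finset.mem_univ k) (Fin.last N)
        obtain ⟨σ, hσ⟩ := exists_perm hv
        have hl' : N + 1 - m ≤ (l : ℕ) := by simpa [hL] using hl
        have hfun : hFun (N+1) m l.castSucc = N + 1 := by
          unfold hFun; rw [if_neg]; simp; omega
        have h1 := hα σ l.castSucc (Fin.last N) (Fin.castSucc_lt_last l) (by rw [hfun]; simp)
        have h2 : σ l.castSucc = w l := by
          rw [← hσ, ← Fin.succAbove_last, Fin.insertNth_apply_succAbove]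
        have h3 : σ (Fin.last N) = k := by rw [← hσ]; simp
        rw [h0 (σ * Equiv.swap _ _) (by simpa [h2] using hwl), h2, h3, sub_zero, ← wd_perm α,
          ← hσ] at h1
        rw [← neg_sub]; exact neg_dvd.mpr h1)
    obtain ⟨u, v, rfl⟩ := Ideal.mem_span_pair.mp hq
    set g : Fin N → PR (N+1) := fun i => xk (N+1) i.castSucc with hg
    set β : PR (N+1) := aeval g u * yk (N+1) m (Nat.succ_pos N) k +
      aeval g v * ∏ j ∈ J, (xk (N+1) (Fin.last N) - algebraMap (MvPolynomial (Fin (N+1)) ℤ) (PR (N+1)) (X j)) with hβ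
    have hxT : ∀ i, xk (N+1) i ∈ TT (N+1) m (Nat.succ_pos N) := fun i =>
      Algebra.subset_adjoin (Or.inl ⟨i, rfl⟩)
    have haT : ∀ u : MvPolynomial (Fin N) (MvPolynomial (Fin (N+1)) ℤ), aeval g u ∈ TT (N+1) m (Nat.succ_pos N) := by
      intro u
      have : aeval g u ∈ Algebra.adjoin (MvPolynomial (Fin (N+1)) ℤ) (Set.range g) := by
        rw [Algebra.adjoin_range_eq_range_aeval]; exact ⟨u, rfl⟩
      refine Algebra.adjoin_le ?_ this
      rintro _ ⟨i, rfl⟩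
      exact hxT _
    have hβT : β ∈ TT (N+1) m (Nat.succ_pos N) := by
      apply add_mem
      · exact mul_mem (haT _) (Algebra.subset_adjoin (Or.inr ⟨k, rfl⟩))
      · apply mul_mem (haT _)
        apply prod_mem
        intro j _
        exact sub_mem (hxT _) (Subalgebra.algebraMap_mem _ _)
    have hβw : ∀ w : Equiv.Perm (Fin (N+1)), β w =
        eval (fun i : Fin N => X (w i.castSucc)) u * yk (N+1) m (Nat.succ_pos N) k w +
        eval (fun i : Fin N => X (w i.castSucc)) v *
          ∏ j ∈ J, (X (w (Fin.last N)) - X j) := by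
      intro w
      simp only [hβ, Pi.add_apply, Pi.mul_apply, Finset.prod_apply, Pi.sub_apply, aeval_apply']
      simp [hg, xk]
    have key := ih (insert k J) (α - β)
      (by
        rw [Finset.card_compl] at hJ ⊢
        rw [Finset.card_insert_of_notMem hkJ]; omega)
      (sub_mem hα (TT_le _ _ _ _ hβT))
      (by
        intro w hw
        rw [Pi.sub_apply, hβw]
        have hyl : (⟨N + 1 - 1, by omega⟩ : Fin (N+1)) = Fin.last N := rfl
        rcases Finset.mem_insert.mp hw with hw | hw
        · obtain ⟨w', hw', hww⟩ := valid_removeNth (V := Finset.univ) (Fin.last N)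
            ⟨w.injective, fun _ => Finset.mem_univ _⟩ hw
          have h1 := hqe w' hw'
          rw [← hww, wd_perm] at h1
          have h2 : ∀ i : Fin N, w i.castSucc = w' i := by
            intro i
            rw [hww, ← Fin.succAbove_last, Fin.insertNth_apply_succAbove]
          rw [h1, ev_add, ev_mul, ev_mul, ev_prod, ev_C, sub_eq_zero]
          simp only [h2, hw, ev]
          congr 2
          unfold yk
          rw [hyl, if_pos hw]
          rw [prod_ins (Fin.last N)]
          simp [hL, h2]
        · have hne : w (Fin.last N) ≠ k := by rintro h; exact hkJ (h ▸ hw)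
          rw [h0 w hw, Finset.prod_eq_zero hw (by simp)]
          unfold yk
          rw [hyl, if_neg hne]
          simp)
    have := add_mem key hβT
    simpa using this

theorem mem_TT' (n m : ℕ) (hn : 0 < n) (α : PR n) (h : α ∈ gkmSubring n m) : α ∈ TT n m hn := by
  obtain ⟨N, rfl⟩ : ∃ N, n = N + 1 := ⟨n - 1, by omega⟩
  exact mem_TT N m _ ∅ α rfl h (by simp)



def lexlt {N : ℕ} (e' e : Fin N →₀ ℕ) : Prop := ∃ k, (∀ j < k, e' j = e j) ∧ e' k < e k

lemma lexlt_wf (N : ℕ) : WellFounded (lexlt (N := N)) := by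
  have h : WellFounded (Pi.Lex (fun i j : Fin N => i < j) (fun {_} (a b : ℕ) => a < b)) :=
    Pi.Lex.wellFounded (· < ·) (fun _ => wellFounded_lt)
  exact InvImage.wf (fun e : Fin N →₀ ℕ => (e : Fin N → ℕ)) h

lemma red {N : ℕ} {B : Type*} [CommRing B] (ψ : MvPolynomial (Fin N) ℤ →+* B)
    (hψ : ∏ l, (Polynomial.X - Polynomial.C (ψ (X l))) = (Polynomial.X ^ N : Polynomial B))
    (k : Fin N) : ∃ r : Polynomial (supported ℤ {l : Fin N | k < l}), r.Monic ∧
      r.natDegree = k + 1 ∧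
      ψ (r.eval₂ (supported ℤ {l : Fin N | k < l}).val.toRingHom (X k)) = 0 := by
  classical
  set D := supported ℤ {l : Fin N | k < l} with hD
  set f : Fin N → D := fun l => if h : k < l then ⟨X l, X_mem_supported.mpr h⟩ else 0 with hf
  have hfv : ∀ l, k < l → (f l : MvPolynomial (Fin N) ℤ) = X l := by
    intro l hl; simp [hf, hl]
  set d : Polynomial D := ∏ l ∈ Finset.Ioi k, (Polynomial.X - Polynomial.C (f l)) with hd
  have hdm : d.Monic := Polynomial.monic_prod_of_monic _ _ (fun l _ => Polynomial.monic_X_sub_C _)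
  have hdd : d.natDegree = N - 1 - k := by
    rw [hd, Polynomial.natDegree_prod_of_monic _ _ (fun l _ => Polynomial.monic_X_sub_C _)]
    simp
  have hk := k.2
  set φ : D →+* B := ψ.comp D.val.toRingHom with hφ
  set g : Polynomial B := ∏ l ∈ Finset.Iic k, (Polynomial.X - Polynomial.C (ψ (X l))) with hg
  have hmap : d.map φ = ∏ l ∈ Finset.Ioi k, (Polynomial.X - Polynomial.C (ψ (X l))) := by
    rw [hd, Polynomial.map_prod]
    apply Finset.prod_congr rfl
    intro l hl
    have := hfv l (Finset.mem_Ioi.mp hl)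
    simp [hφ, this]
  have hgd : d.map φ * g = Polynomial.X ^ N := by
    rw [hmap, hg, ← hψ, mul_comm, ← Finset.prod_union]
    · congr 1; ext l; simp; exact le_or_gt l k
    · rw [Finset.disjoint_left]; intro l; simp
  have hdeg : d.degree ≤ (Polynomial.X ^ N : Polynomial D).degree := by
    rw [Polynomial.degree_X_pow, Polynomial.degree_eq_natDegree hdm.ne_zero, hdd]
    exact_mod_cast (by omega : N - 1 - (k : ℕ) ≤ N)
  refine ⟨Polynomial.X ^ N /ₘ d, ?_, ?_, ?_⟩
  · unfold Polynomial.Monic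
    rw [Polynomial.leadingCoeff_divByMonic_of_monic hdm hdeg]
    exact Polynomial.monic_X_pow N
  · rw [Polynomial.natDegree_divByMonic _ hdm, hdd, Polynomial.natDegree_X_pow]; omega
  · rw [Polynomial.hom_eval₂]
    change Polynomial.eval₂ φ _ _ = 0
    rw [← Polynomial.eval_map, Polynomial.map_divByMonic _ hdm, Polynomial.map_pow,
      Polynomial.map_X, ← hgd, Polynomial.mul_divByMonic_cancel_left _ (hdm.map φ), hg,
      Polynomial.eval_prod]
    apply Finset.prod_eq_zero (Finset.mem_Iic.mpr le_rfl)
    simp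

lemma mem_of_lexlt {N : ℕ} (K : AddSubgroup (MvPolynomial (Fin N) ℤ)) (P : MvPolynomial (Fin N) ℤ)
    (h : ∀ f ∈ P.support, monomial f (1 : ℤ) ∈ K) : P ∈ K := by
  rw [P.as_sum]
  apply sum_mem
  intro f hf
  have : monomial f (coeff f P) = (coeff f P) • monomial f (1 : ℤ) := by
    rw [smul_monomial]; simp
  rw [this]
  exact K.zsmul_mem (h f hf) _

theorem straighten {N : ℕ} {B : Type*} [CommRing B] (ψ : MvPolynomial (Fin N) ℤ →+* B)
    (hψ : ∏ l, (Polynomial.X - Polynomial.C (ψ (X l))) = (Polynomial.X ^ N : Polynomial B))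
    (K : AddSubgroup (MvPolynomial (Fin N) ℤ)) (hK : ∀ p, ψ p = 0 → p ∈ K)
    (S : Finset (Fin N))
    (hgood : ∀ e : Fin N →₀ ℕ, (∀ k, e k ≤ k) → ¬ (∀ k ∈ S, 1 ≤ e k) → monomial e (1 : ℤ) ∈ K)
    (hbad : ∀ e : Fin N →₀ ℕ, (∀ k ∈ S, 1 ≤ e k) →
      (∀ e', lexlt e' e → monomial e' (1 : ℤ) ∈ K) → monomial e (1 : ℤ) ∈ K)
    (p : MvPolynomial (Fin N) ℤ) : p ∈ K := by
  have main : ∀ e : Fin N →₀ ℕ, monomial e (1 : ℤ) ∈ K := by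
    intro e
    induction e using (lexlt_wf N).induction with
    | h e ih =>
      by_cases h1 : ∀ k ∈ S, 1 ≤ e k
      · exact hbad e h1 ih
      by_cases h2 : ∀ k, e k ≤ k
      · exact hgood e h2 h1
      push Not at h2
      obtain ⟨k, hk⟩ := h2
      obtain ⟨r, hrm, hrd, hr0⟩ := red ψ hψ k
      set e0 := e - Finsupp.single k ((k : ℕ) + 1) with he0
      have hee : e = e0 + Finsupp.single k ((k : ℕ) + 1) := by
        rw [he0, tsub_add_cancel_of_le]
        intro j
        by_cases hj : j = k
        · subst hj; simp; omega
        · simp [Ne.symm hj]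
      set ρ := r.eval₂ (supported ℤ {l : Fin N | k < l}).val.toRingHom (X k) with hρ
      have h3 : monomial e0 (1 : ℤ) * ρ ∈ K := hK _ (by rw [map_mul, hr0, mul_zero])
      rw [hρ, Polynomial.eval₂_eq_sum_range, hrd, Finset.sum_range_succ] at h3
      have h4 : r.coeff (k + 1) = 1 := by rw [← hrd]; exact hrm
      rw [h4, RingHom.map_one, one_mul, mul_add] at h3
      have h5 : monomial e0 (1 : ℤ) * X k ^ ((k : ℕ) + 1) = monomial e 1 := by
        rw [X_pow_eq_monomial, monomial_mul, ← hee, mul_one]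
      rw [h5] at h3
      refine (K.add_mem_cancel_left ?_).mp h3
      rw [Finset.mul_sum]
      apply sum_mem
      intro i hi
      have hi' : i < k + 1 := Finset.mem_range.mp hi
      apply mem_of_lexlt
      intro f hf
      apply ih
      set c : MvPolynomial (Fin N) ℤ := (supported ℤ {l : Fin N | k < l}).val.toRingHom (r.coeff i)
        with hc
      have hcm : c ∈ supported ℤ {l : Fin N | k < l} := (r.coeff i).2
      rw [X_pow_eq_monomial, mul_comm c, ← mul_assoc, monomial_mul] at hf
      have hf2 := support_mul _ _ hf
      obtain ⟨a, ha, b, hb, rfl⟩ := Finset.mem_add.mp hf2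
      have ha' := support_monomial_subset ha
      rw [Finset.mem_singleton] at ha'
      subst ha'
      have hb0 : ∀ j, j ≤ k → b j = 0 := by
        intro j hj
        by_contra hne
        have : j ∈ c.vars := (mem_vars_iff_mem_support j).mpr ⟨b, hb, Finsupp.mem_support_iff.mpr hne⟩
        have := (mem_supported.mp hcm) (Finset.mem_coe.mpr this)
        exact absurd this (not_lt.mpr hj)
      refine ⟨k, ?_, ?_⟩
      · intro j hj
        rw [hee]
        simp [hb0 j hj.le, hj.ne']
      · conv_rhs => rw [hee]
        simp [hb0 k le_rfl]; omega
  exact mem_of_lexlt K p (fun f _ => main f)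



section span
variable {Q : Type*} [CommRing Q] {N m : ℕ}

lemma spanX (hm : 1 ≤ m) (x : Fin (N+1) → Q)
    (hx : ∏ l, (Polynomial.X - Polynomial.C (x l)) = (Polynomial.X ^ (N+1) : Polynomial Q))
    (h0 : x (Fin.last N) * ∏ l ∈ Finset.univ.filter
        (fun l : Fin (N+1) => N + 1 - m ≤ (l : ℕ) ∧ (l : ℕ) < N), (x (Fin.last N) - x l) = 0)
    (W : AddSubgroup Q)
    (hW : ∀ e : Fin (N+1) →₀ ℕ, (∀ k, e k ≤ k) →
      ¬ (∀ k : Fin (N+1), N + 1 - m ≤ (k : ℕ) → 1 ≤ e k) →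
      aeval x (monomial e (1 : ℤ)) ∈ W)
    (p : MvPolynomial (Fin (N+1)) ℤ) : aeval x p ∈ W := by
  set L := Finset.univ.filter (fun l : Fin (N+1) => N + 1 - m ≤ (l : ℕ) ∧ (l : ℕ) < N) with hL
  have hlastL : Fin.last N ∉ L := by simp [hL]
  have := straighten (ψ := (aeval x : MvPolynomial (Fin (N+1)) ℤ →ₐ[ℤ] Q).toRingHom)
    (by simpa using hx) (W.comap (aeval x : MvPolynomial (Fin (N+1)) ℤ →ₐ[ℤ] Q).toRingHom.toAddMonoidHom)
    (by
      intro p hp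
      rw [AddSubgroup.mem_comap]
      exact (hp : aeval x p = 0) ▸ W.zero_mem)
    (Finset.univ.filter (fun l : Fin (N+1) => N + 1 - m ≤ (l : ℕ)))
    (by
      intro e he1 he2
      exact hW e he1 (by simpa using he2))
    (by
      intro e he ih
      have he' : ∀ k : Fin (N+1), N + 1 - m ≤ (k : ℕ) → 1 ≤ e k := by simpa using he
      set one : Fin (N+1) →₀ ℕ := (∑ l ∈ L, Finsupp.single l 1) + Finsupp.single (Fin.last N) 1
        with hone
      have hsum : ∀ (t : Finset (Fin (N+1))) (j : Fin (N+1)),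
          (∑ l ∈ t, Finsupp.single l 1 : Fin (N+1) →₀ ℕ) j = if j ∈ t then 1 else 0 := by
        intro t j
        rw [Finsupp.finsetSum_apply]
        simp [Finsupp.single_apply]
      have hle : one ≤ e := by
        intro j
        rw [hone, Finsupp.add_apply, hsum]
        by_cases hj : j = Fin.last N
        · subst hj
          have := he' (Fin.last N) (by simp; omega)
          simp [hlastL, this]
        · by_cases hjL : j ∈ L
          · have := he' j (by simp [hL] at hjL; omega)
            simp [hjL, Ne.symm hj, this]
          · simp [hjL, Ne.symm hj]
      set e1 := e - one with he1
      have hee : e = e1 + one := (tsub_add_cancel_of_le hle).symm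
      set P : MvPolynomial (Fin (N+1)) ℤ := monomial e1 (1 : ℤ) * (X (Fin.last N) *
        ∏ l ∈ L, (X l + - X (Fin.last N))) with hP
      have hP0 : P ∈ (W.comap (aeval x : MvPolynomial (Fin (N+1)) ℤ →ₐ[ℤ] Q).toRingHom.toAddMonoidHom) := by
        rw [AddSubgroup.mem_comap]
        have : aeval x P = 0 := by
          have h1 : ∏ l ∈ L, (x l + - x (Fin.last N)) =
              (-1) ^ L.card * ∏ l ∈ L, (x (Fin.last N) - x l) := by
            rw [← Finset.prod_const, ← Finset.prod_mul_distrib]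
            apply Finset.prod_congr rfl; intros; ring
          rw [hP, map_mul, map_mul, map_prod]
          simp only [map_add, map_neg, aeval_X]
          rw [h1, mul_left_comm (x (Fin.last N)), h0]; simp
        change aeval x P ∈ W
        rw [this]; exact W.zero_mem
      have hmono : ∀ t : Finset (Fin (N+1)), (∏ l ∈ t, X l : MvPolynomial (Fin (N+1)) ℤ) =
          monomial (∑ l ∈ t, Finsupp.single l 1) 1 := by
        intro t
        induction t using Finset.induction_on with
        | empty => simp
        | insert a t ha ih =>
          rw [Finset.prod_insert ha, Finset.sum_insert ha, ih]
          unfold X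
          rw [monomial_mul]; simp
      rw [hP, Finset.prod_add, ← Finset.sum_erase_add _ _ (Finset.mem_powerset_self L), mul_add,
        mul_add] at hP0
      have h2 : monomial e1 (1 : ℤ) * (X (Fin.last N) *
          ((∏ l ∈ L, X l) * ∏ l ∈ L \ L, (- X (Fin.last N)))) = monomial e 1 := by
        rw [Finset.sdiff_self, Finset.prod_empty, mul_one, hmono]
        unfold X
        rw [monomial_mul, monomial_mul, hee, hone, add_comm (Finsupp.single _ _)]; simp
      rw [h2] at hP0
      refine (AddSubgroup.add_mem_cancel_left _ ?_).mp hP0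
      rw [Finset.mul_sum, Finset.mul_sum]
      apply sum_mem
      intro t ht
      obtain ⟨htL, ht⟩ := Finset.mem_erase.mp ht
      rw [Finset.mem_powerset] at ht
      set e2 := e1 + (Finsupp.single (Fin.last N) 1 + (∑ l ∈ t, Finsupp.single l 1 +
        Finsupp.single (Fin.last N) (L \ t).card)) with he2
      have h3 : monomial e1 (1 : ℤ) * (X (Fin.last N) *
          ((∏ l ∈ t, X l) * ∏ l ∈ L \ t, (- X (Fin.last N)))) =
          ((-1 : ℤ) ^ (L \ t).card) • monomial e2 1 := by
        have h4 : monomial e2 (1 : ℤ) = monomial e1 (1 : ℤ) * (X (Fin.last N) *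
            ((∏ l ∈ t, X l) * X (Fin.last N) ^ (L \ t).card)) := by
          rw [hmono, X_pow_eq_monomial]
          unfold X
          rw [monomial_mul, monomial_mul, monomial_mul, he2]
          simp
        rw [Finset.prod_const, neg_pow, h4, zsmul_eq_mul]
        push_cast
        ring
      rw [h3]
      apply AddSubgroup.zsmul_mem
      apply ih
      have hne : (L \ t).Nonempty := by
        rw [Finset.sdiff_nonempty]
        intro h; exact htL (Finset.Subset.antisymm ht h)
      set k := (L \ t).min' hne with hk
      have hkm : k ∈ L \ t := Finset.min'_mem _ _
      have hkL := (Finset.mem_sdiff.mp hkm).1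
      have hkt := (Finset.mem_sdiff.mp hkm).2
      have hklt : k < Fin.last N := by
        have : (k : ℕ) < N := by
          have := (Finset.mem_filter.mp hkL).2.2
          exact this
        exact this
      refine ⟨k, ?_, ?_⟩
      · intro j hj
        have hjt : j ∈ t ↔ j ∈ L := by
          constructor
          · intro h; exact ht h
          · intro h
            by_contra h'
            exact absurd (Finset.min'_le _ _ (Finset.mem_sdiff.mpr ⟨h, h'⟩)) (not_le.mpr hj)
        rw [hee, he2, hone]
        simp only [Finsupp.add_apply, hsum, hjt]
        simp [(hj.trans hklt).ne']
      · rw [hee, he2, hone]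
        simp only [Finsupp.add_apply, hsum]
        simp [hklt.ne', hkL, hkt])
    p
  exact this

end span


section span
variable {Q : Type*} [CommRing Q] {N m : ℕ}

lemma spanY (x : Fin (N+1) → Q) (y : Q)
    (hx : ∏ l, (Polynomial.X - Polynomial.C (x l)) = (Polynomial.X ^ (N+1) : Polynomial Q))
    (h0 : x (Fin.last N) * y = 0)
    (c : MvPolynomial (Fin (N+1)) ℤ)
    (h3 : y * ∏ j ∈ Finset.univ.filter (fun j : Fin N => m - 1 ≤ (j : ℕ)),
      x (Fin.castSucc (Fin.rev j)) = aeval x c)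
    (W : AddSubgroup Q) (hX : ∀ p : MvPolynomial (Fin (N+1)) ℤ, aeval x p ∈ W)
    (hW : ∀ e : Fin N →₀ ℕ, (∀ k, e k ≤ k) →
      ¬ (∀ k : Fin N, m - 1 ≤ (k : ℕ) → 1 ≤ e k) →
      y * aeval (fun j => x (Fin.castSucc (Fin.rev j))) (monomial e (1 : ℤ)) ∈ W)
    (p : MvPolynomial (Fin (N+1)) ℤ) : y * aeval x p ∈ W := by
  set z : Fin N → Q := fun j => x (Fin.castSucc (Fin.rev j)) with hz
  set A : Ideal Q := LinearMap.ker (LinearMap.mulLeft Q y) with hA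
  have memA : ∀ q, q ∈ A ↔ y * q = 0 := fun q => by rw [hA, LinearMap.mem_ker]; rfl
  have hlast : Ideal.Quotient.mk A (x (Fin.last N)) = 0 := by
    rw [Ideal.Quotient.eq_zero_iff_mem, memA, mul_comm, h0]
  have key : ∀ p : MvPolynomial (Fin N) ℤ, y * aeval z p ∈ W := by
    intro p
    have := straighten (ψ := (Ideal.Quotient.mk A).comp
        (aeval z : MvPolynomial (Fin N) ℤ →ₐ[ℤ] Q).toRingHom)
      (by
        have h1 := congrArg (Polynomial.map (Ideal.Quotient.mk A)) hx
        rw [Polynomial.map_prod, Fin.prod_univ_castSucc, Polynomial.map_pow, Polynomial.map_X,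
          pow_succ] at h1
        simp only [Polynomial.map_sub, Polynomial.map_X, Polynomial.map_C, hlast, map_zero,
          sub_zero] at h1
        have h2 := Polynomial.monic_X.isRegular.right h1
        rw [← h2, ← Equiv.prod_comp Fin.revPerm]
        simp [hz])
      (W.comap ((AddMonoidHom.mulLeft y).comp
        (aeval z : MvPolynomial (Fin N) ℤ →ₐ[ℤ] Q).toRingHom.toAddMonoidHom))
      (by
        intro p hp
        rw [AddSubgroup.mem_comap]
        have : aeval z p ∈ A := Ideal.Quotient.eq_zero_iff_mem.mp hp
        rw [memA] at this
        change y * aeval z p ∈ W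
        rw [this]; exact W.zero_mem)
      (Finset.univ.filter (fun j : Fin N => m - 1 ≤ (j : ℕ)))
      (by
        intro e he1 he2
        exact hW e he1 (by simpa using he2))
      (by
        intro e he _
        set S := Finset.univ.filter (fun j : Fin N => m - 1 ≤ (j : ℕ)) with hS
        have hmono : ∀ t : Finset (Fin N), (∏ l ∈ t, X l : MvPolynomial (Fin N) ℤ) =
            monomial (∑ l ∈ t, Finsupp.single l 1) 1 := by
          intro t
          induction t using Finset.induction_on with
          | empty => simp
          | insert a t ha ih =>
            rw [Finset.prod_insert ha, Finset.sum_insert ha, ih]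
            unfold X
            rw [monomial_mul]; simp
        have hle : (∑ l ∈ S, Finsupp.single l 1 : Fin N →₀ ℕ) ≤ e := by
          intro j
          rw [Finsupp.finsetSum_apply]
          by_cases hj : j ∈ S
          · have := he j hj
            simpa [Finsupp.single_apply, hj] using this
          · simp [Finsupp.single_apply, hj]
        have hee : monomial e (1 : ℤ) = monomial (e - ∑ l ∈ S, Finsupp.single l 1) 1 *
            ∏ l ∈ S, X l := by
          rw [hmono, monomial_mul, tsub_add_cancel_of_le hle, mul_one]
        rw [AddSubgroup.mem_comap]
        change y * aeval z (monomial e (1 : ℤ)) ∈ W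
        have : y * aeval z (monomial e (1 : ℤ)) =
            aeval x (rename (fun j => Fin.castSucc (Fin.rev j))
              (monomial (e - ∑ l ∈ S, Finsupp.single l 1) (1:ℤ)) * c) := by
          rw [hee, map_mul, map_mul, ← h3, aeval_rename, map_prod]
          simp only [aeval_X]
          change _ = aeval z _ * _
          ring
        rw [this]
        exact hX _)
      p
    exact this
  set σ : MvPolynomial (Fin (N+1)) ℤ →ₐ[ℤ] MvPolynomial (Fin N) ℤ :=
    aeval (Fin.lastCases (motive := fun _ => MvPolynomial (Fin N) ℤ) 0 (fun j => X (Fin.rev j)))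
    with hσ
  have h4 : (Ideal.Quotient.mk A).comp (aeval x : MvPolynomial (Fin (N+1)) ℤ →ₐ[ℤ] Q).toRingHom =
      (Ideal.Quotient.mk A).comp (((aeval z : MvPolynomial (Fin N) ℤ →ₐ[ℤ] Q).toRingHom).comp
        σ.toRingHom) := by
    apply MvPolynomial.ringHom_ext
    · intro r; simp
    · intro i
      refine Fin.lastCases ?_ (fun j => ?_) i
      · simp [hσ, hlast]
      · simp [hσ, hz]
  have h5 : y * aeval x p = y * aeval z (σ p) := by
    have := RingHom.congr_fun h4 p
    have h6 : aeval x p - aeval z (σ p) ∈ A := Ideal.Quotient.eq.mp this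
    rw [memA, mul_sub] at h6
    exact sub_eq_zero.mp h6
  rw [h5]; exact key _

lemma spanAll (hm : 1 ≤ m) (x y : Fin (N+1) → Q)
    (hx : ∏ l, (Polynomial.X - Polynomial.C (x l)) = (Polynomial.X ^ (N+1) : Polynomial Q))
    (h1 : ∀ k k', k ≠ k' → y k * y k' = 0)
    (h2 : ∀ k, x (Fin.last N) * y k = 0)
    (c : MvPolynomial (Fin (N+1)) ℤ)
    (h3 : ∀ k, y k * ∏ j ∈ Finset.univ.filter (fun j : Fin N => m - 1 ≤ (j : ℕ)),
      x (Fin.castSucc (Fin.rev j)) = aeval x c)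
    (h4 : ∑ k, y k = ∏ l ∈ Finset.univ.filter
        (fun l : Fin (N+1) => N + 1 - m ≤ (l : ℕ) ∧ (l : ℕ) < N), (x (Fin.last N) - x l))
    (W : AddSubgroup Q)
    (hW1 : ∀ e : Fin (N+1) →₀ ℕ, (∀ k, e k ≤ k) →
      ¬ (∀ k : Fin (N+1), N + 1 - m ≤ (k : ℕ) → 1 ≤ e k) →
      aeval x (monomial e (1 : ℤ)) ∈ W)
    (hW2 : ∀ (i : Fin N) (e : Fin N →₀ ℕ), (∀ k, e k ≤ k) →
      ¬ (∀ k : Fin N, m - 1 ≤ (k : ℕ) → 1 ≤ e k) →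
      y (Fin.castSucc i) *
        aeval (fun j => x (Fin.castSucc (Fin.rev j))) (monomial e (1 : ℤ)) ∈ W)
    (p : MvPolynomial (Fin (N+1) ⊕ Fin (N+1)) ℤ) : aeval (Sum.elim x y) p ∈ W := by
  have hX := spanX hm x hx (by rw [← h4, Finset.mul_sum]; exact Finset.sum_eq_zero fun k _ => h2 k)
    W hW1
  have hY1 : ∀ (i : Fin N) (p : MvPolynomial (Fin (N+1)) ℤ), y (Fin.castSucc i) * aeval x p ∈ W := fun i p =>
    spanY x _ hx (h2 _) c (h3 _) W hX (hW2 i) p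
  set s : MvPolynomial (Fin (N+1)) ℤ := ∏ l ∈ Finset.univ.filter
        (fun l : Fin (N+1) => N + 1 - m ≤ (l : ℕ) ∧ (l : ℕ) < N), (X (Fin.last N) - X l) with hs
  have hs' : ∑ k, y k = aeval x s := by rw [h4, hs, map_prod]; simp
  have hY : ∀ (i : Fin (N+1)) (p : MvPolynomial (Fin (N+1)) ℤ), y i * aeval x p ∈ W := by
    intro i p
    refine Fin.lastCases ?_ (fun j => hY1 j p) i
    have : y (Fin.last N) = aeval x s - ∑ i : Fin N, y (Fin.castSucc i) := by
      rw [← hs', Fin.sum_univ_castSucc]; ring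
    rw [this, sub_mul, ← map_mul, Finset.sum_mul]
    exact W.sub_mem (hX _) (W.sum_mem fun j _ => hY1 j p)
  set G : AddSubgroup Q := AddSubgroup.closure
    ({q | ∃ p : MvPolynomial (Fin (N+1)) ℤ, q = aeval x p} ∪ {q | ∃ (i : Fin (N+1)) (p : MvPolynomial (Fin (N+1)) ℤ), q = y i * aeval x p}) with hG
  have hGW : G ≤ W := by
    rw [hG, AddSubgroup.closure_le]
    rintro q (⟨p, rfl⟩ | ⟨i, p, rfl⟩)
    · exact hX p
    · exact hY i p
  have g1 : ∀ p : MvPolynomial (Fin (N+1)) ℤ, aeval x p ∈ G := fun p => AddSubgroup.subset_closure (Or.inl ⟨p, rfl⟩)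
  have g2 : ∀ i (p : MvPolynomial (Fin (N+1)) ℤ), y i * aeval x p ∈ G := fun i p => AddSubgroup.subset_closure (Or.inr ⟨i, p, rfl⟩)
  have hsq : ∀ i, y i * y i = y i * aeval x s := by
    intro i
    rw [← hs', Finset.mul_sum, Finset.sum_eq_single i]
    · intro b _ hb; exact h1 _ _ hb.symm
    · simp
  apply hGW
  induction p using MvPolynomial.induction_on with
  | C a => have := g1 (C a); simpa using this
  | add p q hp hq => rw [map_add]; exact G.add_mem hp hq
  | mul_X p i hp =>
    rw [map_mul, aeval_X]
    generalize aeval (Sum.elim x y) p = q at hp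
    refine AddSubgroup.closure_induction (p := fun q _ => q * Sum.elim x y i ∈ G) ?_ ?_ ?_ ?_ hp
    · rintro q (⟨p, rfl⟩ | ⟨k, p, rfl⟩)
      · rcases i with i | i
        · have := g1 (p * X i); simpa using this
        · have := g2 i p; simpa [mul_comm] using this
      · rcases i with i | i
        · have := g2 k (p * X i); simpa [mul_assoc] using this
        · by_cases hk : k = i
          · subst hk
            have := g2 k (s * p)
            rw [map_mul, ← mul_assoc, ← hsq] at this
            simpa [mul_assoc, mul_comm, mul_left_comm] using this
          · have : y k * aeval x p * Sum.elim x y (Sum.inr i) = 0 := by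
              rw [Sum.elim_inr, mul_right_comm, h1 _ _ hk, zero_mul]
            rw [this]; exact G.zero_mem
    · rw [zero_mul]; exact G.zero_mem
    · intro a b _ _ ha hb; rw [add_mul]; exact G.add_mem ha hb
    · intro a _ ha; rw [neg_mul]; exact G.neg_mem ha

end span


lemma prod_count (N a : ℕ) (ha : a ≤ N + 1) :
    ∏ k ∈ Finset.range (N+1), (if a ≤ k then k else k + 1) = a * N.factorial := by
  induction N with
  | zero => interval_cases a <;> simp
  | succ N ih =>
    by_cases h : a ≤ N + 1
    · rw [Finset.prod_range_succ, ih h, if_pos h, Nat.factorial_succ]; ring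
    · have h' : a = N + 2 := by omega
      subst h'
      rw [Finset.prod_congr rfl (g := fun k => k + 1), Finset.prod_range_add_one_eq_factorial,
        Nat.factorial_succ (N+1)]
      intro k hk
      rw [Finset.mem_range] at hk
      rw [if_neg (by omega)]

/-- exponents of the good monomials -/
def goodE (N a : ℕ) : Finset (Fin N → ℕ) :=
  Fintype.piFinset (fun k : Fin N => Finset.range ((k : ℕ) + 1)) \
    Fintype.piFinset (fun k : Fin N => if a ≤ (k : ℕ) then Finset.Icc 1 (k : ℕ)
      else Finset.range ((k : ℕ) + 1))

lemma mem_goodE {N a : ℕ} (e : Fin N → ℕ) (h1 : ∀ k, e k ≤ k)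
    (h2 : ¬ ∀ k : Fin N, a ≤ (k : ℕ) → 1 ≤ e k) : e ∈ goodE N a := by
  rw [goodE, Finset.mem_sdiff, Fintype.mem_piFinset, Fintype.mem_piFinset]
  refine ⟨fun k => by have := h1 k; simp; omega, fun h => h2 fun k hk => ?_⟩
  have := h k
  rw [if_pos hk, Finset.mem_Icc] at this
  exact this.1

lemma card_goodE (N a : ℕ) (ha : a ≤ N + 1) :
    (goodE (N+1) a).card = (N + 1 - a) * N.factorial := by
  rw [goodE, Finset.card_sdiff_of_subset, Fintype.card_piFinset, Fintype.card_piFinset]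
  · simp only [Finset.card_range, apply_ite Finset.card, Nat.card_Icc, Nat.add_sub_cancel]
    rw [Fin.prod_univ_eq_prod_range (fun k => k + 1) (N+1),
      Fin.prod_univ_eq_prod_range (fun k => if a ≤ k then k else k + 1) (N+1), prod_count N a ha,
      Finset.prod_range_add_one_eq_factorial, Nat.factorial_succ, Nat.sub_mul]
  · apply Fintype.piFinset_subset
    intro k
    split_ifs
    · intro j; simp
    · exact Finset.Subset.refl _

/-- index type of the basis -/
abbrev idx (N m : ℕ) := {e // e ∈ goodE (N+1) (N+1-m)} ⊕ (Fin N × {e // e ∈ goodE N (m-1)})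

lemma card_idx (N m : ℕ) (hN : 1 ≤ N) (hm : 1 ≤ m) (hmN : m ≤ N + 1) :
    Fintype.card (idx N m) = Fintype.card (Equiv.Perm (Fin (N+1))) := by
  obtain ⟨N, rfl⟩ : ∃ N', N = N' + 1 := ⟨N - 1, by omega⟩
  rw [Fintype.card_sum, Fintype.card_prod, Fintype.card_coe, Fintype.card_coe,
    card_goodE _ _ (by omega), card_goodE _ _ (by omega), Fintype.card_perm, Fintype.card_fin,
    Fintype.card_fin, Nat.factorial_succ (N+1), Nat.factorial_succ N]
  obtain ⟨a, rfl⟩ : ∃ a, m = a + 1 := ⟨m - 1, by omega⟩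
  have e1 : N + 1 + 1 - (N + 1 + 1 - (a + 1)) = a + 1 := by omega
  have e2 : N + 1 - (a + 1 - 1) = N + 1 - a := by omega
  rw [e1, e2]
  obtain ⟨b, hb⟩ : ∃ b, N + 1 = a + b := ⟨N + 1 - a, by omega⟩
  have e3 : N + 1 - a = b := by omega
  rw [e3, hb]; ring



/-- the augmentation ideal -/
noncomputable def mI (n : ℕ) : Ideal (MvPolynomial (Fin n) ℤ) := Ideal.span (Set.range X)

lemma mI_coeff {n : ℕ} {p : MvPolynomial (Fin n) ℤ} (hp : p ∈ mI n) : constantCoeff p = 0 := by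
  have : mI n ≤ RingHom.ker (constantCoeff : MvPolynomial (Fin n) ℤ →+* ℤ) := by
    rw [mI, Ideal.span_le]
    rintro _ ⟨i, rfl⟩
    simp
  exact this hp

open scoped Pointwise in
lemma indep {n : ℕ} (M : Submodule (MvPolynomial (Fin n) ℤ) (PR n))
    (b : Equiv.Perm (Fin n) → PR n) (D : MvPolynomial (Fin n) ℤ) (hD : D ≠ 0)
    (hDM : ∀ w, Pi.single w D ∈ M)
    (hspan : M ≤ Submodule.span _ (Set.range b) ⊔ mI n • M)
    (c : Equiv.Perm (Fin n) → ℤ)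
    (hc : ∑ σ, (C (c σ) : MvPolynomial (Fin n) ℤ) • b σ ∈ mI n • M) : c = 0 := by
  classical
  obtain ⟨r, hr1, hr⟩ := Submodule.exists_sub_one_mem_and_smul_le_of_fg_of_le_sup
    (IsNoetherian.noetherian M) le_rfl hspan
  have hrc : constantCoeff r = 1 := by
    have := mI_coeff hr1
    simpa [sub_eq_zero] using this
  have hr0 : r ≠ 0 := by rintro rfl; simp at hrc
  have hr' : ∀ v ∈ M, r • v ∈ Submodule.span (MvPolynomial (Fin n) ℤ) (Set.range b) := fun v hv =>
    hr (Submodule.smul_mem_pointwise_smul _ _ _ hv)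
  set B : Matrix (Equiv.Perm (Fin n)) (Equiv.Perm (Fin n)) (MvPolynomial (Fin n) ℤ) :=
    Matrix.of fun σ w => b σ w with hB
  have hA : ∀ w : Equiv.Perm (Fin n), ∃ a : Equiv.Perm (Fin n) → MvPolynomial (Fin n) ℤ,
      ∑ σ, a σ • b σ = r • Pi.single w D := fun w =>
    Submodule.mem_span_range_iff_exists_fun _ |>.mp (hr' _ (hDM w))
  choose A hA using hA
  have hAB : (Matrix.of A) * B = (r * D) • (1 : Matrix _ _ _) := by
    ext w v
    rw [Matrix.mul_apply]
    have := congrFun (hA w) v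
    simp only [Finset.sum_apply, Pi.smul_apply, smul_eq_mul] at this
    simp only [Matrix.of_apply, hB, this, Matrix.smul_apply, Matrix.one_apply, Pi.single_apply,
      smul_eq_mul, mul_ite, mul_one, mul_zero, eq_comm]

  have hdet : B.det ≠ 0 := by
    intro h
    have := congrArg Matrix.det hAB
    rw [Matrix.det_mul, h, mul_zero, Matrix.det_smul, Matrix.det_one, mul_one] at this
    exact pow_ne_zero _ (mul_ne_zero hr0 hD) this.symm
  have hru : r • ∑ σ, (C (c σ) : MvPolynomial (Fin n) ℤ) • b σ ∈
      mI n • Submodule.span (MvPolynomial (Fin n) ℤ) (Set.range b) := by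
    have h1 : r • ∑ σ, (C (c σ) : MvPolynomial (Fin n) ℤ) • b σ ∈ r • (mI n • M) :=
      Submodule.smul_mem_pointwise_smul _ _ _ hc
    refine Submodule.smul_induction_on hc ?_ ?_
    · intro a ha v hv
      rw [smul_comm]
      exact Submodule.smul_mem_smul ha (hr' v hv)
    · intro u v hu hv
      rw [smul_add]; exact Submodule.add_mem _ hu hv
  obtain ⟨a, ha, hab⟩ := (Submodule.mem_ideal_smul_span_iff_exists_sum _ _ _).mp hru
  have hz : (fun σ => r * C (c σ) - a σ) = 0 := by
    apply Matrix.eq_zero_of_vecMul_eq_zero hdet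
    ext1 v
    rw [Finsupp.sum_fintype _ _ (by simp)] at hab
    have := congrFun hab v
    simp only [Finset.sum_apply, Pi.smul_apply, smul_eq_mul] at this
    simp only [Matrix.vecMul, dotProduct, hB, Matrix.of_apply, sub_mul, Finset.sum_sub_distrib,
      this, Pi.zero_apply, Finset.mul_sum, mul_assoc, sub_self]
  ext σ
  have := congrFun hz σ
  have h2 := congrArg constantCoeff (sub_eq_zero.mp this)
  rw [mI_coeff (ha σ)] at h2
  simpa [hrc] using h2

/-- the GKM ring as a module -/
noncomputable def gM (n m : ℕ) : Submodule (MvPolynomial (Fin n) ℤ) (PR n) where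
  carrier := gkmSubring n m
  zero_mem' := (gkmSubring n m).zero_mem
  add_mem' := (gkmSubring n m).add_mem
  smul_mem' := by
    intro c v hv
    have := (gkmSubring n m).mul_mem (const_mem n m c) hv
    rw [← Algebra.smul_def] at this
    exact this

lemma mem_gM {n m : ℕ} {v : PR n} : v ∈ gM n m ↔ v ∈ gkmSubring n m := Iff.rfl

lemma exists_D (n m : ℕ) : ∃ D : MvPolynomial (Fin n) ℤ, D ≠ 0 ∧
    ∀ w, Pi.single w D ∈ gM n m := by
  refine ⟨∏ p ∈ (Finset.univ : Finset (Fin n)).offDiag, (X p.1 - X p.2), ?_, ?_⟩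
  · rw [Finset.prod_ne_zero_iff]
    rintro ⟨i, j⟩ h
    rw [Finset.mem_offDiag] at h
    rw [sub_ne_zero]
    intro h'
    exact h.2.2 (X_injective h')
  · intro w
    rw [mem_gM, mem_gkm]
    intro v i j hij _
    have key : (X (v i) - X (v j) : MvPolynomial (Fin n) ℤ) ∣
        ∏ p ∈ (Finset.univ : Finset (Fin n)).offDiag, (X p.1 - X p.2) := by
      refine Finset.dvd_prod_of_mem (fun p : Fin n × Fin n => (X p.1 - X p.2 : MvPolynomial (Fin n) ℤ))
        (a := (v i, v j)) ?_
      simp [hij.ne]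
    apply dvd_sub
    · rw [Pi.single_apply]; split_ifs
      · exact key
      · exact dvd_zero _
    · rw [Pi.single_apply]; split_ifs
      · exact key
      · exact dvd_zero _

lemma Jt_smul {n m : ℕ} {z : gkmSubring n m} (hz : z ∈ Jt n m) : (z : PR n) ∈ mI n • gM n m := by
  induction hz using Submodule.span_induction with
  | mem x hx =>
    obtain ⟨k, rfl⟩ := hx
    have : (tkR n m k : PR n) = (X k : MvPolynomial (Fin n) ℤ) • (1 : PR n) := by
      ext1 w; simp [tkR]
    rw [this]
    exact Submodule.smul_mem_smul (Ideal.subset_span ⟨k, rfl⟩) (gkmSubring n m).one_mem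
  | zero => simp
  | add x y _ _ hx hy => exact Submodule.add_mem _ hx hy
  | smul a x _ hx =>
    rw [smul_eq_mul]
    change (a : PR n) * (x : PR n) ∈ _
    refine Submodule.smul_induction_on (p := fun x => (a : PR n) * x ∈ mI n • gM n m) hx ?_ ?_
    · intro r hr v hv
      rw [mul_smul_comm]
      exact Submodule.smul_mem_smul hr ((gkmSubring n m).mul_mem a.2 hv)
    · intro u v hu hv
      rw [mul_add]; exact Submodule.add_mem _ hu hv

/-- constants -/
noncomputable def kap (n m : ℕ) : MvPolynomial (Fin n) ℤ →+* gkmSubring n m :=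
  (algebraMap (MvPolynomial (Fin n) ℤ) (PR n)).codRestrict _ (const_mem n m)

lemma kap_apply (n m : ℕ) (c : MvPolynomial (Fin n) ℤ) (w) : (kap n m c : PR n) w = c := by
  simp [kap]

lemma mk_kap (n m : ℕ) (c : MvPolynomial (Fin n) ℤ) :
    Ideal.Quotient.mk (Jt n m) (kap n m c) = ((constantCoeff c : ℤ) : _ ⧸ Jt n m) := by
  have hX : ∀ i, Ideal.Quotient.mk (Jt n m) (kap n m (X i)) = 0 := by
    intro i
    rw [Ideal.Quotient.eq_zero_iff_mem]
    refine Ideal.subset_span ⟨i, ?_⟩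
    apply Subtype.ext; ext1 w; rw [kap_apply]; rfl
  have : (Ideal.Quotient.mk (Jt n m)).comp (kap n m) =
      (Int.castRingHom (gkmSubring n m ⧸ Jt n m)).comp constantCoeff := by
    apply MvPolynomial.ringHom_ext
    · intro r
      simp
    · intro i; simp [hX]
  exact RingHom.congr_fun this c

lemma mk_tkR (n m : ℕ) (k) : Ideal.Quotient.mk (Jt n m) (tkR n m k) = 0 :=
  Ideal.Quotient.eq_zero_iff_mem.mpr (Ideal.subset_span ⟨k, rfl⟩)



section rel
variable (n m : ℕ) (hn : 0 < n)

noncomputable def xe (k : Fin n) : gkmSubring n m := ⟨xk n k, xk_mem n m k⟩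
noncomputable def ye (k : Fin n) : gkmSubring n m := ⟨yk n m hn k, yk_mem n m hn k⟩

lemma coe_prod_apply {n m : ℕ} {ι : Type*} (s : Finset ι) (f : ι → gkmSubring n m) (w) :
    ((∏ i ∈ s, f i : gkmSubring n m) : PR n) w = ∏ i ∈ s, (f i : PR n) w := by
  rw [SubmonoidClass.coe_finsetProd, Finset.prod_apply]

lemma coe_sum_apply {n m : ℕ} {ι : Type*} (s : Finset ι) (f : ι → gkmSubring n m) (w) :
    ((∑ i ∈ s, f i : gkmSubring n m) : PR n) w = ∑ i ∈ s, (f i : PR n) w := by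
  rw [AddSubmonoidClass.coe_finsetSum, Finset.sum_apply]

lemma rel1 (k k' : Fin n) (h : k ≠ k') : ye n m hn k * ye n m hn k' = 0 := by
  apply Subtype.ext; ext1 w
  change yk n m hn k w * yk n m hn k' w = 0
  unfold yk
  split_ifs with h1 h2 <;> simp
  exact absurd (h1.symm.trans h2) h

lemma rel2 (k : Fin n) : xe n m ⟨n - 1, by omega⟩ * ye n m hn k = tkR n m k * ye n m hn k := by
  apply Subtype.ext; ext1 w
  change xk n _ w * yk n m hn k w = X k * yk n m hn k w
  unfold yk xk
  split_ifs with h1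
  · rw [h1]
  · simp

lemma rel3' (hm : 1 ≤ m) (hmn : m ≤ n) (k : Fin n) (w : Equiv.Perm (Fin n)) :
    yk n m hn k w * ∏ l ∈ Finset.univ.filter (fun l : Fin n => (l : ℕ) < n - m),
      (X k - X (w l)) =
      ∏ l ∈ Finset.univ.filter (fun l : Fin n => (l : ℕ) < n - 1),
        (X k - X (w l) : MvPolynomial (Fin n) ℤ) := by
  unfold yk
  split_ifs with h1
  · rw [← Finset.prod_union]
    · congr 1
      ext l
      simp only [Finset.mem_union, Finset.mem_filter, Finset.mem_univ, true_and]
      omega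
    · rw [Finset.disjoint_left]
      intro l
      simp only [Finset.mem_filter, Finset.mem_univ, true_and]
      omega
  · rw [zero_mul, eq_comm]
    have hne : w.symm k ≠ ⟨n - 1, by omega⟩ := by
      intro h; apply h1; rw [← h]; simp
    have hlt : ((w.symm k : Fin n) : ℕ) < n - 1 := by
      have h2 := (w.symm k).2
      have : ((w.symm k : Fin n) : ℕ) ≠ n - 1 := fun h => hne (Fin.ext h)
      omega
    apply Finset.prod_eq_zero (i := w.symm k)
    · simpa using hlt
    · simp

lemma rel3 (hm : 1 ≤ m) (hmn : m ≤ n) (k : Fin n) :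
    ye n m hn k * ∏ l ∈ Finset.univ.filter (fun l : Fin n => (l : ℕ) < n - m),
      (tkR n m k - xe n m l) =
      ∏ l ∈ Finset.univ.filter (fun l : Fin n => (l : ℕ) < n - 1), (tkR n m k - xe n m l) := by
  apply Subtype.ext; ext1 w
  have h1 : ∀ a b : gkmSubring n m, ((a * b : gkmSubring n m) : PR n) w =
    (a : PR n) w * (b : PR n) w := fun _ _ => rfl
  have h2 : ∀ l, ((tkR n m k - xe n m l : gkmSubring n m) : PR n) w = X k - X (w l) :=
    fun _ => rfl
  have h3 : (ye n m hn k : PR n) w = yk n m hn k w := rfl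
  rw [h1, coe_prod_apply, coe_prod_apply, h3]
  simp only [h2]
  exact rel3' n m hn hm hmn k w

lemma rel4 : ∑ k, ye n m hn k = ∏ l ∈ Finset.univ.filter
      (fun l : Fin n => n - m ≤ (l : ℕ) ∧ (l : ℕ) < n - 1),
        (xe n m ⟨n - 1, by omega⟩ - xe n m l) := by
  apply Subtype.ext; ext1 w
  rw [coe_prod_apply, coe_sum_apply]
  change ∑ k, yk n m hn k w = ∏ l ∈ _, (X (w _) - X (w l))
  unfold yk
  simp

lemma rel5 (i : ℕ) : aeval (xe n m) (esymm (Fin n) ℤ i) = kap n m (esymm (Fin n) ℤ i) := by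
  apply Subtype.ext; ext1 w
  rw [kap_apply]
  have h : ((Pi.evalRingHom (fun _ => MvPolynomial (Fin n) ℤ) w).comp
      (gkmSubring n m).subtype).comp
      (aeval (xe n m) : MvPolynomial (Fin n) ℤ →ₐ[ℤ] gkmSubring n m).toRingHom =
      (rename w : MvPolynomial (Fin n) ℤ →ₐ[ℤ] _).toRingHom := by
    apply MvPolynomial.ringHom_ext
    · intro r; simp
    · intro i; simp [xe, xk]
  have := RingHom.congr_fun h (esymm (Fin n) ℤ i)
  exact this.trans (rename_esymm _ _ _ w)

lemma coeff_esymm (i : ℕ) (hi : 1 ≤ i) : constantCoeff (esymm (Fin n) ℤ i) = 0 := by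
  rw [esymm, map_sum]
  apply Finset.sum_eq_zero
  intro t ht
  rw [Finset.mem_powersetCard] at ht
  obtain ⟨j, hj⟩ : t.Nonempty := by rw [← Finset.card_pos]; omega
  rw [map_prod]
  exact Finset.prod_eq_zero hj (by simp)

/-- the evaluation map -/
noncomputable def Psi : MvPolynomial (Fin n ⊕ Fin n) ℤ →ₐ[ℤ] gkmSubring n m :=
  aeval (Sum.elim (xe n m) (ye n m hn))

noncomputable def Phi : MvPolynomial (Fin n ⊕ Fin n) ℤ →+* gkmSubring n m ⧸ Jt n m :=
  (Ideal.Quotient.mk (Jt n m)).comp (Psi n m hn).toRingHom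

lemma Phi_apply (p) : Phi n m hn p = Ideal.Quotient.mk (Jt n m) (Psi n m hn p) := rfl
lemma Psi_x (k) : Psi n m hn (xv n k) = xe n m k := by simp [Psi, xv]
lemma Psi_y (k) : Psi n m hn (yv n k) = ye n m hn k := by simp [Psi, yv]

lemma I'_le (hm : 1 ≤ m) (hmn : m ≤ n) : I' n m hn ≤ RingHom.ker (Phi n m hn) := by
  rw [I', Ideal.span_le]
  rintro p (⟨k, k', h, rfl⟩ | ⟨k, rfl⟩ | ⟨k, rfl⟩ | rfl | ⟨i, hi, _, rfl⟩) <;>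
    rw [SetLike.mem_coe, RingHom.mem_ker, Phi_apply]
  · rw [map_mul, Psi_y, Psi_y, rel1 n m hn k k' h, map_zero]
  · rw [map_mul, Psi_x, Psi_y, rel2, map_mul, mk_tkR, zero_mul]
  · have := congrArg (Ideal.Quotient.mk (Jt n m)) (rel3 n m hn hm hmn k)
    simp only [map_mul, map_prod, map_sub, mk_tkR, zero_sub] at this
    simp only [map_mul, map_prod, map_sub, map_neg, Psi_x, Psi_y, this, sub_self]
  · rw [map_sub, map_sum, map_prod]
    simp only [map_sub, Psi_x, Psi_y]
    rw [rel4]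
    simp
  · have h1 : Psi n m hn (rename Sum.inl (esymm (Fin n) ℤ i)) = aeval (xe n m) (esymm (Fin n) ℤ i) := by
      rw [Psi, aeval_rename]; rfl
    rw [h1, rel5, mk_kap, coeff_esymm n i hi, Int.cast_zero]

lemma Phi_surj : Function.Surjective (Phi n m hn) := by
  have key : ∀ α ∈ TT n m hn, ∃ h : α ∈ gkmSubring n m,
      Ideal.Quotient.mk (Jt n m) ⟨α, h⟩ ∈ (Phi n m hn).range := by
    intro α hα
    induction hα using Algebra.adjoin_induction with
    | mem x hx =>
      rcases hx with ⟨k, rfl⟩ | ⟨k, rfl⟩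
      · exact ⟨xk_mem n m k, xv n k, by rw [Phi_apply, Psi_x]; rfl⟩
      · exact ⟨yk_mem n m hn k, yv n k, by rw [Phi_apply, Psi_y]; rfl⟩
    | algebraMap c =>
      refine ⟨const_mem n m c, ?_⟩
      have := mk_kap n m c
      change Ideal.Quotient.mk (Jt n m) (kap n m c) ∈ _
      rw [this]
      exact intCast_mem _ _
    | add x y _ _ hx hy =>
      obtain ⟨hx, hx'⟩ := hx
      obtain ⟨hy, hy'⟩ := hy
      exact ⟨add_mem hx hy, add_mem hx' hy'⟩
    | mul x y _ _ hx hy =>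
      obtain ⟨hx, hx'⟩ := hx
      obtain ⟨hy, hy'⟩ := hy
      exact ⟨mul_mem hx hy, mul_mem hx' hy'⟩
  intro q
  obtain ⟨⟨α, hα⟩, rfl⟩ := Ideal.Quotient.mk_surjective q
  obtain ⟨h, h'⟩ := key α (mem_TT' n m hn α hα)
  exact h'

lemma vieta {Q : Type*} [CommRing Q] (x : Fin n → Q)
    (h : ∀ i, 1 ≤ i → i ≤ n → aeval x (esymm (Fin n) ℤ i) = 0) :
    ∏ l, (Polynomial.X - Polynomial.C (x l)) = (Polynomial.X ^ n : Polynomial Q) := by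
  have h1 := Multiset.prod_X_sub_X_eq_sum_esymm (Finset.univ.val.map x)
  rw [Multiset.map_map] at h1
  have h2 : ∀ j, (Finset.univ.val.map x).esymm j = aeval x (esymm (Fin n) ℤ j) := by
    intro j; rw [aeval_esymm_eq_multiset_esymm]
  have h3 : ∏ l, (Polynomial.X - Polynomial.C (x l)) = _ := h1
  rw [h3, Finset.sum_eq_single 0]
  · rw [h2, esymm_zero]; simp
  · intro b hb hb0
    rw [h2, h b (by omega) (by simp at hb; omega)]; simp
  · simp

end rel


section fin
variable (N m : ℕ)

lemma prod_rev {Q : Type*} [CommRing Q] (hm : 1 ≤ m) (hmN : m ≤ N + 1) (f : Fin (N+1) → Q) :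
    ∏ l ∈ Finset.univ.filter (fun l : Fin (N+1) => (l : ℕ) < N + 1 - m), f l =
    ∏ j ∈ Finset.univ.filter (fun j : Fin N => m - 1 ≤ (j : ℕ)), f (Fin.castSucc (Fin.rev j)) := by
  rw [Finset.prod_filter, Fin.prod_univ_castSucc, Finset.prod_filter, ← Equiv.prod_comp Fin.revPerm]
  rw [if_neg (by simp; omega), mul_one]
  apply Finset.prod_congr rfl
  intro j _
  have hj := j.2
  have : ((Fin.castSucc (Fin.revPerm j) : Fin (N+1)) : ℕ) < N + 1 - m ↔ m - 1 ≤ (j : ℕ) := by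
    simp only [Fin.revPerm_apply, Fin.val_castSucc, Fin.val_rev]; omega
  simp only [this]
  rfl

lemma prod_neg' {Q ι : Type*} [CommRing Q] (s : Finset ι) (f : ι → Q) :
    ∏ i ∈ s, (- f i) = (-1) ^ s.card * ∏ i ∈ s, f i := by
  rw [← Finset.prod_const, ← Finset.prod_mul_distrib]
  simp

/-- monomial basis -/
noncomputable def gg : idx N m → MvPolynomial (Fin (N+1) ⊕ Fin (N+1)) ℤ
  | Sum.inl e => rename Sum.inl (monomial (Finsupp.equivFunOnFinite.symm e.1) (1 : ℤ))
  | Sum.inr (i, e) => X (Sum.inr (Fin.castSucc i)) *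
      rename (fun j => Sum.inl (Fin.castSucc (Fin.rev j)))
        (monomial (Finsupp.equivFunOnFinite.symm e.1) (1 : ℤ))

lemma span_gg' {Q : Type*} [CommRing Q] (hm : 1 ≤ m) (hmN : m ≤ N + 1)
    (π : MvPolynomial (Fin (N+1) ⊕ Fin (N+1)) ℤ →+* Q)
    (hmem : ∀ q ∈ I' (N+1) m (Nat.succ_pos N), π q = 0)
    (p : MvPolynomial (Fin (N+1) ⊕ Fin (N+1)) ℤ) :
    ∃ c : idx N m → ℤ, ∑ s, c s • π (gg N m s) = π p := by
  set x : Fin (N+1) → Q := fun k => π (xv (N+1) k) with hx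
  set y : Fin (N+1) → Q := fun k => π (yv (N+1) k) with hy
  have hpi : ∀ p, aeval (Sum.elim x y) p = π p := by
    have : (aeval (Sum.elim x y) : MvPolynomial (Fin (N+1) ⊕ Fin (N+1)) ℤ →ₐ[ℤ] Q).toRingHom
        = π := by
      apply MvPolynomial.ringHom_ext
      · intro r; simp
      · rintro (i | i) <;> simp [hx, hy, xv, yv]
    exact fun p => RingHom.congr_fun this p
  have hpx : ∀ p : MvPolynomial (Fin (N+1)) ℤ, aeval x p = π (rename Sum.inl p) := by
    intro p; rw [← hpi, aeval_rename]; rfl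
  set W : AddSubgroup (Q) := (Submodule.span ℤ (Set.range (fun s => π (gg N m s)))).toAddSubgroup
    with hW
  have hWg : ∀ s, π (gg N m s) ∈ W := fun s => Submodule.subset_span ⟨s, rfl⟩
  have main := spanAll (N := N) (m := m) hm x y
    (by
      apply vieta
      intro i hi hi'
      rw [hpx]
      exact hmem _ (Ideal.subset_span (Or.inr (Or.inr (Or.inr (Or.inr ⟨i, hi, hi', rfl⟩))))))
    (by
      intro k k' h
      rw [hy]
      simp only
      rw [← map_mul]
      exact hmem _ (Ideal.subset_span (Or.inl ⟨k, k', h, rfl⟩)))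
    (by
      intro k
      rw [hx, hy]
      simp only
      rw [← map_mul]
      exact hmem _ (Ideal.subset_span (Or.inr (Or.inl ⟨k, rfl⟩))))
    ((-1) ^ (Finset.univ.filter (fun j : Fin N => m - 1 ≤ (j : ℕ))).card *
      ∏ l ∈ Finset.univ.filter (fun l : Fin (N+1) => (l : ℕ) < N + 1 - 1), (- X l))
    (by
      intro k
      have h := hmem _ (Ideal.subset_span (Or.inr (Or.inr (Or.inl ⟨k, rfl⟩))))
      rw [map_sub, map_mul, map_prod, map_prod, sub_eq_zero] at h
      simp only [map_neg] at h
      change y k * ∏ l ∈ _, (- x l) = ∏ l ∈ _, (- x l) at h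
      rw [prod_rev N m hm hmN (fun l => - x l),
        prod_neg' _ (fun j : Fin N => x (Fin.castSucc (Fin.rev j)))] at h
      rw [map_mul, map_pow, map_prod]
      simp only [map_neg, map_one, aeval_X]
      rw [← h, mul_left_comm, ← mul_assoc ((-1) ^ _), ← mul_pow]
      simp)
    (by
      have h := hmem _ (Ideal.subset_span (Or.inr (Or.inr (Or.inr (Or.inl rfl)))))
      rw [map_sub, map_sum, map_prod, sub_eq_zero] at h
      simp only [map_sub] at h
      exact h)
    W
    (by
      intro e h1 h2
      have := hWg (Sum.inl ⟨e, mem_goodE _ h1 h2⟩)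
      rw [hpx]
      simpa only [gg, Finsupp.equivFunOnFinite_symm_coe] using this)
    (by
      intro i e h1 h2
      have := hWg (Sum.inr (i, ⟨e, mem_goodE _ h1 h2⟩))
      simp only [gg, Finsupp.equivFunOnFinite_symm_coe] at this
      rw [map_mul, ← hpi (rename _ _), aeval_rename] at this
      exact this)
    p
  rw [hpi] at main
  obtain ⟨c, hc⟩ := (Submodule.mem_span_range_iff_exists_fun ℤ).mp main
  exact ⟨c, hc⟩

lemma span_gg (hm : 1 ≤ m) (hmN : m ≤ N + 1)
    (p : MvPolynomial (Fin (N+1) ⊕ Fin (N+1)) ℤ) :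
    ∃ c : idx N m → ℤ, p - ∑ s, c s • gg N m s ∈ I' (N+1) m (Nat.succ_pos N) := by
  obtain ⟨c, hc⟩ := span_gg' N m hm hmN (Ideal.Quotient.mk (I' (N+1) m (Nat.succ_pos N)))
    (fun q hq => Ideal.Quotient.eq_zero_iff_mem.mpr hq) p
  refine ⟨c, ?_⟩
  rw [← Ideal.Quotient.eq, map_sum, ← hc]
  apply Finset.sum_congr rfl
  intro s _
  exact (map_zsmul _ _ _).symm

lemma Phi_inj (hN : 1 ≤ N) (hm : 1 ≤ m) (hmN : m ≤ N + 1)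
    (p : MvPolynomial (Fin (N+1) ⊕ Fin (N+1)) ℤ) (hp : Phi (N+1) m (Nat.succ_pos N) p = 0) :
    p ∈ I' (N+1) m (Nat.succ_pos N) := by
  have hker := I'_le (N+1) m (Nat.succ_pos N) hm hmN
  set E : Equiv.Perm (Fin (N+1)) ≃ idx N m := (Fintype.equivOfCardEq (card_idx N m hN hm hmN)).symm
  set b : Equiv.Perm (Fin (N+1)) → PR (N+1) := fun σ =>
    (Psi (N+1) m (Nat.succ_pos N) (gg N m (E σ)) : PR (N+1)) with hb
  obtain ⟨D, hD, hDM⟩ := exists_D (N+1) m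
  have hsum : ∀ c : idx N m → ℤ,
      (Psi (N+1) m (Nat.succ_pos N) (∑ s, c s • gg N m s) : PR (N+1)) =
      ∑ σ, (C (c (E σ)) : MvPolynomial (Fin (N+1)) ℤ) • b σ := by
    intro c
    rw [← E.sum_comp, map_sum, AddSubmonoidClass.coe_finsetSum]
    apply Finset.sum_congr rfl
    intro σ _
    rw [map_zsmul]
    ext1 w
    simp [hb]
  have hJ : ∀ p : MvPolynomial (Fin (N+1) ⊕ Fin (N+1)) ℤ, ∀ c : idx N m → ℤ,
      p - ∑ s, c s • gg N m s ∈ I' (N+1) m (Nat.succ_pos N) →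
      Phi (N+1) m (Nat.succ_pos N) p = Phi (N+1) m (Nat.succ_pos N) (∑ s, c s • gg N m s) := by
    intro p c h
    have := hker h
    rw [RingHom.mem_ker, map_sub] at this
    exact sub_eq_zero.mp this
  obtain ⟨c, hc⟩ := span_gg N m hm hmN p
  have h1 := hJ p c hc
  rw [hp, eq_comm, Phi_apply, Ideal.Quotient.eq_zero_iff_mem] at h1
  have h2 := Jt_smul h1
  rw [hsum] at h2
  have h3 := indep (gM (N+1) m) b D hD hDM ?_ (fun σ => c (E σ)) h2
  · have h4 : ∀ s, c s = 0 := by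
      intro s
      have := congrFun h3 (E.symm s)
      simpa using this
    simpa [h4] using hc
  · intro v hv
    obtain ⟨q, hq⟩ := Phi_surj (N+1) m (Nat.succ_pos N) (Ideal.Quotient.mk _ ⟨v, hv⟩)
    obtain ⟨d, hd⟩ := span_gg N m hm hmN q
    rw [hJ q d hd, Phi_apply, eq_comm, Ideal.Quotient.eq] at hq
    have h5 := Jt_smul hq
    have h6 : v = (Psi (N+1) m (Nat.succ_pos N) (∑ s, d s • gg N m s) : PR (N+1)) +
        ((⟨v, hv⟩ - Psi (N+1) m (Nat.succ_pos N) (∑ s, d s • gg N m s) : gkmSubring (N+1) m) :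
          PR (N+1)) := by
      rw [AddSubgroupClass.coe_sub]; simp
    rw [h6]
    refine Submodule.add_mem_sup ?_ h5
    rw [hsum]
    exact Submodule.sum_mem _ fun σ _ => Submodule.smul_mem _ _ (Submodule.subset_span ⟨σ, rfl⟩)

end fin

theorem stmt10 (n m : ℕ) (hn : 2 ≤ n) (hm : 1 ≤ m) (hmn : m ≤ n) :
    ∃ (xe ye : Fin n → gkmSubring n m),
      (∀ k, (xe k : PR n) = xk n k) ∧
      (∀ k, (ye k : PR n) = yk n m (by omega) k) ∧
      ∃ e : (gkmSubring n m ⧸ Jt n m) ≃+*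
          (MvPolynomial (Fin n ⊕ Fin n) ℤ ⧸ I' n m (by omega)),
        (∀ k, e (Ideal.Quotient.mk (Jt n m) (xe k))
            = Ideal.Quotient.mk (I' n m (by omega)) (xv n k)) ∧
        (∀ k, e (Ideal.Quotient.mk (Jt n m) (ye k))
            = Ideal.Quotient.mk (I' n m (by omega)) (yv n k)) := by
  obtain ⟨N, rfl⟩ : ∃ N, n = N + 1 := ⟨n - 1, by omega⟩
  have hn0 : 0 < N + 1 := Nat.succ_pos N
  refine ⟨xe (N+1) m, ye (N+1) m hn0, fun _ => rfl, fun _ => rfl, ?_⟩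
  have hle := I'_le (N+1) m hn0 hm hmn
  set F : (MvPolynomial (Fin (N+1) ⊕ Fin (N+1)) ℤ ⧸ I' (N+1) m hn0) →+*
      (gkmSubring (N+1) m ⧸ Jt (N+1) m) :=
    Ideal.Quotient.lift _ (Phi (N+1) m hn0) (fun a ha => hle ha) with hF
  have hbij : Function.Bijective F := by
    constructor
    · rw [injective_iff_map_eq_zero]
      intro q hq
      obtain ⟨p, rfl⟩ := Ideal.Quotient.mk_surjective q
      rw [Ideal.Quotient.eq_zero_iff_mem]
      exact Phi_inj N m (by omega) hm hmn p hq
    · intro q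
      obtain ⟨p, hp⟩ := Phi_surj (N+1) m hn0 q
      exact ⟨Ideal.Quotient.mk _ p, hp⟩
  refine ⟨(RingEquiv.ofBijective F hbij).symm, fun k => ?_, fun k => ?_⟩
  · rw [RingEquiv.symm_apply_eq]
    change _ = Phi (N+1) m hn0 (xv (N+1) k)
    rw [Phi_apply, Psi_x]
  · rw [RingEquiv.symm_apply_eq]
    change _ = Phi (N+1) m hn0 (yv (N+1) k)
    rw [Phi_apply, Psi_y]


end Stmt10
end

section
/- Let n ≥ 1 and 1 ≤ a ≤ n, and let R_h = ℤ[x_1,…,x_n,y_1,…,y_n]/I_h be the presentation of H^*(Hess(S,h)) for h = (a,n,…,n). Then the image in R_h of any polynomial f ∈ ℤ[x_1,…,x_n] (a polynomial in the x-variables only) lies in the ℤ-span of the images of the monomials x_1^{i_1}x_2^{i_2}⋯x_n^{i_n} with 0 ≤ i_j ≤ n−j for all j and with i_ℓ = 0 for at least one ℓ with 1 ≤ ℓ ≤ a. -/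
/-!
STATEMENT 11: In R_h = ℤ[x,y]/I_h (the presentation of H^*(Hess(S,h)) for
h = (a,n,…,n)), the image of any polynomial in the x-variables only lies in the
ℤ-span of the images of the monomials x_1^{i_1}⋯x_n^{i_n} with 0 ≤ i_j ≤ n-j
and i_ℓ = 0 for some 1 ≤ ℓ ≤ a.
-/

open MvPolynomial

namespace Stmt11

noncomputable def xv (n : ℕ) (j : Fin n) : MvPolynomial (Fin n ⊕ Fin n) ℤ :=
  X (Sum.inl j)

noncomputable def yv (n : ℕ) (k : Fin n) : MvPolynomial (Fin n ⊕ Fin n) ℤ :=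
  X (Sum.inr k)

noncomputable def Ih (n a : ℕ) (hn : 0 < n) : Ideal (MvPolynomial (Fin n ⊕ Fin n) ℤ) :=
  Ideal.span
    {p | (∃ k k' : Fin n, k ≠ k' ∧ p = yv n k * yv n k') ∨
         (∃ k : Fin n, p = xv n ⟨0, hn⟩ * yv n k) ∨
         (∃ k : Fin n, p =
            (∏ ℓ ∈ Finset.univ.filter (fun ℓ : Fin n => a ≤ (ℓ : ℕ)), (-xv n ℓ)) * yv n k -
              ∏ ℓ ∈ Finset.univ.filter (fun ℓ : Fin n => 1 ≤ (ℓ : ℕ)), (-xv n ℓ)) ∨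
         (p = (∑ k : Fin n, yv n k) -
            ∏ ℓ ∈ Finset.univ.filter (fun ℓ : Fin n => 1 ≤ (ℓ : ℕ) ∧ (ℓ : ℕ) < a),
              (xv n ⟨0, hn⟩ - xv n ℓ)) ∨
         (∃ i : ℕ, 1 ≤ i ∧ i ≤ n ∧ p = rename Sum.inl (esymm (Fin n) ℤ i))}

/-- Index set of the monomial family B₁. -/
def B1 (n a : ℕ) : Type :=
  {i : Fin n → ℕ //
    (∀ j : Fin n, i j ≤ n - 1 - (j : ℕ)) ∧ ∃ ℓ : Fin n, (ℓ : ℕ) < a ∧ i ℓ = 0}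

/-- Monomials in a family of ring elements. -/
def mon {R : Type*} [CommRing R] {n : ℕ} (x : Fin n → R) (u : Fin n → ℕ) : R :=
  ∏ j, x j ^ u j

/-- Lexicographic order in which later variables are bigger. -/
def LT' {n : ℕ} (u v : Fin n → ℕ) : Prop := ∃ i, (∀ j, i < j → u j = v j) ∧ u i < v i

theorem LT'_wf (n : ℕ) : WellFounded (LT' (n := n)) :=
  Pi.Lex.wellFounded (ι := Fin n) (α := fun _ => ℕ) (r := fun i j => j < i)
    (s := fun _ a b => a < b) (fun _ => Nat.lt_wfRel.wf)

theorem LT'_add {n : ℕ} {u v : Fin n → ℕ} (h : LT' u v) (w : Fin n → ℕ) :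
    LT' (u + w) (v + w) := by
  obtain ⟨i, h1, h2⟩ := h
  exact ⟨i, fun j hj => by simp [h1 j hj], by simpa using h2⟩

section
variable {R : Type*} [CommRing R] {n : ℕ} (x : Fin n → R)

theorem mon_add (u v : Fin n → ℕ) : mon x (u + v) = mon x u * mon x v := by
  simp [mon, pow_add, Finset.prod_mul_distrib]

theorem mon_single (j : Fin n) (i : ℕ) : mon x (Pi.single j i) = x j ^ i := by
  unfold mon
  rw [Finset.prod_eq_single j]
  · simp
  · intro b _ hb; simp [hb]
  · simp

/-- Span of the smaller monomials. -/
def low (w : Fin n → ℕ) : Submodule ℤ R := Submodule.span ℤ (mon x '' {v | LT' v w})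

theorem low_add {w : Fin n → ℕ} {r : R} (h : r ∈ low x w) (u : Fin n → ℕ) :
    r * mon x u ∈ low x (w + u) := by
  unfold low at h
  induction h using Submodule.span_induction with
  | mem r hr =>
    obtain ⟨v, hv, rfl⟩ := hr
    rw [← mon_add]
    exact Submodule.subset_span ⟨_, LT'_add hv u, rfl⟩
  | zero => simp
  | add a b _ _ ha hb => rw [add_mul]; exact add_mem ha hb
  | smul c a _ ha => rw [smul_mul_assoc]; exact Submodule.smul_mem _ _ ha

theorem reduce (B : Set (Fin n → ℕ))
    (H : ∀ u, u ∉ B → ∃ w, w ≤ u ∧ mon x w ∈ low x w) (u : Fin n → ℕ) :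
    mon x u ∈ Submodule.span ℤ (mon x '' B) := by
  induction u using (LT'_wf n).induction with
  | _ u ih =>
    by_cases hu : u ∈ B
    · exact Submodule.subset_span ⟨u, hu, rfl⟩
    · obtain ⟨w, hw, h⟩ := H u hu
      have h2 := low_add x h (u - w)
      rw [← mon_add, add_tsub_cancel_of_le hw] at h2
      refine (Submodule.span_le.2 ?_ : low x u ≤ _) h2
      rintro _ ⟨v, hv, rfl⟩
      exact ih v hv

theorem adjoin_mem (j : Fin n) {r : R} (hr : r ∈ Algebra.adjoin ℤ (x '' {i | i < j})) :
    r ∈ Submodule.span ℤ (mon x '' {v | ∀ i, j ≤ i → v i = 0}) := by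
  rw [← Subalgebra.mem_toSubmodule, Algebra.adjoin_eq_span] at hr
  refine Submodule.span_mono ?_ hr
  intro s hs
  induction hs using Submonoid.closure_induction with
  | mem s hs =>
    obtain ⟨i, hi, rfl⟩ := hs
    refine ⟨Pi.single i 1, fun k hk => ?_, by rw [mon_single, pow_one]⟩
    have : k ≠ i := fun h => absurd hi (by simpa [h] using hk)
    simp [this]
  | one => exact ⟨0, fun _ _ => rfl, by simp [mon]⟩
  | mul a b _ _ ha hb =>
    obtain ⟨u, hu, rfl⟩ := ha
    obtain ⟨v, hv, rfl⟩ := hb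
    exact ⟨u + v, fun k hk => by simp [hu k hk, hv k hk], mon_add x u v⟩

open Polynomial in
theorem power_rel (hx : ∏ i, (Polynomial.X - Polynomial.C (x i)) = (Polynomial.X : R[X]) ^ n) (j : Fin n) :
    mon x (Pi.single j (n - j)) ∈ low x (Pi.single j (n - j)) := by
  nontriviality R
  let S := Algebra.adjoin ℤ (x '' {i | i < j})
  let P : S[X] := ∏ i : {i // i < j}, (Polynomial.X - Polynomial.C (⟨x i, Algebra.subset_adjoin ⟨i, i.2, rfl⟩⟩ : S))
  have hP : P.Monic := Polynomial.monic_prod_of_monic _ _ fun i _ => Polynomial.monic_X_sub_C _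
  have hPm : P.map (algebraMap S R) = ∏ i : {i // i < j}, (Polynomial.X - Polynomial.C (x i)) := by
    simp only [P, Polynomial.map_prod, Polynomial.map_sub, Polynomial.map_X, Polynomial.map_C]
    rfl
  have hPm' : P.map (algebraMap S R) = ∏ i with i < j, (Polynomial.X - Polynomial.C (x i)) := by
    rw [hPm]
    exact (Finset.prod_subtype (p := fun i => i < j) (Finset.univ.filter (· < j)) (by simp)
      (fun i => (Polynomial.X - Polynomial.C (x i) : R[X]))).symm
  let Q : R[X] := ∏ i with ¬ i < j, (Polynomial.X - Polynomial.C (x i))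
  have hQ : (Polynomial.X ^ n /ₘ P).map (algebraMap S R) = Q := by
    rw [Polynomial.map_divByMonic _ hP, Polynomial.map_pow, Polynomial.map_X, ← hx,
      ← Finset.prod_filter_mul_prod_filter_not Finset.univ (· < j), ← hPm']
    exact Polynomial.mul_divByMonic_cancel_left _ (hP.map _)
  have hQm : Q.Monic := Polynomial.monic_prod_of_monic _ _ fun i _ => Polynomial.monic_X_sub_C _
  have hQd : Q.natDegree = n - j := by
    rw [Polynomial.natDegree_prod_of_monic _ _ fun i _ => Polynomial.monic_X_sub_C _]
    simp only [Polynomial.natDegree_X_sub_C, Finset.sum_const, smul_eq_mul, mul_one, not_lt]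
    have : Finset.univ.filter (fun i => j ≤ i) = Finset.Ici j := by ext; simp
    rw [this, Fin.card_Ici]
  have hQ0 : Q.eval (x j) = 0 := by
    simp only [Q, Polynomial.eval_prod]
    exact Finset.prod_eq_zero (i := j) (by simp) (by simp)
  rw [hQm.as_sum, hQd] at hQ0
  simp only [Polynomial.eval_add, Polynomial.eval_pow, Polynomial.eval_X, Polynomial.eval_finsetSum, Polynomial.eval_mul, Polynomial.eval_C] at hQ0
  rw [mon_single, eq_neg_of_add_eq_zero_left hQ0]
  refine neg_mem (sum_mem fun i hi => ?_)
  have hc : Q.coeff i ∈ S := by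
    rw [← hQ, Polynomial.coeff_map]; exact ((Polynomial.X ^ n /ₘ P).coeff i).2
  have hc := adjoin_mem x j hc
  rw [← mon_single]
  generalize Q.coeff i = c at hc
  induction hc using Submodule.span_induction with
  | mem r hr =>
    obtain ⟨v, hv, rfl⟩ := hr
    rw [← mon_add]
    refine Submodule.subset_span ⟨_, ⟨j, fun k hk => ?_, ?_⟩, rfl⟩
    · simp [hv k hk.le, hk.ne']
    · simpa [hv j le_rfl] using hi
  | zero => simp
  | add a b _ _ ha hb => rw [add_mul]; exact add_mem ha hb
  | smul c a _ ha => rw [smul_mul_assoc]; exact Submodule.smul_mem _ _ ha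

theorem mon_prod (s : Finset (Fin n)) (u : Fin n → Fin n → ℕ) :
    mon x (∑ i ∈ s, u i) = ∏ i ∈ s, mon x (u i) := by
  classical
  induction s using Finset.induction_on with
  | empty => simp [mon]
  | insert a s ha ih => rw [Finset.sum_insert ha, Finset.prod_insert ha, mon_add, ih]

theorem prod_rel (z : Fin n) (s : Finset (Fin n)) (hs : ∀ i ∈ s, z < i)
    (h : x z * ∏ i ∈ s, (x z - x i) = 0) :
    mon x (Pi.single z 1 + ∑ i ∈ s, Pi.single i 1) ∈
      low x (Pi.single z 1 + ∑ i ∈ s, Pi.single i 1) := by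
  classical
  have h' : x z * ∏ i ∈ s, (x i + - x z) = 0 := by
    have : ∏ i ∈ s, (x i + - x z) = (-1) ^ s.card * ∏ i ∈ s, (x z - x i) := by
      rw [← Finset.prod_const, ← Finset.prod_mul_distrib]
      exact Finset.prod_congr rfl fun i _ => by ring
    rw [this, mul_left_comm, h, mul_zero]
  rw [Finset.prod_add, ← Finset.add_sum_erase _ _ (Finset.mem_powerset_self s)] at h'
  simp only [Finset.sdiff_self, Finset.prod_empty, mul_one, mul_add] at h'
  have hm : mon x (Pi.single z 1 + ∑ i ∈ s, Pi.single i 1) = x z * ∏ i ∈ s, x i := by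
    rw [mon_add, mon_prod, mon_single, pow_one]
    simp [mon_single]
  rw [hm, eq_neg_of_add_eq_zero_left h', Finset.mul_sum]
  refine neg_mem (sum_mem fun t ht => ?_)
  rw [Finset.mem_erase, Finset.mem_powerset] at ht
  have hne : (s \ t).Nonempty := by
    rw [Finset.sdiff_nonempty]
    exact fun h => ht.1 (Finset.Subset.antisymm ht.2 h)
  have e : x z * ((∏ i ∈ t, x i) * ∏ i ∈ s \ t, -x z) = ((-1 : ℤ) ^ (s \ t).card) •
      mon x (Pi.single z 1 + ∑ i ∈ t, Pi.single i 1 + Pi.single z (s \ t).card) := by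
    rw [mon_add, mon_add, mon_prod, mon_single, mon_single, Finset.prod_const, neg_pow]
    simp only [mon_single, zsmul_eq_mul]
    push_cast
    simp only [pow_one]
    ring
  rw [e]
  refine Submodule.smul_mem _ _ (Submodule.subset_span ⟨_, ?_, rfl⟩)
  have hmax := Finset.max'_mem _ hne
  set m := (s \ t).max' hne with hmdef
  rw [Finset.mem_sdiff] at hmax
  have hzm := hs m hmax.1
  refine ⟨m, fun k hk => ?_, ?_⟩
  · have hkz : k ≠ z := (hzm.trans hk).ne'
    have hk' : k ∉ s \ t := fun h => absurd (Finset.le_max' _ _ h) (not_le.2 hk)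
    have : k ∈ t ↔ k ∈ s := ⟨fun h => ht.2 h, fun h => by
      by_contra h2; exact hk' (Finset.mem_sdiff.2 ⟨h, h2⟩)⟩
    simp [hkz, Finset.sum_apply, Pi.single_apply, this]
  · simp [hzm.ne', Finset.sum_apply, Pi.single_apply, hmax.1, hmax.2]

end

theorem span_all {R : Type*} [CommRing R] {n : ℕ} (x : Fin n → R) (a : ℕ) (hn : 0 < n)
    (ha : 1 ≤ a)
    (hx : ∏ i, (Polynomial.X - Polynomial.C (x i)) = (Polynomial.X : Polynomial R) ^ n)
    (h : x ⟨0, hn⟩ * ∏ ℓ ∈ Finset.univ.filter (fun ℓ : Fin n => 1 ≤ (ℓ : ℕ) ∧ (ℓ : ℕ) < a),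
              (x ⟨0, hn⟩ - x ℓ) = 0) (u : Fin n → ℕ) :
    mon x u ∈ Submodule.span ℤ (mon x '' {i | (∀ j : Fin n, i j ≤ n - 1 - (j : ℕ)) ∧
      ∃ ℓ : Fin n, (ℓ : ℕ) < a ∧ i ℓ = 0}) := by
  refine reduce x _ (fun u hu => ?_) u
  by_cases h1 : ∀ j : Fin n, u j ≤ n - 1 - (j : ℕ)
  · refine ⟨_, ?_, prod_rel x ⟨0, hn⟩ _ ?_ h⟩
    · have h2 : ∀ ℓ : Fin n, (ℓ : ℕ) < a → u ℓ ≠ 0 := fun ℓ hℓ h0 => hu ⟨h1, ℓ, hℓ, h0⟩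
      intro k
      have h3 := h2 k
      simp only [Pi.add_apply, Finset.sum_apply, Pi.single_apply, Finset.sum_ite_eq,
        Finset.mem_filter, Finset.mem_univ, true_and]
      simp only [Fin.ext_iff]
      split_ifs <;> omega
    · intro i hi
      simp only [Finset.mem_filter] at hi
      rw [Fin.lt_def]
      exact hi.2.1
  · push Not at h1
    obtain ⟨j, hj⟩ := h1
    refine ⟨_, ?_, power_rel x hx j⟩
    intro k
    by_cases hk : k = j
    · subst hk; simp; omega
    · simp [hk]

theorem stmt11 (n a : ℕ) (hn : 0 < n) (ha : 1 ≤ a) (han : a ≤ n)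
    (f : MvPolynomial (Fin n) ℤ) :
    Ideal.Quotient.mk (Ih n a hn) (rename Sum.inl f) ∈
      Submodule.span ℤ (Set.range fun i : B1 n a =>
        Ideal.Quotient.mk (Ih n a hn) (∏ j : Fin n, xv n j ^ i.val j)) := by
  set q := Ideal.Quotient.mk (Ih n a hn) with hq
  let x : Fin n → (MvPolynomial (Fin n ⊕ Fin n) ℤ ⧸ Ih n a hn) := fun j => q (xv n j)
  have hmon : ∀ u : Fin n → ℕ, q (∏ j : Fin n, xv n j ^ u j) = mon x u := by
    intro u; simp [mon, x]
  have hq0 : ∀ p ∈ Ih n a hn, q p = 0 := fun p hp => Ideal.Quotient.eq_zero_iff_mem.2 hp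
  have hae : ∀ p : MvPolynomial (Fin n) ℤ, q (rename Sum.inl p) = aeval x p := by
    intro p
    have : (Ideal.Quotient.mkₐ ℤ (Ih n a hn)).comp (rename Sum.inl) = aeval x := by
      ext i
      simp [x, xv, hq]
    exact DFunLike.congr_fun this p
  have hE : ∀ i, 1 ≤ i → i ≤ n → (Finset.univ.val.map x).esymm i = 0 := by
    intro i h1 h2
    rw [← aeval_esymm_eq_multiset_esymm (Fin n) ℤ, ← hae]
    exact hq0 _ (Ideal.subset_span (Or.inr (Or.inr (Or.inr (Or.inr ⟨i, h1, h2, rfl⟩)))))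
  have hx : ∏ i, (Polynomial.X - Polynomial.C (x i)) = Polynomial.X ^ n := by
    have h := Multiset.prod_X_sub_X_eq_sum_esymm (Finset.univ.val.map x)
    rw [Multiset.map_map] at h
    refine Eq.trans ?_ (h.trans ?_)
    · rfl
    · rw [Finset.sum_eq_single 0]
      · simp [Multiset.esymm]
      · intro i hi h0
        rw [hE i (by omega) (by simp at hi; omega)]
        simp
      · simp
  have hrel : x ⟨0, hn⟩ *
      ∏ ℓ ∈ Finset.univ.filter (fun ℓ : Fin n => 1 ≤ (ℓ : ℕ) ∧ (ℓ : ℕ) < a),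
        (x ⟨0, hn⟩ - x ℓ) = 0 := by
    have h1 := hq0 _ (Ideal.subset_span (Or.inr (Or.inr (Or.inr (Or.inl rfl)))))
    rw [map_sub, sub_eq_zero, map_prod] at h1
    simp only [map_sub] at h1
    change _ * ∏ ℓ ∈ _, (q (xv n ⟨0, hn⟩) - q (xv n ℓ)) = 0
    rw [← h1, map_sum, Finset.mul_sum]
    refine Finset.sum_eq_zero fun k _ => ?_
    change q _ * q _ = 0
    rw [← map_mul]
    exact hq0 _ (Ideal.subset_span (Or.inr (Or.inl ⟨k, rfl⟩)))
  have hspan := span_all x a hn ha hx hrel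
  have hset : (Set.range fun i : B1 n a => q (∏ j : Fin n, xv n j ^ i.val j)) =
      mon x '' {i | (∀ j : Fin n, i j ≤ n - 1 - (j : ℕ)) ∧
        ∃ ℓ : Fin n, (ℓ : ℕ) < a ∧ i ℓ = 0} := by
    ext r
    constructor
    · rintro ⟨i, rfl⟩
      exact ⟨i.1, i.2, (hmon _).symm⟩
    · rintro ⟨i, hi, rfl⟩
      exact ⟨⟨i, hi⟩, hmon _⟩
  rw [hset, hae, aeval_def, eval₂_eq']
  refine sum_mem fun d _ => ?_
  rw [← Algebra.smul_def]
  exact Submodule.smul_mem _ _ (hspan d)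

end Stmt11
end

section
/- Let n ≥ 1 and 1 ≤ a ≤ n, and let A = ℂ[x_1,…,x_n,y_1,…,y_n]/I_h be the complex version of the presentation of H^*(Hess(S,h)) for h = (a,n,…,n). The symmetric group S_n acts on A by ℂ-algebra automorphisms via σ·x_i = x_i and σ·y_i = y_{σ(i)} (the ideal I_h is stable under this action). Then, as a ℂ[S_n]-module, A is isomorphic to the direct sum of a·(n−1)! copies of the trivial representation and (n−a)·(n−2)! copies of the standard representation V_{(n−1,1)} = {v ∈ ℂ^n : v_1 + ⋯ + v_n = 0} (with S_n permuting coordinates). -/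
/-!
STATEMENT 12: For h = (a,n,…,n), the ring A = ℂ[x,y]/I_h (the complex
presentation of H^*(Hess(S,h))) carries the S_n-action σ·x_i = x_i,
σ·y_i = y_{σ(i)}, and as a ℂ[S_n]-module it decomposes as a·(n-1)! copies of
the trivial representation plus (n-a)·(n-2)! copies of the standard
representation {v ∈ ℂ^n : ∑ v_i = 0}.

The action is formalized as a family of ℂ-algebra automorphisms `act`
(anti-multiplicative composition law `act (σ*τ) = act τ ≫ act σ` expressed via
`trans`, fixing the x's and permuting the y's); the module isomorphism is a
ℂ-linear equivalence intertwining `act` with the action on the target (trivial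
on the first factor, permutation action (σ•v)_i = v_{σ⁻¹ i} on the standard
factors).

Conventions: variables are 0-indexed; `X (Sum.inl j)` is x_{j+1},
`X (Sum.inr k)` is y_{k+1}.
-/

open MvPolynomial

namespace Stmt12

noncomputable def xv (n : ℕ) (j : Fin n) : MvPolynomial (Fin n ⊕ Fin n) ℂ :=
  X (Sum.inl j)

noncomputable def yv (n : ℕ) (k : Fin n) : MvPolynomial (Fin n ⊕ Fin n) ℂ :=
  X (Sum.inr k)

/-- The ideal I_h over ℂ, for h = (a,n,…,n). -/
noncomputable def Ih (n a : ℕ) (hn : 0 < n) : Ideal (MvPolynomial (Fin n ⊕ Fin n) ℂ) :=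
  Ideal.span
    {p | (∃ k k' : Fin n, k ≠ k' ∧ p = yv n k * yv n k') ∨
         (∃ k : Fin n, p = xv n ⟨0, hn⟩ * yv n k) ∨
         (∃ k : Fin n, p =
            (∏ ℓ ∈ Finset.univ.filter (fun ℓ : Fin n => a ≤ (ℓ : ℕ)), (-xv n ℓ)) * yv n k -
              ∏ ℓ ∈ Finset.univ.filter (fun ℓ : Fin n => 1 ≤ (ℓ : ℕ)), (-xv n ℓ)) ∨
         (p = (∑ k : Fin n, yv n k) -
            ∏ ℓ ∈ Finset.univ.filter (fun ℓ : Fin n => 1 ≤ (ℓ : ℕ) ∧ (ℓ : ℕ) < a),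
              (xv n ⟨0, hn⟩ - xv n ℓ)) ∨
         (∃ i : ℕ, 1 ≤ i ∧ i ≤ n ∧ p = rename Sum.inl (esymm (Fin n) ℂ i))}

/-- The quotient algebra A = ℂ[x,y]/I_h. -/
noncomputable abbrev A (n a : ℕ) (hn : 0 < n) :=
  MvPolynomial (Fin n ⊕ Fin n) ℂ ⧸ Ih n a hn

/-- The standard representation {v ∈ ℂ^n : ∑ v_i = 0}, as a submodule of ℂ^n. -/
noncomputable def Vstd (n : ℕ) : Submodule ℂ (Fin n → ℂ) where
  carrier := {v | ∑ i, v i = 0}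
  add_mem' := by
    intro x y hx hy
    simp only [Set.mem_setOf_eq, Pi.add_apply, Finset.sum_add_distrib] at *
    rw [hx, hy, add_zero]
  zero_mem' := by simp
  smul_mem' := by
    intro c x hx
    simp only [Set.mem_setOf_eq, Pi.smul_apply, smul_eq_mul] at *
    rw [← Finset.mul_sum, hx, mul_zero]

/-! ### Splitting towers -/

section Tower

open scoped Polynomial in
theorem adjoinRoot_fin (K : Type) [CommRing K] [Algebra ℂ K] [Module.Finite ℂ K]
    (f : K[X]) (hf : f.Monic) :
    Module.Finite ℂ (AdjoinRoot f) ∧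
      Module.finrank ℂ (AdjoinRoot f) = Module.finrank ℂ K * f.natDegree := by
  have _i1 : Module.Finite K (AdjoinRoot f) := hf.finite_adjoinRoot
  have : Module.Free K (AdjoinRoot f) := hf.free_adjoinRoot
  refine ⟨Module.Finite.trans K _, ?_⟩
  rcases subsingleton_or_nontrivial K with h | h
  · have : Subsingleton (AdjoinRoot f) := Module.subsingleton K _
    rw [Module.finrank_zero_of_subsingleton, Module.finrank_zero_of_subsingleton, zero_mul]
  · rw [← Module.finrank_mul_finrank ℂ K (AdjoinRoot f),
      (AdjoinRoot.powerBasis' hf).finrank, AdjoinRoot.powerBasis'_dim]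

open scoped Polynomial in
theorem root_factor {K : Type} [CommRing K] (f : K[X]) (hf : f.Monic) :
    ∃ f' : (AdjoinRoot f)[X], f'.Monic ∧ f.map (AdjoinRoot.of f) =
      (Polynomial.X - Polynomial.C (AdjoinRoot.root f)) * f' ∧ (f.natDegree ≠ 0 → f'.natDegree = f.natDegree - 1) := by
  obtain ⟨f', h⟩ : (Polynomial.X - Polynomial.C (AdjoinRoot.root f)) ∣ f.map (AdjoinRoot.of f) := by
    rw [Polynomial.dvd_iff_isRoot]
    exact AdjoinRoot.isRoot_root f
  have hm : f'.Monic := (Polynomial.monic_X_sub_C _).of_mul_monic_left (h ▸ hf.map _)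
  refine ⟨f', hm, h, fun h0 => ?_⟩
  have : Nontrivial K := by
    by_contra hh
    rw [not_nontrivial_iff_subsingleton] at hh
    exact h0 (by rw [Subsingleton.elim f 0]; simp)
  have : Nontrivial (AdjoinRoot f) := by
    by_contra hh
    rw [not_nontrivial_iff_subsingleton] at hh
    have h1 : AdjoinRoot.mk f 1 = 0 := Subsingleton.elim _ _
    rw [AdjoinRoot.mk_eq_zero] at h1
    exact h0 (by rw [hf.eq_one_of_isUnit (isUnit_of_dvd_one h1)]; simp)
  have := congrArg Polynomial.natDegree h
  rw [hf.natDegree_map, (Polynomial.monic_X_sub_C _).natDegree_mul hm, Polynomial.natDegree_X_sub_C] at this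
  omega

open scoped Polynomial in
theorem upper {ι : Type} [DecidableEq ι] (Q : Type) [CommRing Q] [Algebra ℂ Q] (b : ι → Q)
    (s : Finset ι) : ∀ (K : Type) [CommRing K] [Algebra ℂ K] [Module.Finite ℂ K]
    (φ : K →ₐ[ℂ] Q) (f : K[X]) (_ : f.Monic) (_ : f.natDegree = s.card)
    (_ : f.map (φ : K →+* Q) = ∏ i ∈ s, (Polynomial.X - Polynomial.C (b i)))
    (_ : Algebra.adjoin ℂ (Set.range φ ∪ b '' s) = ⊤),
    Module.Finite ℂ Q ∧ Module.finrank ℂ Q ≤ Module.finrank ℂ K * s.card.factorial := by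
  induction s using Finset.induction_on with
  | empty =>
    intro K _ _ _ φ f hf hd hp hg
    have hs : Function.Surjective φ := by
      rw [← AlgHom.range_eq_top, ← hg]
      have : Set.range φ = (φ.range : Set Q) := by ext; simp
      rw [Finset.coe_empty, Set.image_empty, Set.union_empty, this, Algebra.adjoin_eq]
    refine ⟨Module.Finite.of_surjective φ.toLinearMap hs, ?_⟩
    simpa using LinearMap.finrank_le_finrank_of_surjective (f := φ.toLinearMap) hs
  | insert j s hj ih =>
    intro K _ _ _ φ f hf hd hp hg
    obtain ⟨hfin, hrank⟩ := adjoinRoot_fin K f hf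
    obtain ⟨f', hm', hf', hdeg⟩ := root_factor f hf
    rw [Finset.card_insert_of_notMem hj] at hd
    have h0 : Polynomial.eval₂ (φ : K →+* Q) (b j) f = 0 := by
      rw [← Polynomial.eval_map, hp, Finset.prod_insert hj]
      simp
    let ψ : AdjoinRoot f →ₐ[ℂ] Q := AdjoinRoot.liftAlgHom f φ (b j) h0
    have hcomp : (ψ : AdjoinRoot f →+* Q).comp (AdjoinRoot.of f) = (φ : K →+* Q) := by
      ext x
      simp [ψ]
    have hp' : f'.map (ψ : AdjoinRoot f →+* Q) = ∏ i ∈ s, (Polynomial.X - Polynomial.C (b i)) := by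
      apply (Polynomial.monic_X_sub_C (b j)).isRegular.left
      have h2 := congrArg (Polynomial.map (ψ : AdjoinRoot f →+* Q)) hf'
      rw [Polynomial.map_map, hcomp, hp, Finset.prod_insert hj, Polynomial.map_mul] at h2
      refine Eq.trans ?_ h2.symm
      simp [ψ]
    have := ih (AdjoinRoot f) ψ f' hm' (by rw [hdeg (by omega)]; omega) hp' ?_
    · refine ⟨this.1, this.2.trans ?_⟩
      rw [hrank, Finset.card_insert_of_notMem hj, Nat.factorial_succ, hd, mul_assoc]
    · rw [eq_top_iff, ← hg]
      apply Algebra.adjoin_mono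
      rintro x (⟨y, rfl⟩ | ⟨i, hi, rfl⟩)
      · left
        exact ⟨AdjoinRoot.of f y, by simp [ψ]⟩
      · simp only [Finset.coe_insert, Set.mem_insert_iff] at hi
        rcases hi with rfl | hi
        · left
          exact ⟨AdjoinRoot.root f, by simp [ψ]⟩
        · right
          exact ⟨i, hi, rfl⟩

open scoped Polynomial in
theorem lower {ι : Type} [DecidableEq ι]
    (s : Finset ι) : ∀ (K : Type) [CommRing K] [Algebra ℂ K] [Module.Finite ℂ K]
    (f : K[X]) (_ : f.Monic) (_ : f.natDegree = s.card),
    ∃ (Q : Type) (_ : CommRing Q) (_ : Algebra ℂ Q) (φ : K →ₐ[ℂ] Q) (b : ι → Q),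
      (∀ i, i ∉ s → b i = 0) ∧
      f.map (φ : K →+* Q) = ∏ i ∈ s, (Polynomial.X - Polynomial.C (b i)) ∧
      Algebra.adjoin ℂ (Set.range φ ∪ b '' s) = ⊤ ∧
      Module.Finite ℂ Q ∧ Module.finrank ℂ Q = Module.finrank ℂ K * s.card.factorial := by
  induction s using Finset.induction_on with
  | empty =>
    intro K _ _ _ f hf hd
    refine ⟨K, inferInstance, inferInstance, AlgHom.id ℂ K, 0, by simp, ?_, ?_, inferInstance, by simp⟩
    · have := hf.natDegree_eq_zero.1 (by simpa using hd)
      simp [this]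
    · simp
  | insert j s hj ih =>
    intro K _ _ _ f hf hd
    obtain ⟨hfin, hrank⟩ := adjoinRoot_fin K f hf
    obtain ⟨f', hm', hf', hdeg⟩ := root_factor f hf
    rw [Finset.card_insert_of_notMem hj] at hd
    obtain ⟨Q, _, _, ψ, b, hb, hp, hg, hF, hr⟩ :=
      ih (AdjoinRoot f) f' hm' (by rw [hdeg (by omega)]; omega)
    let of' : K →ₐ[ℂ] AdjoinRoot f := 
      { AdjoinRoot.of f with commutes' := fun r => by simp [AdjoinRoot.algebraMap_eq'] }
    have hof : ∀ x, of' x = AdjoinRoot.of f x := fun x => rfl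
    have hne : ∀ i ∈ s, i ≠ j := fun i hi h => hj (h ▸ hi)
    refine ⟨Q, inferInstance, inferInstance, ψ.comp of', 
      Function.update b j (ψ (AdjoinRoot.root f)), ?_, ?_, ?_, hF, ?_⟩
    · intro i hi
      simp only [Finset.mem_insert, not_or] at hi
      rw [Function.update_of_ne hi.1, hb i hi.2]
    · rw [Finset.prod_insert hj, Finset.prod_congr rfl (g := fun i => Polynomial.X - Polynomial.C (b i)), ← hp]
      · have h2 := congrArg (Polynomial.map (ψ : AdjoinRoot f →+* Q)) hf'
        rw [Polynomial.map_map, Polynomial.map_mul] at h2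
        simp only [Function.update_self]
        refine Eq.trans ?_ (h2.trans ?_)
        · rfl
        · simp
      · intro i hi
        rw [Function.update_of_ne (hne i hi)]
    · rw [eq_top_iff, ← hg]
      apply Algebra.adjoin_le
      rintro x (⟨y, rfl⟩ | ⟨i, hi, rfl⟩)
      · induction y using AdjoinRoot.induction_on with
        | ih p =>
          rw [← AdjoinRoot.aeval_eq, Polynomial.aeval_eq_sum_range, map_sum]
          refine Subalgebra.sum_mem _ fun i _ => ?_
          rw [Algebra.smul_def, map_mul, map_pow]
          refine Subalgebra.mul_mem _ ?_ (Subalgebra.pow_mem _ ?_ _)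
          · apply Algebra.subset_adjoin
            left
            exact ⟨p.coeff i, rfl⟩
          · apply Algebra.subset_adjoin
            right
            exact ⟨j, by simp, by simp⟩
      · apply Algebra.subset_adjoin
        right
        exact ⟨i, by simp [Finset.mem_coe.1 hi], by rw [Function.update_of_ne (hne i hi)]⟩
    · rw [hr, hrank, Finset.card_insert_of_notMem hj, Nat.factorial_succ, hd, mul_assoc]

end Tower

/-! ### Subadditivity of colengths -/

section Count

theorem subadd {S : Type} [CommRing S] [Algebra ℂ S] (I : Ideal S) (f g : S) :
    Module.length ℂ (S ⧸ (I ⊔ Ideal.span {f * g})) ≤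
      Module.length ℂ (S ⧸ (I ⊔ Ideal.span {f})) + Module.length ℂ (S ⧸ (I ⊔ Ideal.span {g})) := by
  have hle : I ⊔ Ideal.span {f * g} ≤ I ⊔ Ideal.span {f} := by
    refine sup_le le_sup_left (le_sup_of_le_right ?_)
    rw [Ideal.span_singleton_le_span_singleton]
    exact Dvd.intro g rfl
  let π : (S ⧸ (I ⊔ Ideal.span {f * g})) →ₐ[ℂ] (S ⧸ (I ⊔ Ideal.span {f})) :=
    Ideal.Quotient.factorₐ ℂ hle
  have hπ : Function.Surjective π := Ideal.Quotient.factor_surjective hle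
  have hmap : I ⊔ Ideal.span {g} ≤
      Submodule.comap (LinearMap.mulLeft S f) (I ⊔ Ideal.span {f * g}) := by
    refine sup_le ?_ ?_
    · intro x hx
      exact Ideal.mem_sup_left (I.mul_mem_left f hx)
    · rw [Ideal.span_singleton_le_iff_mem]
      exact Ideal.mem_sup_right (Ideal.mem_span_singleton_self _)
  let μ : (S ⧸ (I ⊔ Ideal.span {g})) →ₗ[S] (S ⧸ (I ⊔ Ideal.span {f * g})) :=
    Submodule.mapQ _ _ (LinearMap.mulLeft S f) hmap
  have hk : LinearMap.ker π.toLinearMap ≤ LinearMap.range (μ.restrictScalars ℂ) := by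
    intro x hx
    obtain ⟨p, rfl⟩ := Ideal.Quotient.mk_surjective x
    have hp : p ∈ I ⊔ Ideal.span {f} := Ideal.Quotient.eq_zero_iff_mem.1 hx
    obtain ⟨i, hi, j, hj, rfl⟩ := Submodule.mem_sup.1 hp
    obtain ⟨c, rfl⟩ := Ideal.mem_span_singleton.1 hj
    refine ⟨Ideal.Quotient.mk _ c, ?_⟩
    change Ideal.Quotient.mk (I ⊔ Ideal.span {f * g}) (f * c) = _
    rw [Ideal.Quotient.eq]
    have : f * c - (i + f * c) = - i := by ring
    rw [this]
    exact Ideal.mem_sup_left (I.neg_mem hi)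
  have h1 := Module.length_eq_add_of_exact (R := ℂ) (LinearMap.ker π.toLinearMap).subtype
    π.toLinearMap Subtype.val_injective hπ (LinearMap.exact_subtype_ker_map _)
  have h2 : Module.length ℂ (LinearMap.ker π.toLinearMap) ≤
      Module.length ℂ (S ⧸ (I ⊔ Ideal.span {g})) :=
    (Module.length_le_of_injective (Submodule.inclusion hk) (Submodule.inclusion_injective hk)).trans
      (Module.length_le_of_surjective (μ.restrictScalars ℂ).rangeRestrict
        (LinearMap.surjective_rangeRestrict _))
  rw [h1, add_comm]
  gcongr

theorem subadd_prod {S : Type} [CommRing S] [Algebra ℂ S] (I : Ideal S) {ι : Type} [DecidableEq ι]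
    (f : ι → S) (d : ℕ) (s : Finset ι)
    (h : ∀ i ∈ s, Module.length ℂ (S ⧸ (I ⊔ Ideal.span {f i})) ≤ d) :
    Module.length ℂ (S ⧸ (I ⊔ Ideal.span {∏ i ∈ s, f i})) ≤ (s.card * d : ℕ) := by
  induction s using Finset.induction_on with
  | empty =>
    have : I ⊔ Ideal.span {∏ i ∈ (∅ : Finset ι), f i} = ⊤ := by simp
    rw [this]
    have : Subsingleton (S ⧸ (⊤ : Ideal S)) := Ideal.Quotient.subsingleton_iff.2 rfl
    rw [Module.length_eq_zero]
    simp
  | insert j s hj ih =>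
    rw [Finset.prod_insert hj, Finset.card_insert_of_notMem hj]
    refine (subadd I _ _).trans ?_
    have h1 := h j (Finset.mem_insert_self _ _)
    have h2 := ih fun i hi => h i (Finset.mem_insert_of_mem hi)
    refine (add_le_add h1 h2).trans (le_of_eq ?_)
    push_cast
    ring

theorem count {S : Type} [CommRing S] [Algebra ℂ S] (I : Ideal S) {ι : Type} [DecidableEq ι]
    (f : ι → S) (d : ℕ) (s t : Finset ι) (hst : s ⊆ t)
    (h : ∀ i ∈ t, Module.length ℂ (S ⧸ (I ⊔ Ideal.span {f i})) ≤ d)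
    (hprod : ∏ i ∈ t, f i ∈ I) (hI : (t.card * d : ℕ) ≤ Module.length ℂ (S ⧸ I)) :
    Module.length ℂ (S ⧸ (I ⊔ Ideal.span {∏ i ∈ s, f i})) = (s.card * d : ℕ) := by
  have h1 := subadd_prod I f d s fun i hi => h i (hst hi)
  have h2 := subadd_prod I f d (t \ s) fun i hi => h i (Finset.sdiff_subset hi)
  have h3 := subadd I (∏ i ∈ t \ s, f i) (∏ i ∈ s, f i)
  rw [Finset.prod_sdiff hst, sup_eq_left.2 ((Ideal.span_singleton_le_iff_mem I).2 hprod)] at h3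
  have h4 := hI.trans h3
  obtain ⟨u, hu⟩ := ENat.ne_top_iff_exists.1 (ne_top_of_le_ne_top (ENat.natCast_ne_top _) h1)
  obtain ⟨v, hv⟩ := ENat.ne_top_iff_exists.1 (ne_top_of_le_ne_top (ENat.natCast_ne_top _) h2)
  rw [← hu] at h1 h4 ⊢
  rw [← hv] at h2 h4
  norm_cast at h1 h2 h4 ⊢
  have h5 := Finset.card_sdiff_add_card_eq_card hst
  have h6 : (t \ s).card * d + s.card * d = t.card * d := by rw [← add_mul, h5]
  omega

theorem finrank_of_length {V : Type} [AddCommGroup V] [Module ℂ V] {d : ℕ}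
    (h : Module.length ℂ V = d) : Module.Finite ℂ V ∧ Module.finrank ℂ V = d := by
  have hf : Module.Finite ℂ V := by
    have h1 := Module.length_ne_top_iff.1 (by rw [h]; exact ENat.natCast_ne_top d)
    rw [isFiniteLength_iff_isNoetherian_isArtinian] at h1
    have := h1.1
    infer_instance
  refine ⟨hf, ?_⟩
  rw [Module.length_eq_finrank] at h
  exact_mod_cast h

/-! ### Roots of `T^n` -/

/-- The ideal of positive degree symmetric polynomials. -/
noncomputable def Esym (n : ℕ) : Ideal (MvPolynomial (Fin n) ℂ) :=
  Ideal.span {p | ∃ i : ℕ, 1 ≤ i ∧ i ≤ n ∧ p = esymm (Fin n) ℂ i}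

theorem kill_iff {n : ℕ} {Q : Type} [CommRing Q] [Algebra ℂ Q]
    (g : MvPolynomial (Fin n) ℂ →ₐ[ℂ] Q) :
    (∀ p ∈ Esym n, g p = 0) ↔
      ∏ i, (Polynomial.X - Polynomial.C (g (X i))) = (Polynomial.X : Polynomial Q) ^ n := by
  set b : Fin n → Q := fun i => g (X i) with hb
  have hg : g = aeval b := by
    ext i; simp [hb]
  have hpr : ∏ i, (Polynomial.X - Polynomial.C (b i)) =
      (((Finset.univ.val.map b).map fun t => Polynomial.X - Polynomial.C t).prod) := by
    rw [Multiset.map_map]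
    rfl
  have hcard : Multiset.card (Finset.univ.val.map b) = n := by simp
  have hco : ∀ k ≤ n, (∏ i, (Polynomial.X - Polynomial.C (b i))).coeff k =
      (-1) ^ (n - k) * g (esymm (Fin n) ℂ (n - k)) := by
    intro k hk
    rw [hpr, Multiset.prod_X_sub_C_coeff _ (by rw [hcard]; exact hk), hcard, hg,
      aeval_esymm_eq_multiset_esymm]
  constructor
  · intro h
    ext k
    rw [Polynomial.coeff_X_pow]
    rcases lt_trichotomy k n with hk | rfl | hk
    · rw [hco k hk.le, if_neg hk.ne, h, mul_zero]
      exact Ideal.subset_span ⟨n - k, by omega, by omega, rfl⟩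
    · rw [hco k le_rfl]
      simp
    · rw [if_neg hk.ne']
      apply Polynomial.coeff_eq_zero_of_natDegree_lt
      refine lt_of_le_of_lt ?_ hk
      rw [hpr]
      refine (Polynomial.natDegree_multiset_prod_le _).trans ?_
      rw [Multiset.map_map, Multiset.map_map]
      refine (Multiset.sum_le_card_nsmul _ 1 ?_).trans ?_
      · intro x hx
        simp only [Multiset.mem_map] at hx
        obtain ⟨i, _, rfl⟩ := hx
        exact Polynomial.natDegree_X_sub_C_le _
      · simp
  · intro h p hp
    have : Esym n ≤ RingHom.ker g := by
      rw [Esym, Ideal.span_le]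
      rintro _ ⟨i, h1, h2, rfl⟩
      have h3 := hco (n - i) (by omega)
      rw [h, Polynomial.coeff_X_pow, if_neg (by omega), Nat.sub_sub_self h2] at h3
      rw [SetLike.mem_coe, RingHom.mem_ker]
      have h4 : ((-1 : Q) ^ i) * ((-1) ^ i * g (esymm (Fin n) ℂ i)) = 0 := by rw [← h3, mul_zero]
      rwa [← mul_assoc, ← mul_pow, neg_one_mul, neg_neg, one_pow, one_mul] at h4
    exact this hp

variable {n : ℕ} {Q : Type} [CommRing Q] {b : Fin n → Q}

theorem root_pow (h : ∏ i, (Polynomial.X - Polynomial.C (b i)) = (Polynomial.X : Polynomial Q) ^ n)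
    (j : Fin n) : b j ^ n = 0 := by
  have := congrArg (Polynomial.eval (b j)) h
  rw [Polynomial.eval_prod, Finset.prod_eq_zero (Finset.mem_univ j) (by simp)] at this
  simpa using this.symm

open Polynomial in
theorem factor_out
    (h : ∏ i, (Polynomial.X - Polynomial.C (b i)) = (Polynomial.X : Polynomial Q) ^ n)
    (j : Fin n) : ∏ i ∈ Finset.univ.erase j, (Polynomial.X - Polynomial.C (b i)) =
      ∑ i ∈ Finset.range n, Polynomial.X ^ i * (Polynomial.C (b j)) ^ (n - 1 - i) := by
  apply (Polynomial.monic_X_sub_C (b j)).isRegular.left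
  change (Polynomial.X - Polynomial.C (b j)) * _ = (Polynomial.X - Polynomial.C (b j)) * _
  rw [Finset.mul_prod_erase Finset.univ (fun i => Polynomial.X - Polynomial.C (b i))
    (Finset.mem_univ j), h, mul_comm,
    Commute.geom_sum₂_mul (Commute.all _ _), ← Polynomial.C_pow, root_pow h j]
  simp

theorem prod_diff
    (h : ∏ i, (Polynomial.X - Polynomial.C (b i)) = (Polynomial.X : Polynomial Q) ^ n)
    (j : Fin n) : ∏ i ∈ Finset.univ.erase j, (b j - b i) = n * b j ^ (n - 1) := by
  have := congrArg (Polynomial.eval (b j)) (factor_out h j)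
  rw [Polynomial.eval_prod, Polynomial.eval_finsetSum] at this
  simp only [Polynomial.eval_sub, Polynomial.eval_X, Polynomial.eval_C, Polynomial.eval_mul,
    Polynomial.eval_pow] at this
  rw [this, Finset.sum_congr rfl (g := fun _ => b j ^ (n - 1))]
  · simp
  · intro i hi
    rw [Finset.mem_range] at hi
    rw [← pow_add]
    congr 1
    omega

theorem prod_neg'
    (h : ∏ i, (Polynomial.X - Polynomial.C (b i)) = (Polynomial.X : Polynomial Q) ^ n)
    (j : Fin n) : ∏ i ∈ Finset.univ.erase j, (- b i) = b j ^ (n - 1) := by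
  have := congrArg (Polynomial.eval 0) (factor_out h j)
  rw [Polynomial.eval_prod, Polynomial.eval_finsetSum] at this
  simp only [Polynomial.eval_sub, Polynomial.eval_X, Polynomial.eval_C, Polynomial.eval_mul,
    Polynomial.eval_pow, zero_sub] at this
  rw [this, Finset.sum_eq_single 0]
  · simp
  · intro i _ hi
    simp [hi]
  · intro hh
    exact absurd (Finset.mem_range.2 (Nat.pos_of_ne_zero (by rintro rfl; exact j.elim0))) hh

end Count

/-! ### The dimensions -/

section Dims

variable {n : ℕ}

theorem quot_gen (J : Ideal (MvPolynomial (Fin n) ℂ)) :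
    Algebra.adjoin ℂ (Set.range fun i => Ideal.Quotient.mkₐ ℂ J (X i)) = ⊤ := by
  have h := congrArg (Subalgebra.map (Ideal.Quotient.mkₐ ℂ J))
    (MvPolynomial.adjoin_range_X (R := ℂ) (σ := Fin n))
  rw [AlgHom.map_adjoin, Algebra.map_top,
    (AlgHom.range_eq_top _).2 (Ideal.Quotient.mkₐ_surjective ℂ J), ← Set.range_comp] at h
  exact h

theorem quot_prod (J : Ideal (MvPolynomial (Fin n) ℂ)) (hJ : Esym n ≤ J) :
    ∏ i, (Polynomial.X - Polynomial.C (Ideal.Quotient.mkₐ ℂ J (X i))) =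
      (Polynomial.X : Polynomial (MvPolynomial (Fin n) ℂ ⧸ J)) ^ n :=
  (kill_iff _).1 fun _ hp => Ideal.Quotient.eq_zero_iff_mem.2 (hJ hp)

theorem gen_of_zero {Q K : Type} [CommRing Q] [Algebra ℂ Q] [CommRing K] [Algebra ℂ K]
    (φ : K →ₐ[ℂ] Q) (b : Fin n → Q)
    (hb : Algebra.adjoin ℂ (Set.range b) = ⊤) (s : Finset (Fin n))
    (hs : ∀ i, i ∉ s → b i ∈ Set.range φ) :
    Algebra.adjoin ℂ (Set.range φ ∪ b '' s) = ⊤ := by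
  rw [eq_top_iff, ← hb]
  apply Algebra.adjoin_mono
  rintro _ ⟨i, rfl⟩
  by_cases hi : i ∈ s
  · right
    exact ⟨i, hi, rfl⟩
  · left
    exact hs i hi

theorem up0 (J : Ideal (MvPolynomial (Fin n) ℂ)) (hJ : Esym n ≤ J) (s : Finset (Fin n))
    (hs : ∀ i, i ∉ s → X i ∈ J) :
    Module.length ℂ (MvPolynomial (Fin n) ℂ ⧸ J) ≤ (s.card.factorial : ℕ) := by
  have hb0 : ∀ i, i ∉ s → Ideal.Quotient.mkₐ ℂ J (X i) = 0 := fun i hi =>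
    Ideal.Quotient.eq_zero_iff_mem.2 (hs i hi)
  have hp : ∏ i ∈ s, (Polynomial.X - Polynomial.C (Ideal.Quotient.mkₐ ℂ J (X i))) =
      (Polynomial.X : Polynomial (MvPolynomial (Fin n) ℂ ⧸ J)) ^ s.card := by
    apply ((Polynomial.monic_X (R := MvPolynomial (Fin n) ℂ ⧸ J)).pow (n - s.card)).isRegular.left
    have h1 := quot_prod J hJ
    rw [← Finset.prod_compl_mul_prod s, Finset.prod_congr rfl
      (g := fun _ => (Polynomial.X : Polynomial (MvPolynomial (Fin n) ℂ ⧸ J))),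
      Finset.prod_const, Finset.card_compl, Fintype.card_fin] at h1
    · refine h1.trans ?_
      change _ = _ * _
      rw [← pow_add, Nat.sub_add_cancel]
      simpa using Finset.card_le_univ s
    · intro i hi
      rw [hb0 i (by simpa using hi)]
      simp
  obtain ⟨h1, h2⟩ := upper _ (fun i => Ideal.Quotient.mkₐ ℂ J (X i)) s ℂ (Algebra.ofId ℂ _)
    (Polynomial.X ^ s.card) (Polynomial.monic_X.pow _) (by simp)
    (by rw [hp]; simp) (gen_of_zero _ _ (quot_gen J) s fun i hi => ⟨0, by rw [map_zero, hb0 i hi]⟩)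
  rw [Module.length_eq_finrank]
  simpa using h2

open scoped Polynomial in
theorem up1 (j l : Fin n) (hjl : l ≠ j) :
    Module.length ℂ (MvPolynomial (Fin n) ℂ ⧸ (Esym n ⊔ Ideal.span {X j - X l})) ≤
      ((n - 1).factorial : ℕ) := by
  set J := Esym n ⊔ Ideal.span {X j - X l} with hJ
  have hn : 2 ≤ n := by
    have := j.2
    have := l.2
    have := Fin.val_ne_of_ne hjl
    omega
  set b : Fin n → (MvPolynomial (Fin n) ℂ ⧸ J) := fun i => Ideal.Quotient.mkₐ ℂ J (X i) with hb
  have hbl : b l = b j := by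
    symm
    rw [hb]
    apply Ideal.Quotient.eq.2
    exact Ideal.mem_sup_right (Ideal.mem_span_singleton_self _)
  have hP := quot_prod J le_sup_left
  change ∏ i, (Polynomial.X - Polynomial.C (b i)) = _ at hP
  have hj0 : b j ^ (n - 1) = 0 := by
    have h1 := prod_diff hP j
    rw [Finset.prod_eq_zero (Finset.mem_erase.2 ⟨hjl, Finset.mem_univ l⟩) (by rw [hbl, sub_self])] at h1
    have h2 : (n : ℂ) • b j ^ (n - 1) = 0 := by
      rw [Algebra.smul_def, map_natCast, ← h1]
    exact (smul_eq_zero.1 h2).resolve_left (by norm_cast; omega)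
  let g : ℂ[X] := Polynomial.X ^ (n - 1)
  have hg : g.Monic := Polynomial.monic_X.pow _
  obtain ⟨hfin, hrk⟩ := adjoinRoot_fin ℂ g hg
  let φ : AdjoinRoot g →ₐ[ℂ] (MvPolynomial (Fin n) ℂ ⧸ J) :=
    AdjoinRoot.liftAlgHom g (Algebra.ofId ℂ _) (b j) (by simp [g, hj0])
  have hφ : φ (AdjoinRoot.root g) = b j := by simp [φ]
  have hr : AdjoinRoot.root g ^ (n - 1) = 0 := by
    have := AdjoinRoot.eval₂_root g
    simpa [g] using this
  have hrn : AdjoinRoot.root g ^ n = 0 := by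
    rw [← Nat.sub_add_cancel (show 1 ≤ n by omega), pow_succ, hr, zero_mul]
  obtain ⟨f, hf⟩ : ∃ f : (AdjoinRoot g)[X], Polynomial.X ^ n =
      (Polynomial.X - Polynomial.C (AdjoinRoot.root g)) *
        ((Polynomial.X - Polynomial.C (AdjoinRoot.root g)) * f) := by
    have h1 : (Polynomial.X : (AdjoinRoot g)[X]) ^ n =
      (Polynomial.X - Polynomial.C (AdjoinRoot.root g)) *
      ∑ i ∈ Finset.range n, Polynomial.X ^ i * (Polynomial.C (AdjoinRoot.root g)) ^ (n - 1 - i) := by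
      rw [mul_comm, Commute.geom_sum₂_mul (Commute.all _ _), ← Polynomial.C_pow, hrn]
      simp
    obtain ⟨f, h2⟩ : (Polynomial.X - Polynomial.C (AdjoinRoot.root g)) ∣
        ∑ i ∈ Finset.range n, Polynomial.X ^ i * (Polynomial.C (AdjoinRoot.root g)) ^ (n - 1 - i) := by
      rw [Polynomial.dvd_iff_isRoot, Polynomial.IsRoot.def, Polynomial.eval_finsetSum]
      apply Finset.sum_eq_zero
      intro i hi
      rw [Finset.mem_range] at hi
      simp only [Polynomial.eval_X, Polynomial.eval_C, Polynomial.eval_mul, Polynomial.eval_pow]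
      rw [← pow_add, ← hr]
      congr 1
      omega
    exact ⟨f, by rw [h1, h2]⟩
  have hm1 := Polynomial.monic_X_sub_C (AdjoinRoot.root g)
  have hfm1 : ((Polynomial.X - Polynomial.C (AdjoinRoot.root g)) * f).Monic :=
    hm1.of_mul_monic_left (hf ▸ Polynomial.monic_X.pow n)
  have hfm : f.Monic := hm1.of_mul_monic_left hfm1
  have : Nontrivial (AdjoinRoot g) := by
    by_contra hh
    rw [not_nontrivial_iff_subsingleton] at hh
    rw [Module.finrank_zero_of_subsingleton] at hrk
    simp [g] at hrk
    omega
  have hdeg : f.natDegree = ((Finset.univ.erase j).erase l).card := by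
    have h1 := congrArg Polynomial.natDegree hf
    rw [hm1.natDegree_mul hfm1, hm1.natDegree_mul hfm, Polynomial.natDegree_X_pow,
      Polynomial.natDegree_X_sub_C] at h1
    rw [Finset.card_erase_of_mem (Finset.mem_erase.2 ⟨hjl, Finset.mem_univ l⟩),
      Finset.card_erase_of_mem (Finset.mem_univ j), Finset.card_univ, Fintype.card_fin]
    omega
  have hfp : f.map (φ : AdjoinRoot g →+* _) =
      ∏ i ∈ (Finset.univ.erase j).erase l, (Polynomial.X - Polynomial.C (b i)) := by
    apply ((Polynomial.monic_X_sub_C (b j)).mul (Polynomial.monic_X_sub_C (b j))).isRegular.left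
    change _ * _ = _ * _
    have h1 := congrArg (Polynomial.map (φ : AdjoinRoot g →+* (MvPolynomial (Fin n) ℂ ⧸ J))) hf
    rw [Polynomial.map_pow, Polynomial.map_X, ← hP,
      ← Finset.mul_prod_erase Finset.univ _ (Finset.mem_univ j),
      ← Finset.mul_prod_erase (Finset.univ.erase j) _
        (Finset.mem_erase.2 ⟨hjl, Finset.mem_univ l⟩), hbl] at h1
    rw [mul_assoc, mul_assoc, h1]
    simp [hφ]
  obtain ⟨h1, h2⟩ := upper _ b ((Finset.univ.erase j).erase l) (AdjoinRoot g) φ f hfm hdeg hfp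
    (gen_of_zero φ b (quot_gen J) _ fun i hi => by
      refine ⟨AdjoinRoot.root g, ?_⟩
      rw [hφ]
      simp only [Finset.mem_erase, Finset.mem_univ, and_true, not_and, not_not] at hi
      by_cases h : i = l
      · rw [h, hbl]
      · rw [hi h])
  rw [Module.length_eq_finrank]
  rw [hrk, ← hdeg] at h2
  have hd2 : f.natDegree = n - 2 := by
    rw [hdeg, Finset.card_erase_of_mem (Finset.mem_erase.2 ⟨hjl, Finset.mem_univ l⟩),
      Finset.card_erase_of_mem (Finset.mem_univ j), Finset.card_univ, Fintype.card_fin]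
    omega
  have h3 : (n - 1).factorial = (n - 1) * (n - 2).factorial := by
    obtain ⟨m, rfl⟩ := Nat.exists_eq_add_of_le hn
    rw [show 2 + m - 1 = m + 1 by omega, show 2 + m - 2 = m by omega, Nat.factorial_succ]
  rw [hd2] at h2
  simp only [g, Polynomial.natDegree_X_pow, Module.finrank_self, one_mul] at h2
  rw [h3]
  exact_mod_cast h2

theorem low (s : Finset (Fin n)) (J : Ideal (MvPolynomial (Fin n) ℂ))
    (hJ : J ≤ Esym n ⊔ Ideal.span (X '' {i | i ∉ s})) :
    (s.card.factorial : ℕ) ≤ Module.length ℂ (MvPolynomial (Fin n) ℂ ⧸ J) := by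
  obtain ⟨Q, _, _, φ, b, hb, hp, hg, hF, hr⟩ := lower s ℂ (Polynomial.X ^ s.card)
    (Polynomial.monic_X.pow _) (by simp)
  have hprod : ∏ i, (Polynomial.X - Polynomial.C (aeval (R := ℂ) b (X i))) =
      (Polynomial.X : Polynomial Q) ^ n := by
    simp only [aeval_X]
    rw [← Finset.prod_compl_mul_prod s, ← hp, Finset.prod_congr rfl
      (g := fun _ => (Polynomial.X : Polynomial Q)),
      Finset.prod_const, Finset.card_compl, Fintype.card_fin]
    · rw [Polynomial.map_pow, Polynomial.map_X, ← pow_add, Nat.sub_add_cancel]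
      simpa using Finset.card_le_univ s
    · intro i hi
      rw [hb i (by simpa using hi)]
      simp
  have hk := (kill_iff (aeval (R := ℂ) b)).2 hprod
  have hkJ : J ≤ RingHom.ker (aeval (R := ℂ) b) := by
    refine hJ.trans (sup_le hk ?_)
    rw [Ideal.span_le]
    rintro _ ⟨i, hi, rfl⟩
    rw [SetLike.mem_coe, RingHom.mem_ker, aeval_X]
    exact hb i hi
  have hsurj : Function.Surjective (aeval (R := ℂ) b) := by
    rw [← AlgHom.range_eq_top, eq_top_iff, ← hg]
    apply Algebra.adjoin_le
    rintro _ (⟨c, rfl⟩ | ⟨i, _, rfl⟩)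
    · refine ⟨C c, ?_⟩
      change aeval b (algebraMap ℂ (MvPolynomial (Fin n) ℂ) c) = φ (algebraMap ℂ ℂ c)
      rw [AlgHom.commutes, AlgHom.commutes]
    · exact ⟨X i, by simp⟩
  have h1 := Module.length_le_of_surjective (Ideal.Quotient.liftₐ J (aeval (R := ℂ) b)
    fun a ha => hkJ ha).toLinearMap (fun q => by
      obtain ⟨p, rfl⟩ := hsurj q
      exact ⟨Ideal.Quotient.mk J p, rfl⟩)
  rw [Module.length_eq_finrank, hr] at h1
  simpa using h1

/-- The linear factors for the trivial part. -/
noncomputable def lin (n : ℕ) (hn : 0 < n) (l : Fin n) : MvPolynomial (Fin n) ℂ :=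
  if l = ⟨0, hn⟩ then X ⟨0, hn⟩ else X ⟨0, hn⟩ - X l

noncomputable def JB (n a : ℕ) (hn : 0 < n) : Ideal (MvPolynomial (Fin n) ℂ) :=
  Esym n ⊔ Ideal.span {∏ l ∈ Finset.univ.filter (fun l : Fin n => (l : ℕ) < a), lin n hn l}

noncomputable def JC (n a : ℕ) (hn : 0 < n) : Ideal (MvPolynomial (Fin n) ℂ) :=
  (Esym n ⊔ Ideal.span {X ⟨0, hn⟩}) ⊔
    Ideal.span {∏ l ∈ Finset.univ.filter (fun l : Fin n => a ≤ (l : ℕ)), (- X l)}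

theorem card_lt (n a : ℕ) (han : a ≤ n) :
    (Finset.univ.filter (fun l : Fin n => (l : ℕ) < a)).card = a := by
  rw [Fin.card_filter_val_lt]
  omega

theorem card_ge (n a : ℕ) :
    (Finset.univ.filter (fun l : Fin n => a ≤ (l : ℕ))).card = n - a := by
  have h1 := Finset.card_filter_add_card_filter_not (s := (Finset.univ : Finset (Fin n)))
    (fun l : Fin n => (l : ℕ) < a)
  simp only [not_lt] at h1
  rw [Fin.card_filter_val_lt, Finset.card_univ, Fintype.card_fin] at h1
  omega

theorem lenB (n a : ℕ) (hn : 0 < n) (han : a ≤ n) :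
    Module.length ℂ (MvPolynomial (Fin n) ℂ ⧸ JB n a hn) = (a * (n - 1).factorial : ℕ) := by
  have := count (Esym n) (lin n hn) (n - 1).factorial
    (Finset.univ.filter (fun l : Fin n => (l : ℕ) < a)) Finset.univ (Finset.subset_univ _) ?_ ?_ ?_
  · rwa [card_lt n a han] at this
  · intro i _
    by_cases hi : i = ⟨0, hn⟩
    · subst hi
      rw [lin, if_pos rfl]
      refine (up0 _ le_sup_left (Finset.univ.erase ⟨0, hn⟩) ?_).trans ?_
      · intro i hi
        simp only [Finset.mem_erase, Finset.mem_univ, and_true, not_not] at hi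
        rw [hi]
        exact Ideal.mem_sup_right (Ideal.mem_span_singleton_self _)
      · rw [Finset.card_erase_of_mem (Finset.mem_univ _), Finset.card_univ, Fintype.card_fin]
    · rw [lin, if_neg hi]
      exact up1 _ _ hi
  · rw [← Ideal.Quotient.eq_zero_iff_mem, ← Ideal.Quotient.mkₐ_eq_mk ℂ,
      ← Finset.mul_prod_erase Finset.univ _ (Finset.mem_univ ⟨0, hn⟩),
      Finset.prod_congr rfl (g := fun l => X ⟨0, hn⟩ - X l)]
    · have h1 := quot_prod (Esym n) le_rfl
      rw [map_mul, map_prod, lin, if_pos rfl]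
      simp only [map_sub]
      rw [prod_diff h1, mul_left_comm, ← pow_succ', Nat.sub_add_cancel hn, root_pow h1, mul_zero]
    · intro l hl
      rw [lin, if_neg (Finset.ne_of_mem_erase hl)]
  · have := low (Finset.univ : Finset (Fin n)) (Esym n) le_sup_left
    rw [Finset.card_univ, Fintype.card_fin] at this ⊢
    rwa [Nat.mul_factorial_pred hn.ne']

theorem lenC (n a : ℕ) (hn : 0 < n) (ha : 1 ≤ a) (han : a ≤ n) :
    Module.length ℂ (MvPolynomial (Fin n) ℂ ⧸ JC n a hn) = ((n - a) * (n - 2).factorial : ℕ) := by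
  rcases eq_or_lt_of_le han with rfl | hlt
  · have h0 : Finset.univ.filter (fun l : Fin a => a ≤ (l : ℕ)) = ∅ := by
      ext l
      simp
    have : JC a a hn = ⊤ := by
      rw [JC, h0]
      simp
    rw [this]
    have : Subsingleton (MvPolynomial (Fin a) ℂ ⧸ (⊤ : Ideal (MvPolynomial (Fin a) ℂ))) :=
      Ideal.Quotient.subsingleton_iff.2 rfl
    rw [Module.length_eq_zero]
    simp
  have hc : (Finset.univ.erase (⟨0, hn⟩ : Fin n)).card = n - 1 := by
    rw [Finset.card_erase_of_mem (Finset.mem_univ _), Finset.card_univ, Fintype.card_fin]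
  have := count (Esym n ⊔ Ideal.span {X ⟨0, hn⟩}) (fun l : Fin n => - X l) (n - 2).factorial
    (Finset.univ.filter (fun l : Fin n => a ≤ (l : ℕ))) (Finset.univ.erase ⟨0, hn⟩) ?_ ?_ ?_ ?_
  · rwa [card_ge n a] at this
  · intro l hl
    rw [Finset.mem_filter] at hl
    refine Finset.mem_erase.2 ⟨?_, Finset.mem_univ _⟩
    rintro rfl
    have := hl.2
    simp at this
    omega
  · intro i hi
    refine (up0 _ (le_sup_left.trans le_sup_left) ((Finset.univ.erase ⟨0, hn⟩).erase i) ?_).trans ?_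
    · intro j hj
      simp only [Finset.mem_erase, Finset.mem_univ, and_true, not_and, not_not] at hj
      by_cases h : j = i
      · rw [h, ← neg_mem_iff]
        exact Ideal.mem_sup_right (Ideal.mem_span_singleton_self _)
      · rw [hj h]
        exact Ideal.mem_sup_left (Ideal.mem_sup_right (Ideal.mem_span_singleton_self _))
    · rw [Finset.card_erase_of_mem hi, hc]
      rfl
  · have h1 := quot_prod (Esym n ⊔ Ideal.span {X ⟨0, hn⟩}) le_sup_left
    rw [← Ideal.Quotient.eq_zero_iff_mem, ← Ideal.Quotient.mkₐ_eq_mk ℂ, map_prod]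
    simp only [map_neg]
    rw [prod_neg' h1]
    have : Ideal.Quotient.mkₐ ℂ (Esym n ⊔ Ideal.span {X ⟨0, hn⟩}) (X ⟨0, hn⟩) = 0 :=
      Ideal.Quotient.eq_zero_iff_mem.2 (Ideal.mem_sup_right (Ideal.mem_span_singleton_self _))
    rw [this, zero_pow (by omega)]
  · have := low (Finset.univ.erase (⟨0, hn⟩ : Fin n)) (Esym n ⊔ Ideal.span {X ⟨0, hn⟩}) ?_
    · rw [hc] at this ⊢
      rwa [← Nat.sub_sub n 1 1, Nat.mul_factorial_pred (by omega)]
    · refine sup_le_sup_left ?_ _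
      rw [Ideal.span_singleton_le_iff_mem]
      exact Ideal.subset_span ⟨_, by simp, rfl⟩

end Dims

/-! ### Coordinates on `ℂ[x,y]` -/

section Coord

variable (n a : ℕ) (hn : 0 < n)

noncomputable def PP : MvPolynomial (Fin n) ℂ :=
  ∏ l ∈ Finset.univ.filter (fun l : Fin n => 1 ≤ (l : ℕ) ∧ (l : ℕ) < a), (X ⟨0, hn⟩ - X l)

noncomputable def qq : MvPolynomial (Fin n) ℂ :=
  ∏ l ∈ Finset.univ.filter (fun l : Fin n => 1 ≤ (l : ℕ) ∧ (l : ℕ) < a), (- X l)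

noncomputable def pa : MvPolynomial (Fin n) ℂ :=
  ∏ l ∈ Finset.univ.filter (fun l : Fin n => a ≤ (l : ℕ)), (- X l)

noncomputable def ww : MvPolynomial (Fin n) ℂ :=
  ∏ l ∈ Finset.univ.filter (fun l : Fin n => 1 ≤ (l : ℕ)), (- X l)

theorem dvd_diff (s : Finset (Fin n)) :
    ∃ c : MvPolynomial (Fin n) ℂ,
      ∏ l ∈ s, (X ⟨0, hn⟩ - X l) = ∏ l ∈ s, (- X l) + X ⟨0, hn⟩ * c := by
  have : ∏ l ∈ s, (X ⟨0, hn⟩ - X l) - ∏ l ∈ s, (- X l) ∈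
      Ideal.span {(X ⟨0, hn⟩ : MvPolynomial (Fin n) ℂ)} := by
    rw [← Ideal.Quotient.eq, map_prod, map_prod]
    refine Finset.prod_congr rfl fun l _ => ?_
    rw [map_sub, map_neg, Ideal.Quotient.eq_zero_iff_mem.2 (Ideal.mem_span_singleton_self _),
      zero_sub]
  obtain ⟨c, hc⟩ := Ideal.mem_span_singleton.1 this
  exact ⟨c, by rw [← hc]; ring⟩

theorem filter_one : Finset.univ.filter (fun l : Fin n => 1 ≤ (l : ℕ)) =
    Finset.univ.erase ⟨0, hn⟩ := by
  ext l
  simp [Fin.ext_iff, Nat.one_le_iff_ne_zero]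

theorem split_prod {M : Type} [CommMonoid M] (ha : 1 ≤ a) (f : Fin n → M) :
    (∏ l ∈ Finset.univ.filter (fun l : Fin n => 1 ≤ (l : ℕ) ∧ (l : ℕ) < a), f l) *
      (∏ l ∈ Finset.univ.filter (fun l : Fin n => a ≤ (l : ℕ)), f l) =
    ∏ l ∈ Finset.univ.filter (fun l : Fin n => 1 ≤ (l : ℕ)), f l := by
  rw [← Finset.prod_union]
  · congr 1
    ext l
    simp only [Finset.mem_union, Finset.mem_filter, Finset.mem_univ, true_and]
    omega
  · rw [Finset.disjoint_filter]
    intro l _ h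
    omega

theorem prod_lin (ha : 1 ≤ a) :
    ∏ l ∈ Finset.univ.filter (fun l : Fin n => (l : ℕ) < a), lin n hn l =
      X ⟨0, hn⟩ * PP n a hn := by
  have h : Finset.univ.filter (fun l : Fin n => (l : ℕ) < a) =
      insert ⟨0, hn⟩ (Finset.univ.filter (fun l : Fin n => 1 ≤ (l : ℕ) ∧ (l : ℕ) < a)) := by
    ext l
    simp only [Finset.mem_insert, Finset.mem_filter, Finset.mem_univ, true_and, Fin.ext_iff]
    omega
  rw [h, Finset.prod_insert (by simp), lin, if_pos rfl, PP]
  congr 1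
  refine Finset.prod_congr rfl fun l hl => ?_
  rw [lin, if_neg]
  rintro rfl
  simp at hl

theorem xP_mem (ha : 1 ≤ a) : X ⟨0, hn⟩ * PP n a hn ∈ JB n a hn := by
  rw [JB, prod_lin n a hn ha]
  exact Ideal.mem_sup_right (Ideal.mem_span_singleton_self _)

theorem ww_eq (ha : 1 ≤ a) : ww n = qq n a * pa n a := (split_prod n a ha _).symm

theorem mk_ww (J : Ideal (MvPolynomial (Fin n) ℂ)) (hJ : Esym n ≤ J) :
    Ideal.Quotient.mk J (ww n) = Ideal.Quotient.mk J (X ⟨0, hn⟩) ^ (n - 1) := by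
  have h := prod_neg' (quot_prod J hJ) ⟨0, hn⟩
  rw [ww, filter_one n hn, map_prod]
  simp only [map_neg]
  exact h

theorem E_le_JB : Esym n ≤ JB n a hn := le_sup_left

theorem prod_one (J : Ideal (MvPolynomial (Fin n) ℂ)) (hJ : Esym n ≤ J) :
    Ideal.Quotient.mk J (∏ l ∈ Finset.univ.filter (fun l : Fin n => 1 ≤ (l : ℕ)),
      (X ⟨0, hn⟩ - X l)) = n * Ideal.Quotient.mk J (X ⟨0, hn⟩) ^ (n - 1) := by
  have h1 := prod_diff (quot_prod J hJ) ⟨0, hn⟩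
  rw [filter_one n hn, map_prod]
  simp only [map_sub]
  exact h1

theorem PP_pa (ha : 1 ≤ a) : ∃ c : MvPolynomial (Fin n) ℂ,
    ∏ l ∈ Finset.univ.filter (fun l : Fin n => 1 ≤ (l : ℕ)),
      ((X ⟨0, hn⟩ : MvPolynomial (Fin n) ℂ) - X l) =
    PP n a hn * pa n a + X ⟨0, hn⟩ * PP n a hn * c := by
  obtain ⟨c, hc⟩ := dvd_diff n hn (Finset.univ.filter (fun l : Fin n => a ≤ (l : ℕ)))
  refine ⟨c, ?_⟩
  rw [← split_prod n a ha, hc]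
  unfold PP pa
  generalize (∏ l ∈ Finset.univ.filter (fun l : Fin n => 1 ≤ (l : ℕ) ∧ (l : ℕ) < a), ((X ⟨0, hn⟩ : MvPolynomial (Fin n) ℂ) - X l)) = u
  generalize ∏ l ∈ Finset.univ.filter (fun l : Fin n => a ≤ (l : ℕ)), (- X l : MvPolynomial (Fin n) ℂ) = v
  ring

theorem J_Ppa (ha : 1 ≤ a) (J : Ideal (MvPolynomial (Fin n) ℂ)) (hJ : Esym n ≤ J)
    (hx : X ⟨0, hn⟩ * PP n a hn ∈ J) : Ideal.Quotient.mk J (PP n a hn * pa n a) =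
    n * Ideal.Quotient.mk J (ww n) := by
  obtain ⟨c, hc⟩ := PP_pa n a hn ha
  have h5 := prod_one n hn J hJ
  rw [hc] at h5
  rw [mk_ww n hn J hJ]
  refine Eq.trans ?_ h5
  rw [Ideal.Quotient.eq, sub_add_cancel_left]
  exact J.neg_mem (J.mul_mem_right _ hx)

theorem B_Ppa (ha : 1 ≤ a) : Ideal.Quotient.mk (JB n a hn) (PP n a hn * pa n a) =
    n * Ideal.Quotient.mk (JB n a hn) (ww n) :=
  J_Ppa n a hn ha _ (E_le_JB n a hn) (xP_mem n a hn ha)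

theorem B_wwP (ha : 1 ≤ a) (h2 : 2 ≤ n) :
    Ideal.Quotient.mk (JB n a hn) (ww n) * Ideal.Quotient.mk (JB n a hn) (PP n a hn) = 0 := by
  have h4 : Ideal.Quotient.mk (JB n a hn) (X ⟨0, hn⟩ * PP n a hn) = 0 :=
    Ideal.Quotient.eq_zero_iff_mem.2 (xP_mem n a hn ha)
  rw [map_mul] at h4
  rw [mk_ww n hn _ (E_le_JB n a hn), show n - 1 = n - 2 + 1 by omega, pow_succ, mul_assoc, h4, mul_zero]

theorem B_wwq (ha : 1 ≤ a) (h2 : 2 ≤ n) :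
    Ideal.Quotient.mk (JB n a hn) (ww n) * Ideal.Quotient.mk (JB n a hn) (qq n a) = 0 := by
  obtain ⟨c, hc⟩ := dvd_diff n hn
    (Finset.univ.filter (fun l : Fin n => 1 ≤ (l : ℕ) ∧ (l : ℕ) < a))
  have hc' : PP n a hn = qq n a + X ⟨0, hn⟩ * c := hc
  have h := B_wwP n a hn ha h2
  have h3 : Ideal.Quotient.mk (JB n a hn) (ww n) * Ideal.Quotient.mk (JB n a hn) (X ⟨0, hn⟩) = 0 := by
    rw [mk_ww n hn _ (E_le_JB n a hn), ← pow_succ, Nat.sub_add_cancel hn]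
    exact root_pow (quot_prod (JB n a hn) (E_le_JB n a hn)) ⟨0, hn⟩
  rw [hc', map_add, map_mul, mul_add, ← mul_assoc, h3, zero_mul, add_zero] at h
  exact h

/-- The homomorphism recording the two coordinates. -/
noncomputable def FF : MvPolynomial (Fin n ⊕ Fin n) ℂ →ₐ[ℂ]
    (Fin n → QuadraticAlgebra (MvPolynomial (Fin n) ℂ) 0 (qq n a)) :=
  aeval (Sum.elim (fun i _ => ⟨X i, 0⟩) (fun k => Pi.single k ⟨0, 1⟩))

noncomputable def rr : MvPolynomial (Fin n ⊕ Fin n) ℂ →ₐ[ℂ] MvPolynomial (Fin n) ℂ :=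
  aeval (Sum.elim X 0)

noncomputable def im : MvPolynomial (Fin n ⊕ Fin n) ℂ →ₗ[ℂ] (Fin n → MvPolynomial (Fin n) ℂ) where
  toFun p k := (FF n a p k).im
  map_add' p q := by ext1 k; simp
  map_smul' c p := by ext1 k; simp

theorem FF_re (p : MvPolynomial (Fin n ⊕ Fin n) ℂ) (k : Fin n) :
    (FF n a p k).re = rr n p := by
  induction p using MvPolynomial.induction_on with
  | C c =>
    rw [← algebraMap_eq, AlgHom.commutes, AlgHom.commutes]
    rfl
  | add p q hp hq => simp [hp, hq]
  | mul_X p i hp =>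
    rw [map_mul, map_mul, ← hp, Pi.mul_apply, QuadraticAlgebra.re_mul]
    cases i with
    | inl i => simp [FF, rr]
    | inr j =>
      by_cases h : k = j
      · subst h; simp [FF, rr]
      · simp [FF, rr, Pi.single_apply, h]

theorem im_mul (p q : MvPolynomial (Fin n ⊕ Fin n) ℂ) (k : Fin n) :
    im n a (p * q) k = rr n p * im n a q k + im n a p k * rr n q +
      qq n a * im n a p k * im n a q k := by
  change (FF n a (p * q) k).im = _ * (FF n a q k).im + (FF n a p k).im * _ +
    _ * (FF n a p k).im * (FF n a q k).im
  rw [map_mul, Pi.mul_apply, QuadraticAlgebra.im_mul, FF_re, FF_re]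

theorem im_x (i k : Fin n) : im n a (xv n i) k = 0 := by
  simp [im, FF, xv]

theorem im_y (j k : Fin n) : im n a (yv n j) k = if k = j then 1 else 0 := by
  simp only [im, FF, yv, LinearMap.coe_mk, AddHom.coe_mk, aeval_X, Sum.elim_inr, Pi.single_apply]
  split_ifs <;> simp

theorem rr_x (i : Fin n) : rr n (xv n i) = X i := by simp [rr, xv]

theorem rr_y (i : Fin n) : rr n (yv n i) = 0 := by simp [rr, yv]

theorem im_C (c : ℂ) (k : Fin n) : im n a (C c) k = 0 := by
  change (FF n a (algebraMap ℂ _ c) k).im = 0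
  rw [AlgHom.commutes]
  rfl

theorem rr_rename (r : MvPolynomial (Fin n) ℂ) : rr n (rename Sum.inl r) = r := by
  rw [rr, aeval_rename]
  simp

theorem im_rename (r : MvPolynomial (Fin n) ℂ) (k : Fin n) : im n a (rename Sum.inl r) k = 0 := by
  induction r using MvPolynomial.induction_on with
  | C c => rw [rename_C, im_C]
  | add p q hp hq => rw [map_add, map_add, Pi.add_apply, hp, hq, add_zero]
  | mul_X p i hp =>
    have : im n a (X (Sum.inl i)) k = 0 := im_x n a i k
    rw [map_mul, im_mul, hp, rename_X, this]
    simp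

/-- the permutation action on polynomials -/
noncomputable def ren (σ : Equiv.Perm (Fin n)) :
    MvPolynomial (Fin n ⊕ Fin n) ℂ ≃ₐ[ℂ] MvPolynomial (Fin n ⊕ Fin n) ℂ :=
  renameEquiv ℂ (Equiv.sumCongr (Equiv.refl _) σ)

theorem ren_x (σ : Equiv.Perm (Fin n)) (i : Fin n) : ren n σ (xv n i) = xv n i := by
  simp [ren, xv]

theorem ren_y (σ : Equiv.Perm (Fin n)) (i : Fin n) : ren n σ (yv n i) = yv n (σ i) := by
  simp [ren, yv]

theorem rr_ren (σ : Equiv.Perm (Fin n)) (p : MvPolynomial (Fin n ⊕ Fin n) ℂ) :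
    rr n (ren n σ p) = rr n p := by
  simp only [rr, ren, renameEquiv_apply, aeval_rename]
  congr 2
  ext i
  cases i <;> simp

theorem im_ren (σ : Equiv.Perm (Fin n)) (p : MvPolynomial (Fin n ⊕ Fin n) ℂ) (k : Fin n) :
    im n a (ren n σ p) k = im n a p (σ⁻¹ k) := by
  induction p using MvPolynomial.induction_on with
  | C c =>
    rw [im_C, ← algebraMap_eq, AlgEquiv.commutes, algebraMap_eq, im_C]
  | add p q hp hq => rw [map_add, map_add, map_add, Pi.add_apply, Pi.add_apply, hp, hq]
  | mul_X p i hp =>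
    rw [map_mul, im_mul, im_mul, hp, rr_ren, rr_ren]
    have : im n a (ren n σ (X i)) k = im n a (X i) (σ⁻¹ k) := by
      cases i with
      | inl i =>
        change im n a (ren n σ (xv n i)) k = im n a (xv n i) (σ⁻¹ k)
        rw [ren_x, im_x, im_x]
      | inr i =>
        change im n a (ren n σ (yv n i)) k = im n a (yv n i) (σ⁻¹ k)
        rw [ren_y, im_y, im_y]
        simp [Equiv.symm_apply_eq]
    rw [this]

end Coord

section Kill

variable (n a : ℕ) (hn : 0 < n)

noncomputable def nu : MvPolynomial (Fin n) ℂ := C ((n : ℂ)⁻¹)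

theorem nu_mul (h0 : 0 < n) : nu n * (n : MvPolynomial (Fin n) ℂ) = 1 := by
  have : (n : MvPolynomial (Fin n) ℂ) = C (n : ℂ) := (map_natCast C n).symm
  rw [this, nu, ← C_mul, inv_mul_cancel₀ (by exact_mod_cast h0.ne'), C_1]

theorem rr_prod (s : Finset (Fin n)) : rr n (∏ l ∈ s, (- xv n l)) = ∏ l ∈ s, (- X l) := by
  rw [map_prod]
  refine Finset.prod_congr rfl fun l _ => ?_
  rw [map_neg, rr_x]

theorem pa_ren : (∏ l ∈ Finset.univ.filter (fun l : Fin n => a ≤ (l : ℕ)), (- xv n l)) =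
    rename Sum.inl (pa n a) := by
  rw [pa, map_prod]
  refine Finset.prod_congr rfl fun l _ => ?_
  rw [map_neg, rename_X, xv]

theorem ww_ren : (∏ l ∈ Finset.univ.filter (fun l : Fin n => 1 ≤ (l : ℕ)), (- xv n l)) =
    rename Sum.inl (ww n) := by
  rw [ww, map_prod]
  refine Finset.prod_congr rfl fun l _ => ?_
  rw [map_neg, rename_X, xv]

theorem PP_ren : (∏ l ∈ Finset.univ.filter (fun l : Fin n => 1 ≤ (l : ℕ) ∧ (l : ℕ) < a),
      (xv n ⟨0, hn⟩ - xv n l)) = rename Sum.inl (PP n a hn) := by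
  rw [PP, map_prod]
  refine Finset.prod_congr rfl fun l _ => ?_
  rw [map_sub, rename_X, rename_X, xv, xv]

/-- the generators -/
def gens : Set (MvPolynomial (Fin n ⊕ Fin n) ℂ) :=
  {p | (∃ k k' : Fin n, k ≠ k' ∧ p = yv n k * yv n k') ∨
       (∃ k : Fin n, p = xv n ⟨0, hn⟩ * yv n k) ∨
       (∃ k : Fin n, p = rename Sum.inl (pa n a) * yv n k - rename Sum.inl (ww n)) ∨
       (p = (∑ k : Fin n, yv n k) - rename Sum.inl (PP n a hn)) ∨
       (∃ i : ℕ, 1 ≤ i ∧ i ≤ n ∧ p = rename Sum.inl (esymm (Fin n) ℂ i))}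

theorem Ih_eq : Ih n a hn = Ideal.span (gens n a hn) := by
  rw [Ih, gens, pa_ren, ww_ren, PP_ren]

theorem im_xy (r : MvPolynomial (Fin n) ℂ) (k j : Fin n) :
    im n a (rename Sum.inl r * yv n k) j = if j = k then r else 0 := by
  rw [im_mul, im_rename, rr_rename, im_y, rr_y]
  split_ifs <;> simp

theorem rr_xy (r : MvPolynomial (Fin n) ℂ) (k : Fin n) :
    rr n (rename Sum.inl r * yv n k) = 0 := by
  rw [map_mul, rr_y, mul_zero]

theorem xv_ren (i : Fin n) : xv n i = rename Sum.inl (X i) := by rw [rename_X, xv]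

theorem n_one (h : n = 1) : PP n a hn = 1 ∧ qq n a = 1 := by
  have : Finset.univ.filter (fun l : Fin n => 1 ≤ (l : ℕ) ∧ (l : ℕ) < a) = ∅ := by
    ext l
    have := l.2
    simp
    omega
  rw [PP, qq, this]
  simp

theorem killB {Q : Type} [CommRing Q] (φ : MvPolynomial (Fin n) ℂ →+* Q)
    (hE : ∀ i, 1 ≤ i → i ≤ n → φ (esymm (Fin n) ℂ i) = 0)
    (hx : φ (X ⟨0, hn⟩) * φ (PP n a hn) = 0)
    (hPpa : φ (PP n a hn) * φ (pa n a) = n * φ (ww n))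
    (h2 : 2 ≤ n → φ (ww n) * φ (PP n a hn) = 0) (h3 : 2 ≤ n → φ (ww n) * φ (qq n a) = 0)
    (c g : MvPolynomial (Fin n ⊕ Fin n) ℂ) (hg : g ∈ gens n a hn) :
    φ (rr n (c * g)) + φ (nu n) * φ (PP n a hn) * ∑ k, φ (im n a (c * g) k) = 0 := by
  have hnu : φ (nu n) * n = 1 := by
    have := congrArg φ (nu_mul n hn)
    simpa using this
  have hq : φ (PP n a hn) * (φ (qq n a) - φ (PP n a hn)) = 0 := by
    obtain ⟨d, hd⟩ := dvd_diff n hn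
      (Finset.univ.filter (fun l : Fin n => 1 ≤ (l : ℕ) ∧ (l : ℕ) < a))
    have hd' : PP n a hn = qq n a + X ⟨0, hn⟩ * d := hd
    have hd2 := congrArg φ hd'
    rw [map_add, map_mul] at hd2
    have : φ (qq n a) - φ (PP n a hn) = - (φ (X ⟨0, hn⟩) * φ d) := by rw [hd2]; ring
    rw [this]
    linear_combination (- φ d) * hx
  rcases hg with ⟨k, k', hk, rfl⟩ | ⟨k, rfl⟩ | ⟨k, rfl⟩ | rfl | ⟨i, h1, h2', rfl⟩
  · have : ∀ j, im n a (c * (yv n k * yv n k')) j = 0 := by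
      intro j
      rw [im_mul, im_mul, map_mul, rr_y, rr_y, im_y, im_y]
      by_cases h : j = k
      · subst h; simp [hk]
      · simp [h]
    simp [this, rr_y]
  · rw [xv_ren, map_mul, rr_xy]
    have : ∀ j, im n a (c * (rename Sum.inl (X ⟨0, hn⟩) * yv n k)) j =
        if j = k then X ⟨0, hn⟩ * (rr n c + qq n a * im n a c j) else 0 := by
      intro j
      rw [im_mul, im_xy, rr_xy]
      split_ifs
      · ring
      · ring
    simp only [this, apply_ite φ, map_zero, Finset.sum_ite_eq', Finset.mem_univ, if_true, map_mul]
    linear_combination (φ (nu n) * φ (rr n c + qq n a * im n a c k)) * hx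
  · have : ∀ j, im n a (c * (rename Sum.inl (pa n a) * yv n k - rename Sum.inl (ww n))) j =
        (if j = k then pa n a * (rr n c + qq n a * im n a c j) else 0) - im n a c j * ww n := by
      intro j
      rw [im_mul, map_sub, map_sub, Pi.sub_apply, im_xy, rr_xy, im_rename, rr_rename]
      split_ifs
      · ring
      · ring
    simp only [this, apply_ite φ, map_zero, Finset.sum_ite_eq', Finset.mem_univ, if_true, map_mul,
      map_sub, Finset.sum_sub_distrib, rr_y, rr_rename, mul_zero, map_add, ← Finset.sum_mul]
    rcases Nat.lt_or_ge n 2 with h | h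
    · have h1 : n = 1 := by omega
      subst h1
      obtain ⟨e1, e2⟩ := n_one 1 a hn rfl
      rw [e1] at hPpa ⊢
      rw [e2]
      have e3 : ∑ i, φ (im 1 a c i) = φ (im 1 a c k) := by
        rw [Fin.sum_univ_one, Subsingleton.elim k 0]
      rw [e3]
      simp only [map_one, Nat.cast_one, one_mul, mul_one] at hPpa hnu ⊢
      rw [hnu, hPpa]
      ring
    · have h2' := h2 h
      have h3' := h3 h
      linear_combination (φ (nu n) * (φ (rr n c) + φ (qq n a) * φ (im n a c k))) * hPpa +
        (φ (ww n) * (φ (rr n c) + φ (qq n a) * φ (im n a c k))) * hnu +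
        φ (im n a c k) * h3' - φ (nu n) * (∑ i, φ (im n a c i)) * h2'
  · have : ∀ j, im n a (c * ((∑ k : Fin n, yv n k) - rename Sum.inl (PP n a hn))) j =
        rr n c + (qq n a - PP n a hn) * im n a c j := by
      intro j
      rw [im_mul, map_sub, map_sub, Pi.sub_apply, im_rename, rr_rename, map_sum, map_sum,
        Finset.sum_apply]
      simp only [im_y, rr_y, Finset.sum_ite_eq, Finset.mem_univ, if_true, Finset.sum_const_zero]
      ring
    simp only [this, map_mul, map_sub, map_add, map_sum, rr_y, rr_rename, Finset.sum_const_zero,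
      Finset.sum_add_distrib, Finset.sum_const, Finset.card_univ, Fintype.card_fin,
      nsmul_eq_mul, ← Finset.mul_sum, map_zero]
    linear_combination (φ (rr n c) * φ (PP n a hn)) * hnu +
      (φ (nu n) * (∑ i, φ (im n a c i))) * hq
  · have := hE i h1 h2'
    simp [im_mul, im_rename, rr_rename, this]

theorem killC {Q : Type} [CommRing Q] (φ : MvPolynomial (Fin n) ℂ →+* Q)
    (hE : ∀ i, 1 ≤ i → i ≤ n → φ (esymm (Fin n) ℂ i) = 0)
    (hx : φ (X ⟨0, hn⟩) = 0)
    (hpa : φ (pa n a) = 0) (hww : φ (ww n) = 0)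
    (c g : MvPolynomial (Fin n ⊕ Fin n) ℂ) (hg : g ∈ gens n a hn) :
    ∃ t, ∀ k, φ (im n a (c * g) k) = t := by
  have hq : φ (qq n a) - φ (PP n a hn) = 0 := by
    obtain ⟨d, hd⟩ := dvd_diff n hn
      (Finset.univ.filter (fun l : Fin n => 1 ≤ (l : ℕ) ∧ (l : ℕ) < a))
    have hd' : PP n a hn = qq n a + X ⟨0, hn⟩ * d := hd
    have hd2 := congrArg φ hd'
    rw [map_add, map_mul, hx] at hd2
    rw [hd2]; ring
  rcases hg with ⟨k, k', hk, rfl⟩ | ⟨k, rfl⟩ | ⟨k, rfl⟩ | rfl | ⟨i, h1, h2', rfl⟩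
  · refine ⟨0, fun j => ?_⟩
    rw [im_mul, im_mul, map_mul, rr_y, rr_y, im_y, im_y]
    by_cases h : j = k
    · subst h; simp [hk]
    · simp [h]
  · refine ⟨0, fun j => ?_⟩
    rw [xv_ren, im_mul, im_xy, rr_xy]
    split_ifs <;> simp [hx]
  · refine ⟨0, fun j => ?_⟩
    rw [im_mul, map_sub, map_sub, Pi.sub_apply, im_xy, rr_xy, im_rename, rr_rename]
    split_ifs <;> simp [hpa, hww]
  · refine ⟨φ (rr n c), fun j => ?_⟩
    rw [im_mul, map_sub, map_sub, Pi.sub_apply, im_rename, rr_rename, map_sum, map_sum,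
      Finset.sum_apply]
    simp only [im_y, rr_y, Finset.sum_ite_eq, Finset.mem_univ, if_true, Finset.sum_const_zero,
      map_mul, map_sub, map_add, map_one, map_zero]
    linear_combination φ (im n a c j) * hq
  · refine ⟨0, fun j => ?_⟩
    have := hE i h1 h2'
    simp [im_mul, im_rename, rr_rename, this]

end Kill
section Rel

variable (n a : ℕ) (hn : 0 < n)

theorem JC_x : X ⟨0, hn⟩ ∈ JC n a hn :=
  Ideal.mem_sup_left (Ideal.mem_sup_right (Ideal.mem_span_singleton_self _))

theorem JC_pa : pa n a ∈ JC n a hn :=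
  Ideal.mem_sup_right (Ideal.mem_span_singleton_self _)

theorem JC_ww (ha : 1 ≤ a) : ww n ∈ JC n a hn := by
  rw [ww_eq n a ha]
  exact Ideal.mul_mem_left _ _ (JC_pa n a hn)

theorem E_le_JC : Esym n ≤ JC n a hn := le_sup_left.trans le_sup_left

theorem esymm_mem (J : Ideal (MvPolynomial (Fin n) ℂ)) (hJ : Esym n ≤ J) (i : ℕ) (h1 : 1 ≤ i)
    (h2 : i ≤ n) : Ideal.Quotient.mk J (esymm (Fin n) ℂ i) = 0 :=
  Ideal.Quotient.eq_zero_iff_mem.2 (hJ (Ideal.subset_span ⟨i, h1, h2, rfl⟩))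

noncomputable def thB : MvPolynomial (Fin n ⊕ Fin n) ℂ →ₗ[ℂ] MvPolynomial (Fin n) ℂ ⧸ JB n a hn where
  toFun p := Ideal.Quotient.mk _ (rr n p + nu n * PP n a hn * ∑ k, im n a p k)
  map_add' p q := by
    have : rr n (p + q) + nu n * PP n a hn * ∑ k, im n a (p + q) k =
      (rr n p + nu n * PP n a hn * ∑ k, im n a p k) +
      (rr n q + nu n * PP n a hn * ∑ k, im n a q k) := by
      rw [map_add, map_add]
      simp only [Pi.add_apply, Finset.sum_add_distrib]
      ring
    rw [this, map_add]
  map_smul' c p := by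
    have : rr n (c • p) + nu n * PP n a hn * ∑ k, im n a (c • p) k =
      c • (rr n p + nu n * PP n a hn * ∑ k, im n a p k) := by
      rw [map_smul, map_smul]
      simp only [Pi.smul_apply, ← Finset.smul_sum, smul_add, mul_smul_comm]
    rw [this]
    rfl

noncomputable def thC : MvPolynomial (Fin n ⊕ Fin n) ℂ →ₗ[ℂ]
    (Fin n → MvPolynomial (Fin n) ℂ ⧸ JC n a hn) where
  toFun p k := Ideal.Quotient.mk _ (im n a p k - nu n * ∑ j, im n a p j)
  map_add' p q := by
    ext1 k
    rw [Pi.add_apply, ← map_add, map_add]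
    congr 1
    simp only [Pi.add_apply, Finset.sum_add_distrib]
    ring
  map_smul' c p := by
    ext1 k
    have : im n a (c • p) k - nu n * ∑ j, im n a (c • p) j =
      c • (im n a p k - nu n * ∑ j, im n a p j) := by
      rw [map_smul]
      simp only [Pi.smul_apply, ← Finset.smul_sum, smul_sub, mul_smul_comm]
    rw [this]
    rfl

theorem thB_kill (ha : 1 ≤ a) (p : MvPolynomial (Fin n ⊕ Fin n) ℂ) (hp : p ∈ Ih n a hn) :
    thB n a hn p = 0 := by
  have key : ∀ c, thB n a hn (c * p) = 0 := by
    rw [Ih_eq] at hp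
    induction hp using Submodule.span_induction with
    | mem g hg =>
      intro c
      have h := killB n a hn (Ideal.Quotient.mk (JB n a hn))
        (esymm_mem n _ (E_le_JB n a hn))
        (by rw [← map_mul]; exact Ideal.Quotient.eq_zero_iff_mem.2 (xP_mem n a hn ha))
        (by rw [← map_mul]; exact B_Ppa n a hn ha) (B_wwP n a hn ha) (B_wwq n a hn ha) c g hg
      rw [← map_sum, ← map_mul, ← map_mul, ← map_add] at h
      exact h
    | zero => intro c; rw [mul_zero, map_zero]
    | add p q _ _ hp hq => intro c; rw [mul_add, map_add, hp, hq, add_zero]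
    | smul b p _ hp => intro c; rw [smul_eq_mul, ← mul_assoc]; exact hp _
  simpa using key 1

theorem thC_kill (ha : 1 ≤ a) (p : MvPolynomial (Fin n ⊕ Fin n) ℂ) (hp : p ∈ Ih n a hn) :
    thC n a hn p = 0 := by
  have key : ∀ c, thC n a hn (c * p) = 0 := by
    rw [Ih_eq] at hp
    induction hp using Submodule.span_induction with
    | mem g hg =>
      intro c
      obtain ⟨t, ht⟩ := killC n a hn (Ideal.Quotient.mk (JC n a hn))
        (esymm_mem n _ (E_le_JC n a hn))
        (Ideal.Quotient.eq_zero_iff_mem.2 (JC_x n a hn))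
        (Ideal.Quotient.eq_zero_iff_mem.2 (JC_pa n a hn))
        (Ideal.Quotient.eq_zero_iff_mem.2 (JC_ww n a hn ha)) c g hg
      have hnu := congrArg (Ideal.Quotient.mk (JC n a hn)) (nu_mul n hn)
      rw [map_mul, map_natCast, map_one] at hnu
      ext1 k
      change Ideal.Quotient.mk _ (im n a _ k - nu n * ∑ j, im n a _ j) = 0
      rw [map_sub, map_mul _ (nu n), map_sum, ht k]
      simp only [ht, Finset.sum_const, Finset.card_univ, Fintype.card_fin, nsmul_eq_mul]
      rw [← mul_assoc, hnu, one_mul, sub_self]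
    | zero => intro c; rw [mul_zero, map_zero]
    | add p q _ _ hp hq => intro c; rw [mul_add, map_add, hp, hq, add_zero]
    | smul b p _ hp => intro c; rw [smul_eq_mul, ← mul_assoc]; exact hp _
  simpa using key 1

/-- Conversely: the normal form. -/
theorem normal {R : Type} [CommRing R] (F : MvPolynomial (Fin n ⊕ Fin n) ℂ →+* R)
    (hF : ∀ g ∈ gens n a hn, F g = 0) (ha : 1 ≤ a)
    (p : MvPolynomial (Fin n ⊕ Fin n) ℂ) (hB : thB n a hn p = 0) (hC : thC n a hn p = 0) :
    F p = 0 := by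
  obtain ⟨ξ, hξ⟩ : ∃ ξ : MvPolynomial (Fin n) ℂ →+* R, ∀ r, ξ r = F (rename Sum.inl r) :=
    ⟨F.comp (rename Sum.inl : MvPolynomial (Fin n) ℂ →ₐ[ℂ] _).toRingHom, fun r => rfl⟩
  obtain ⟨η, hη⟩ : ∃ η : Fin n → R, ∀ k, η k = F (yv n k) := ⟨_, fun k => rfl⟩
  have R1 : ∀ k k', k ≠ k' → η k * η k' = 0 := by
    intro k k' h
    rw [hη, hη, ← map_mul]
    exact hF _ (Or.inl ⟨k, k', h, rfl⟩)
  have R2 : ∀ k, ξ (X ⟨0, hn⟩) * η k = 0 := by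
    intro k
    rw [hξ, hη, ← map_mul, ← xv_ren]
    exact hF _ (Or.inr (Or.inl ⟨k, rfl⟩))
  have R3 : ∀ k, ξ (pa n a) * η k = ξ (ww n) := by
    intro k
    rw [hξ, hη, hξ, ← map_mul, ← sub_eq_zero, ← map_sub]
    exact hF _ (Or.inr (Or.inr (Or.inl ⟨k, rfl⟩)))
  have R4 : ∑ k, η k = ξ (PP n a hn) := by
    simp only [hη, hξ]
    rw [← map_sum, ← sub_eq_zero, ← map_sub]
    exact hF _ (Or.inr (Or.inr (Or.inr (Or.inl rfl))))
  have R5 : ∀ s ∈ Esym n, ξ s = 0 := by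
    intro s hs
    have : Esym n ≤ RingHom.ker ξ := by
      rw [Esym, Ideal.span_le]
      rintro _ ⟨i, h1, h2, rfl⟩
      change ξ _ = 0
      rw [hξ]
      exact hF _ (Or.inr (Or.inr (Or.inr (Or.inr ⟨i, h1, h2, rfl⟩))))
    exact this hs
  have KB : ∀ s ∈ JB n a hn, ξ s = 0 := by
    intro s hs
    have : JB n a hn ≤ RingHom.ker ξ := by
      refine sup_le R5 ?_
      rw [Ideal.span_singleton_le_iff_mem, prod_lin n a hn ha]
      change ξ _ = 0
      rw [map_mul, ← R4, Finset.mul_sum]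
      exact Finset.sum_eq_zero fun k _ => R2 k
    exact this hs
  have KC : ∀ k j, ∀ s ∈ JC n a hn, ξ s * (η k - η j) = 0 := by
    intro k j s hs
    have : JC n a hn ≤ Ideal.comap ξ (Submodule.annihilator (Ideal.span {η k - η j})) := by
      refine sup_le (sup_le ?_ ?_) ?_
      · intro s hs
        rw [Ideal.mem_comap, R5 s hs]
        exact zero_mem _
      · rw [Ideal.span_singleton_le_iff_mem, Ideal.mem_comap, Submodule.mem_annihilator_span_singleton,
          smul_eq_mul, mul_sub, R2, R2, sub_zero]
      · rw [Ideal.span_singleton_le_iff_mem, Ideal.mem_comap, Submodule.mem_annihilator_span_singleton,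
          smul_eq_mul, mul_sub]
        exact sub_eq_zero.2 ((R3 k).trans (R3 j).symm)
    have h := this hs
    rwa [Ideal.mem_comap, Submodule.mem_annihilator_span_singleton, smul_eq_mul] at h
  have R6 : ∀ k, η k * η k = ξ (qq n a) * η k := by
    intro k
    obtain ⟨d, hd⟩ := dvd_diff n hn
      (Finset.univ.filter (fun l : Fin n => 1 ≤ (l : ℕ) ∧ (l : ℕ) < a))
    have hd' : PP n a hn = qq n a + X ⟨0, hn⟩ * d := hd
    have h1 : (∑ j, η j) * η k = η k * η k := by
      rw [Finset.sum_mul, Finset.sum_eq_single k]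
      · intro j _ hj; exact R1 j k hj
      · simp
    rw [← h1, R4, hd', map_add, map_mul]
    linear_combination ξ d * R2 k
  have NF : ∀ p, F p = ξ (rr n p) + ∑ k, ξ (im n a p k) * η k := by
    intro p
    induction p using MvPolynomial.induction_on with
    | C c =>
      have : (C c : MvPolynomial (Fin n ⊕ Fin n) ℂ) = rename Sum.inl (C c) := (rename_C _ _).symm
      rw [this, rr_rename, hξ]
      simp only [im_rename]
      simp
    | add p q hp hq =>
      rw [map_add, hp, hq, map_add, map_add, map_add]
      simp only [Pi.add_apply, map_add, add_mul, Finset.sum_add_distrib]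
      ring
    | mul_X p i hp =>
      rw [map_mul, hp]
      cases i with
      | inl i =>
        have e : (X (Sum.inl i) : MvPolynomial (Fin n ⊕ Fin n) ℂ) = rename Sum.inl (X i) :=
          (rename_X _ _).symm
        rw [e, map_mul, rr_rename, ← hξ]
        simp only [im_mul, im_rename, rr_rename]
        simp only [mul_zero, zero_add, add_zero, map_mul, add_mul, Finset.sum_mul]
        congr 1
        refine Finset.sum_congr rfl fun k _ => ?_
        ring
      | inr j =>
        change (_ : R) * F (yv n j) = ξ (rr n (p * yv n j)) + ∑ k, ξ (im n a (p * yv n j) k) * η k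
        rw [map_mul, rr_y, ← hη, add_mul, Finset.sum_mul, Finset.sum_eq_single j,
          Finset.sum_eq_single j]
        · rw [im_mul, im_y, rr_y, if_pos rfl]
          simp only [map_add, map_mul, mul_zero, map_zero, mul_one, add_zero, zero_add]
          linear_combination ξ (im n a p j) * R6 j
        · intro k _ hk
          rw [im_mul, im_y, rr_y, if_neg hk]
          simp
        · simp
        · intro k _ hk
          rw [mul_assoc, R1 k j hk, mul_zero]
        · simp
  have hB' := KB _ (Ideal.Quotient.eq_zero_iff_mem.1 hB)
  have hC' := fun k => KC k ⟨0, hn⟩ _ (Ideal.Quotient.eq_zero_iff_mem.1 (congrFun hC k))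
  rw [NF p]
  rw [map_add, map_mul, map_mul, map_sum, ← R4] at hB'
  simp only [map_sub, map_mul, map_sum] at hC'
  have hs := Finset.sum_eq_zero (s := Finset.univ) fun k _ => hC' k
  have hnu := congrArg ξ (nu_mul n hn)
  rw [map_mul, map_natCast, map_one] at hnu
  simp only [sub_mul, mul_sub, Finset.sum_sub_distrib, ← Finset.sum_mul, ← Finset.mul_sum,
    Finset.sum_const, Finset.card_univ, Fintype.card_fin, nsmul_eq_mul] at hs
  linear_combination hB' + hs - (∑ i, ξ (im n a p i)) * η ⟨0, hn⟩ * hnu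

theorem mem_iff (ha : 1 ≤ a) (p : MvPolynomial (Fin n ⊕ Fin n) ℂ) :
    p ∈ Ih n a hn ↔ thB n a hn p = 0 ∧ thC n a hn p = 0 := by
  refine ⟨fun h => ⟨thB_kill n a hn ha p h, thC_kill n a hn ha p h⟩, fun h => ?_⟩
  rw [← Ideal.Quotient.eq_zero_iff_mem]
  refine normal n a hn (Ideal.Quotient.mk (Ih n a hn)) ?_ ha p h.1 h.2
  intro g hg
  rw [Ideal.Quotient.eq_zero_iff_mem, Ih_eq]
  exact Ideal.subset_span hg

theorem thB_ren (σ : Equiv.Perm (Fin n)) (p : MvPolynomial (Fin n ⊕ Fin n) ℂ) :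
    thB n a hn (ren n σ p) = thB n a hn p := by
  change Ideal.Quotient.mk _ _ = Ideal.Quotient.mk _ _
  rw [rr_ren]
  simp only [im_ren]
  rw [Equiv.sum_comp σ⁻¹ (fun k => im n a p k)]

theorem thC_ren (σ : Equiv.Perm (Fin n)) (p : MvPolynomial (Fin n ⊕ Fin n) ℂ) (k : Fin n) :
    thC n a hn (ren n σ p) k = thC n a hn p (σ⁻¹ k) := by
  change Ideal.Quotient.mk _ _ = Ideal.Quotient.mk _ _
  simp only [im_ren]
  rw [Equiv.sum_comp σ⁻¹ (fun k => im n a p k)]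

theorem thC_sum (p : MvPolynomial (Fin n ⊕ Fin n) ℂ) : ∑ k, thC n a hn p k = 0 := by
  have : ∀ k, thC n a hn p k =
    Ideal.Quotient.mk _ (im n a p k - nu n * ∑ j, im n a p j) := fun k => rfl
  simp only [this]
  rw [← map_sum, Finset.sum_sub_distrib, Finset.sum_const, Finset.card_univ, Fintype.card_fin,
    nsmul_eq_mul, ← mul_assoc, mul_comm (n : MvPolynomial (Fin n) ℂ), nu_mul n hn, one_mul,
    sub_self, map_zero]

theorem th_surj (b : MvPolynomial (Fin n) ℂ ⧸ JB n a hn)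
    (v : Fin n → MvPolynomial (Fin n) ℂ ⧸ JC n a hn) (hv : ∑ k, v k = 0) :
    ∃ p, thB n a hn p = b ∧ thC n a hn p = v := by
  obtain ⟨r, rfl⟩ := Ideal.Quotient.mk_surjective b
  choose s hs using fun k => Ideal.Quotient.mk_surjective (v k)
  let p : MvPolynomial (Fin n ⊕ Fin n) ℂ :=
    rename Sum.inl (r - nu n * PP n a hn * ∑ k, s k) + ∑ k, rename Sum.inl (s k) * yv n k
  have h1 : rr n p = r - nu n * PP n a hn * ∑ k, s k := by
    rw [map_add, rr_rename, map_sum]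
    simp only [rr_xy, Finset.sum_const_zero, add_zero]
  have h2 : ∀ k, im n a p k = s k := by
    intro k
    rw [map_add, Pi.add_apply, im_rename, map_sum, Finset.sum_apply]
    simp only [im_xy, Finset.sum_ite_eq, Finset.mem_univ, if_true, zero_add]
  refine ⟨p, ?_, ?_⟩
  · change Ideal.Quotient.mk _ _ = Ideal.Quotient.mk _ _
    rw [h1]
    simp only [h2, sub_add_cancel]
  · ext1 k
    change Ideal.Quotient.mk _ (im n a p k - nu n * ∑ j, im n a p j) = _
    simp only [h2]
    rw [map_sub, map_mul, map_sum]
    simp only [hs, hv, mul_zero, sub_zero]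

end Rel
theorem exists_equiv {P W : Type} [CommRing P] [Algebra ℂ P] [AddCommGroup W] [Module ℂ W]
    (I : Ideal P) (G : P →ₗ[ℂ] W) (hG : Function.Surjective G) (hI : ∀ p, p ∈ I ↔ G p = 0) :
    ∃ e : (P ⧸ I) ≃ₗ[ℂ] W, ∀ p, e (Ideal.Quotient.mk I p) = G p := by
  have h : Submodule.restrictScalars ℂ I = LinearMap.ker G := by
    ext p
    rw [Submodule.restrictScalars_mem, hI, LinearMap.mem_ker]
  exact ⟨(Submodule.Quotient.restrictScalarsEquiv ℂ I).symm ≪≫ₗ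
    Submodule.quotEquivOfEq _ _ h ≪≫ₗ G.quotKerEquivOfSurjective hG, fun p => rfl⟩

theorem exists_coord {V : Type} [AddCommGroup V] [Module ℂ V] {d : ℕ}
    (h : Module.length ℂ V = d) : Nonempty (V ≃ₗ[ℂ] (Fin d → ℂ)) := by
  obtain ⟨h1, h2⟩ := finrank_of_length h
  exact ⟨LinearEquiv.ofFinrankEq _ _ (by rw [h2, Module.finrank_fin_fun])⟩

theorem Ih_map (n a : ℕ) (hn : 0 < n) (ha : 1 ≤ a) (σ : Equiv.Perm (Fin n)) :
    Ih n a hn = (Ih n a hn).map (ren n σ : MvPolynomial (Fin n ⊕ Fin n) ℂ →+* _) := by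
  have key : ∀ p, ren n σ p ∈ Ih n a hn ↔ p ∈ Ih n a hn := by
    intro p
    rw [mem_iff n a hn ha, mem_iff n a hn ha, thB_ren]
    refine and_congr Iff.rfl ⟨fun h => ?_, fun h => ?_⟩
    · ext1 k
      have := thC_ren n a hn σ p (σ k)
      rw [h] at this
      simpa using this.symm
    · ext1 k
      rw [thC_ren, h]
      rfl
  apply le_antisymm
  · intro p hp
    have h : ren n σ ((ren n σ).symm p) = p := (ren n σ).apply_symm_apply p
    rw [← h]
    exact Ideal.mem_map_of_mem _ ((key _).1 (by rwa [h]))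
  · rw [Ideal.map_le_iff_le_comap]
    intro p hp
    exact (key p).2 hp

theorem stmt12 (n a : ℕ) (hn : 0 < n) (ha : 1 ≤ a) (han : a ≤ n) :
    ∃ act : Equiv.Perm (Fin n) → (A n a hn ≃ₐ[ℂ] A n a hn),
      (∀ σ τ : Equiv.Perm (Fin n), act (σ * τ) = (act τ).trans (act σ)) ∧
      (∀ (σ : Equiv.Perm (Fin n)) (i : Fin n),
        act σ (Ideal.Quotient.mk (Ih n a hn) (xv n i))
          = Ideal.Quotient.mk (Ih n a hn) (xv n i)) ∧
      (∀ (σ : Equiv.Perm (Fin n)) (k : Fin n),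
        act σ (Ideal.Quotient.mk (Ih n a hn) (yv n k))
          = Ideal.Quotient.mk (Ih n a hn) (yv n (σ k))) ∧
      ∃ e : A n a hn ≃ₗ[ℂ]
          ((Fin (a * Nat.factorial (n - 1)) → ℂ) ×
            (Fin ((n - a) * Nat.factorial (n - 2)) → Vstd n)),
        ∀ (σ : Equiv.Perm (Fin n)) (v : A n a hn),
          (e (act σ v)).1 = (e v).1 ∧
          ∀ (p : Fin ((n - a) * Nat.factorial (n - 2))) (i : Fin n),
            ((e (act σ v)).2 p : Fin n → ℂ) i = ((e v).2 p : Fin n → ℂ) (σ⁻¹ i) := by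
  let act : Equiv.Perm (Fin n) → (A n a hn ≃ₐ[ℂ] A n a hn) := fun σ =>
    Ideal.quotientEquivAlg (Ih n a hn) (Ih n a hn) (ren n σ) (Ih_map n a hn ha σ)
  have hact : ∀ σ p, act σ (Ideal.Quotient.mk (Ih n a hn) p) =
      Ideal.Quotient.mk (Ih n a hn) (ren n σ p) := fun σ p => rfl
  refine ⟨act, ?_, ?_, ?_, ?_⟩
  · intro σ τ
    ext v
    obtain ⟨p, rfl⟩ := Ideal.Quotient.mk_surjective v
    rw [AlgEquiv.trans_apply, hact, hact, hact]
    congr 1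
    simp only [ren, renameEquiv_apply, rename_rename]
    congr 2
    ext i
    cases i <;> simp
  · intro σ i
    rw [hact, ren_x]
  · intro σ k
    rw [hact, ren_y]
  · obtain ⟨bB⟩ := exists_coord (lenB n a hn han)
    obtain ⟨bC⟩ := exists_coord (lenC n a hn ha han)
    have hsum : ∀ p i, (fun k => bC (thC n a hn p k) i) ∈ Vstd n := by
      intro p i
      change ∑ k, bC (thC n a hn p k) i = 0
      rw [← Finset.sum_apply, ← map_sum, thC_sum, map_zero, Pi.zero_apply]
    let G : MvPolynomial (Fin n ⊕ Fin n) ℂ →ₗ[ℂ]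
      ((Fin (a * Nat.factorial (n - 1)) → ℂ) ×
            (Fin ((n - a) * Nat.factorial (n - 2)) → Vstd n)) :=
      { toFun := fun p => (bB (thB n a hn p), fun i => ⟨fun k => bC (thC n a hn p k) i, hsum p i⟩)
        map_add' := by
          intro p q
          refine Prod.ext ?_ ?_
          · change bB (thB n a hn (p + q)) = bB (thB n a hn p) + bB (thB n a hn q)
            rw [map_add, map_add]
          · funext i
            apply Subtype.ext
            funext k
            change bC (thC n a hn (p + q) k) i = bC (thC n a hn p k) i + bC (thC n a hn q k) i
            rw [map_add, Pi.add_apply, map_add, Pi.add_apply]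
        map_smul' := by
          intro c p
          refine Prod.ext ?_ ?_
          · change bB (thB n a hn (c • p)) = c • bB (thB n a hn p)
            rw [map_smul, map_smul]
          · funext i
            apply Subtype.ext
            funext k
            change bC (thC n a hn (c • p) k) i = c • bC (thC n a hn p k) i
            rw [map_smul, Pi.smul_apply, map_smul, Pi.smul_apply] }
    have hG1 : ∀ p, (G p).1 = bB (thB n a hn p) := fun p => rfl
    have hG2 : ∀ p i k, ((G p).2 i : Fin n → ℂ) k = bC (thC n a hn p k) i := fun p i k => rfl
    have hker : ∀ p, p ∈ Ih n a hn ↔ G p = 0 := by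
      intro p
      rw [mem_iff n a hn ha]
      constructor
      · rintro ⟨h1, h2⟩
        refine Prod.ext ?_ ?_
        · rw [hG1, h1, map_zero]; rfl
        · funext i
          apply Subtype.ext
          funext k
          rw [hG2, h2, Pi.zero_apply, map_zero]
          rfl
      · intro h
        constructor
        · apply bB.injective
          rw [← hG1, h, map_zero]; rfl
        · funext k
          apply bC.injective
          funext i
          rw [← hG2, h, Pi.zero_apply, map_zero]
          rfl
    have hsurj : Function.Surjective G := by
      rintro ⟨u, w⟩
      obtain ⟨p, h1, h2⟩ := th_surj n a hn (bB.symm u)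
        (fun k => bC.symm fun i => (w i : Fin n → ℂ) k) (by
          rw [← map_sum]
          have : (∑ k, fun i => (w i : Fin n → ℂ) k) = 0 := by
            funext i
            rw [Finset.sum_apply]
            exact (w i).2
          rw [this, map_zero])
      refine ⟨p, Prod.ext ?_ ?_⟩
      · rw [hG1, h1, LinearEquiv.apply_symm_apply]
      · funext i
        apply Subtype.ext
        funext k
        rw [hG2, h2, LinearEquiv.apply_symm_apply]
    obtain ⟨e, he⟩ := exists_equiv (Ih n a hn) G hsurj hker
    refine ⟨e, fun σ v => ?_⟩
    obtain ⟨p, rfl⟩ := Ideal.Quotient.mk_surjective v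
    rw [hact, he, he]
    refine ⟨?_, fun i k => ?_⟩
    · rw [hG1, hG1, thB_ren]
    · rw [hG2, hG2, thC_ren]

end Stmt12
end
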